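/- Let u : ℝ^{1+m} → ℝ^{1+m} be smooth, divergence-free, h-periodic in every coordinate, and mean-zero over its period cell, and let f : [0,1] → ℝ be Lipschitz with f(0) = f(1) = 0 and f(T) > 0 for all T ∈ (0,1). Let c, θ > 0 and p < 3 be such that f(T) ≥ c T^p for all T ∈ [0,θ]. Then: (a) if a classical solution T of T_t + u·∇T = ΔT + M f(T) with initial datum T₀ quenches, then T₀ ≡ 0; and (b) there exist 0 < γ₁ < γ₂ < ∞ such that every classical solution whose initial datum T₀ is compactly supported in x with 0 ≤ T₀ ≤ 1 and T₀ ≢ 0 satisfies lim_{t→∞} inf_{|x| ≤ γ₁ t, y ∈ ℝ^m} T(t,x,y) = 1 and lim_{t→∞} sup_{|x| ≥ γ₂ t, y ∈ ℝ^m} T(t,x,y) = 0. -/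

import Mathlib

open MeasureTheory
open scoped BigOperators

noncomputable section

/-- Partial derivative of `g : ℝ^N → ℝ` in the `i`-th coordinate direction. -/
def pd {N : ℕ} (i : Fin N) (g : (Fin N → ℝ) → ℝ) (z : Fin N → ℝ) : ℝ :=
  fderiv ℝ g z (Pi.single i 1)

/-- Laplacian of `g : ℝ^N → ℝ`. -/
def lap {N : ℕ} (g : (Fin N → ℝ) → ℝ) (z : Fin N → ℝ) : ℝ :=
  ∑ i, pd i (pd i g) z

/-- A classical solution of `T_t + u·∇T = ΔT + M f(T)` on the cylinder `ℝ×[0,h]^m`,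
viewed as a `[0,1]`-valued function on `ℝ^{1+m}` (coordinate `0` is `x`, the remaining `m`
coordinates are `y`), `h`-periodic in each of the last `m` spatial coordinates,
continuous on `[0,∞)×ℝ^{1+m}`, `C¹` in `t` and `C²` in the spatial variables for `t > 0`,
satisfying the equation pointwise for `t > 0` and `T(0,·) = T₀`. -/
structure IsCylSol (m : ℕ) (h M : ℝ) (u : (Fin (m+1) → ℝ) → Fin (m+1) → ℝ)
    (f : ℝ → ℝ) (T0 : (Fin (m+1) → ℝ) → ℝ) (T : ℝ → (Fin (m+1) → ℝ) → ℝ) : Prop where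
  cont : ContinuousOn (fun p : ℝ × (Fin (m+1) → ℝ) => T p.1 p.2) {p | 0 ≤ p.1}
  mem_Icc : ∀ t z, 0 ≤ t → T t z ∈ Set.Icc (0:ℝ) 1
  periodic : ∀ t z, 0 ≤ t → ∀ j : Fin m, T t (z + Pi.single j.succ h) = T t z
  timeDiff : ∀ t z, 0 < t → DifferentiableAt ℝ (fun s => T s z) t
  spaceC2 : ∀ t, 0 < t → ContDiff ℝ 2 (T t)
  eqn : ∀ t z, 0 < t →
    deriv (fun s => T s z) t + ∑ i, u z i * pd i (T t) z
      = lap (T t) z + M * f (T t z)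
  init : ∀ z, T 0 z = T0 z

/-- `T` quenches: `lim_{t→∞} sup_{(x,y)} T(t,x,y) = 0` (for nonnegative `T`). -/
def CylQuenches (m : ℕ) (T : ℝ → (Fin (m+1) → ℝ) → ℝ) : Prop :=
  ∀ ε > (0:ℝ), ∃ t₀ : ℝ, ∀ t ≥ t₀, ∀ z, T t z ≤ ε

/-- The plane wave `z ↦ exp(iω k·z)`. -/
def planeWave {N : ℕ} (ω : ℝ) (k : Fin N → ℤ) (z : Fin N → ℝ) : ℂ :=
  Complex.exp (Complex.I * ((ω * ∑ i, (k i : ℝ) * z i : ℝ) : ℂ))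

/-- The unit cell of the integer lattice. -/
def unitCell (N : ℕ) : Set (Fin N → ℝ) := {x | ∀ i, x i ∈ Set.Ioc (0 : ℝ) 1}

section Fourier

variable {N : ℕ}

lemma norm_planeWave (ω : ℝ) (k : Fin N → ℤ) (z : Fin N → ℝ) : ‖planeWave ω k z‖ = 1 := by
  rw [planeWave, mul_comm]; exact Complex.norm_exp_ofReal_mul_I _

lemma planeWave_zero (ω : ℝ) (z : Fin N → ℝ) : planeWave ω 0 z = 1 := by
  simp [planeWave]

lemma planeWave_add (ω : ℝ) (k l : Fin N → ℤ) (z : Fin N → ℝ) :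
    planeWave ω (k + l) z = planeWave ω k z * planeWave ω l z := by
  rw [planeWave, planeWave, planeWave, ← Complex.exp_add]
  congr 1
  simp only [Pi.add_apply, Int.cast_add, add_mul, Finset.sum_add_distrib, mul_add]
  push_cast
  ring

lemma planeWave_neg (ω : ℝ) (k : Fin N → ℤ) (z : Fin N → ℝ) :
    planeWave ω (-k) z = (starRingEnd ℂ) (planeWave ω k z) := by
  rw [planeWave, planeWave, ← Complex.exp_conj]
  congr 1
  simp

lemma planeWave_periodic {ω h : ℝ} (hω : ω * h = 2 * Real.pi) (k : Fin N → ℤ) (z : Fin N → ℝ)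
    (i : Fin N) : planeWave ω k (z + Pi.single i h) = planeWave ω k z := by
  have : ω * ∑ j, (k j : ℝ) * (z + Pi.single i h : Fin N → ℝ) j
      = ω * ∑ j, (k j : ℝ) * z j + (k i : ℝ) * (2 * Real.pi) := by
    simp only [Pi.add_apply, mul_add, Finset.sum_add_distrib, Pi.single_apply, mul_ite, mul_zero,
      Finset.sum_ite_eq', Finset.mem_univ, if_true]
    rw [← hω]; ring
  rw [planeWave, planeWave, this]
  push_cast
  rw [mul_add, Complex.exp_add]
  have h2 : Complex.exp (Complex.I * ((k i : ℂ) * (2 * Real.pi))) = 1 := by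
    rw [Complex.exp_eq_one_iff]; exact ⟨k i, by ring⟩
  rw [h2, mul_one]

lemma hasFDerivAt_planeWave (ω : ℝ) (k : Fin N → ℤ) (z : Fin N → ℝ) :
    HasFDerivAt (planeWave ω k)
      ((Complex.I * ω * planeWave ω k z) •
        (∑ i, (k i : ℂ) • (Complex.ofRealCLM.comp (ContinuousLinearMap.proj (R := ℝ) i)) :
          (Fin N → ℝ) →L[ℝ] ℂ)) z := by
  have h1 : HasFDerivAt (fun z : Fin N → ℝ => Complex.I * ((ω * ∑ i, (k i : ℝ) * z i : ℝ) : ℂ))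
      ((Complex.I * ω) •
        (∑ i, (k i : ℂ) • (Complex.ofRealCLM.comp (ContinuousLinearMap.proj (R := ℝ) i)) :
          (Fin N → ℝ) →L[ℝ] ℂ)) z := by
    have : (fun z : Fin N → ℝ => Complex.I * ((ω * ∑ i, (k i : ℝ) * z i : ℝ) : ℂ)) =
      ⇑((Complex.I * ω) •
        (∑ i, (k i : ℂ) • (Complex.ofRealCLM.comp (ContinuousLinearMap.proj (R := ℝ) i)) :
          (Fin N → ℝ) →L[ℝ] ℂ)) := by
      ext z
      simp [mul_assoc]
    rw [this]
    exact ContinuousLinearMap.hasFDerivAt _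
  have h2 := h1.cexp
  refine h2.congr_fderiv ?_
  rw [smul_smul]
  congr 1
  rw [planeWave]; ring

lemma contDiff_planeWave (ω : ℝ) (k : Fin N → ℤ) {n : WithTop ℕ∞} :
    ContDiff ℝ n (planeWave ω k) := by
  unfold planeWave
  have h0 : ContDiff ℝ n (fun z : Fin N → ℝ => (ω * ∑ i, (k i : ℝ) * z i : ℝ)) := by fun_prop
  exact (contDiff_const.mul (Complex.ofRealCLM.contDiff.comp h0)).cexp

lemma fderiv_planeWave_single (ω : ℝ) (k : Fin N → ℤ) (z : Fin N → ℝ) (j : Fin N) :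
    fderiv ℝ (planeWave ω k) z (Pi.single j 1) = Complex.I * ω * k j * planeWave ω k z := by
  rw [(hasFDerivAt_planeWave ω k z).fderiv]
  simp [Pi.single_apply, apply_ite Complex.ofReal]
  ring

lemma mFourier_coe (k : Fin N → ℤ) (x : Fin N → ℝ) :
    UnitAddTorus.mFourier k (fun i => (x i : UnitAddCircle)) = planeWave (2 * Real.pi) k x := by
  simp only [UnitAddTorus.mFourier, ContinuousMap.coe_mk, fourier_coe_apply, planeWave]
  rw [← Complex.exp_sum]
  congr 1
  push_cast
  rw [Finset.mul_sum, Finset.mul_sum]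
  refine Finset.sum_congr rfl fun i _ => ?_
  ring

lemma add_intCast_of_periodic {F : (Fin N → ℝ) → ℂ} (hp : ∀ z i, F (z + Pi.single i 1) = F z)
    (k : Fin N → ℤ) (z : Fin N → ℝ) : F (z + fun i => (k i : ℝ)) = F z := by
  have h1 : ∀ (i : Fin N) (n : ℤ) (z), F (z + Pi.single i (n : ℝ)) = F z := by
    intro i n
    induction n using Int.induction_on with
    | zero => simp
    | succ n ih =>
      intro z
      rw [Int.cast_add, Int.cast_one, Pi.single_add, ← add_assoc, hp]; exact ih z
    | pred n ih =>
      intro z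
      rw [← hp, Int.cast_sub, Int.cast_one, Pi.single_sub]
      rw [show z + (Pi.single i ((-(n : ℤ) : ℤ) : ℝ) - Pi.single i (1:ℝ)) + Pi.single i (1:ℝ)
        = z + Pi.single i ((-(n : ℤ) : ℤ) : ℝ) by abel]
      exact ih z
  have h2 : ∀ (s : Finset (Fin N)) z, F (z + ∑ i ∈ s, Pi.single i (k i : ℝ)) = F z := by
    intro s
    induction s using Finset.induction_on with
    | empty => simp
    | insert a s ha ih =>
      intro z
      rw [Finset.sum_insert ha, ← add_assoc, ih, h1]
  have := h2 Finset.univ z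
  rwa [Finset.univ_sum_single] at this

lemma exists_torus_lift {F : (Fin N → ℝ) → ℂ} (hF : Continuous F)
    (hp : ∀ z i, F (z + Pi.single i 1) = F z) :
    ∃ G : C(UnitAddTorus (Fin N), ℂ), ∀ x : Fin N → ℝ, G (fun i => (x i : UnitAddCircle)) = F x := by
  let π : (Fin N → ℝ) → UnitAddTorus (Fin N) := fun x i => (x i : UnitAddCircle)
  have hq : Topology.IsQuotientMap π := by
    have : IsOpenQuotientMap (Pi.map fun (_ : Fin N) (t : ℝ) => (t : UnitAddCircle)) :=
      IsOpenQuotientMap.piMap fun _ => QuotientAddGroup.isOpenQuotientMap_mk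
    exact this.isQuotientMap
  have hfac : ∀ x y, π x = π y → F x = F y := by
    intro x y hxy
    have : ∀ i, ∃ n : ℤ, x i = y i + n := by
      intro i
      have h1 : ((x i : ℝ) : UnitAddCircle) = y i := congrFun hxy i
      rw [← sub_eq_zero, ← AddCircle.coe_sub, AddCircle.coe_eq_zero_iff] at h1
      obtain ⟨n, hn⟩ := h1
      refine ⟨n, ?_⟩
      simp only [zsmul_eq_mul, mul_one] at hn
      linarith
    choose n hn using this
    have : x = y + fun i => (n i : ℝ) := by ext i; simp [hn i]
    rw [this, add_intCast_of_periodic hp]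
  choose s hs using hq.surjective
  have hG : (fun y => F (s y)) ∘ π = F := funext fun x => hfac _ _ (hs (π x))
  exact ⟨⟨fun y => F (s y), hq.continuous_iff.2 (by rw [hG]; exact hF)⟩,
    fun x => congrFun hG x⟩


lemma measurableSet_unitCell : MeasurableSet (unitCell N) :=
  MeasurableSet.univ_pi' fun _ => measurableSet_Ioc

lemma unitCell_subset_Icc : unitCell N ⊆ Set.Icc 0 1 :=
  fun _ hx => ⟨fun i => (hx i).1.le, fun i => (hx i).2⟩

lemma volume_unitCell_lt_top : volume (unitCell N) < ⊤ :=
  (measure_mono unitCell_subset_Icc).trans_lt isCompact_Icc.measure_lt_top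

instance : IsFiniteMeasure (volume.restrict (unitCell N)) :=
  ⟨by simpa using volume_unitCell_lt_top⟩

lemma integrableOn_unitCell {F : (Fin N → ℝ) → ℂ} (hF : Continuous F) :
    IntegrableOn F (unitCell N) :=
  (hF.continuousOn.integrableOn_compact isCompact_Icc).mono_set unitCell_subset_Icc

lemma setIntegral_unitCell_translate {F : (Fin N → ℝ) → ℂ} (hF : Continuous F)
    (hp : ∀ z i, F (z + Pi.single i 1) = F z) (v : Fin N → ℝ) :
    ∫ x in unitCell N, F (x + v) = ∫ x in unitCell N, F x := by
  obtain ⟨G, hG⟩ := exists_torus_lift hF hp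
  have h1 : ∀ a : Fin N → ℝ, ∫ x in {x : Fin N → ℝ | ∀ i, x i ∈ Set.Ioc (a i) (a i + 1)}, F x
      = UnitAddTorus.mFourierCoeff G 0 := by
    intro a
    rw [UnitAddTorus.mFourierCoeff_eq_integral G 0 a]
    simp [hG, UnitAddTorus.mFourier_zero]
  have h2 : unitCell N = (fun x => x + v) ⁻¹'
      {x : Fin N → ℝ | ∀ i, x i ∈ Set.Ioc (v i) (v i + 1)} := by
    ext x
    simp [unitCell, add_comm (v _) 1]
  have h3 := h1 0
  simp only [Pi.zero_apply, zero_add] at h3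
  have h4 := (measurePreserving_add_right volume v).setIntegral_preimage_emb
    (measurableEmbedding_addRight v) F {x : Fin N → ℝ | ∀ i, x i ∈ Set.Ioc (v i) (v i + 1)}
  rw [← h2, h1 v, ← h3] at h4
  exact h4

lemma setIntegral_unitCell_fderiv {F : (Fin N → ℝ) → ℂ} (hF : ContDiff ℝ 1 F)
    (hp : ∀ z i, F (z + Pi.single i 1) = F z) (j : Fin N) :
    ∫ x in unitCell N, fderiv ℝ F x (Pi.single j 1) = 0 := by
  have hcd : Continuous fun x => fderiv ℝ F x (Pi.single j 1) :=
    (hF.continuous_fderiv one_ne_zero).clm_apply continuous_const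
  obtain ⟨C, hC⟩ := (isCompact_Icc (a := (-1 : Fin N → ℝ)) (b := 2)).exists_bound_of_continuousOn
    hcd.continuousOn
  have key := hasDerivAt_integral_of_dominated_loc_of_deriv_le
    (μ := volume.restrict (unitCell N)) (𝕜 := ℝ)
    (F := fun (s : ℝ) x => F (x + Pi.single j s))
    (F' := fun (s : ℝ) x => fderiv ℝ F (x + Pi.single j s) (Pi.single j 1))
    (x₀ := 0) (s := Metric.ball 0 1) (bound := fun _ => C) (Metric.ball_mem_nhds _ one_pos)
    (Filter.Eventually.of_forall fun s => by
      have : Continuous fun x : Fin N → ℝ => F (x + Pi.single j s) :=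
        hF.continuous.comp (by fun_prop)
      exact this.aestronglyMeasurable)
    (by simpa using (integrableOn_unitCell hF.continuous).integrable)
    (by simpa using hcd.aestronglyMeasurable)
    (by
      refine (ae_restrict_mem measurableSet_unitCell).mono fun x hx s hs => hC _ ?_
      rw [Metric.mem_ball, dist_zero_right, Real.norm_eq_abs, abs_lt] at hs
      constructor
      · intro i
        have := hx i
        by_cases hij : i = j
        · subst hij; simp; linarith [this.1]
        · simp [hij]; linarith [this.1]
      · intro i
        have := hx i
        by_cases hij : i = j
        · subst hij; simp; linarith [this.2]
        · simp [hij]; linarith [this.2])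
    (integrable_const _)
    (Filter.Eventually.of_forall fun x s _ => by
      have h1 : HasDerivAt (fun s : ℝ => x + Pi.single j s) (Pi.single j (1:ℝ)) s := by
        have : HasDerivAt (fun s : ℝ => (Pi.single j s : Fin N → ℝ)) (Pi.single j (1:ℝ)) s := by
          have := (ContinuousLinearMap.single ℝ (fun _ : Fin N => ℝ) j).hasDerivAt (x := s)
          exact this
        exact this.const_add x
      exact ((hF.differentiable one_ne_zero).differentiableAt.hasFDerivAt).comp_hasDerivAt s h1)
  have h2 := key.2
  simp only [setIntegral_unitCell_translate hF.continuous hp, Pi.single_zero, add_zero] at h2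
  exact h2.unique (hasDerivAt_const _ _)

/-- The Fourier coefficients of a function with period `1` in every coordinate. -/
def fourierCoef (F : (Fin N → ℝ) → ℂ) (k : Fin N → ℤ) : ℂ :=
  ∫ x in unitCell N, planeWave (2 * Real.pi) (-k) x * F x

lemma fourierCoef_fderiv {F : (Fin N → ℝ) → ℂ} (hF : ContDiff ℝ 1 F)
    (hp : ∀ z i, F (z + Pi.single i 1) = F z) (j : Fin N) (k : Fin N → ℤ) :
    fourierCoef (fun x => fderiv ℝ F x (Pi.single j 1)) k
      = Complex.I * (2 * Real.pi) * k j * fourierCoef F k := by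
  have hE : ContDiff ℝ 1 (planeWave (2 * Real.pi) (-k)) := contDiff_planeWave _ _
  have h0 := setIntegral_unitCell_fderiv (hE.mul hF) (fun z i => by
    rw [hp, planeWave_periodic (by ring)]) j
  have hcd : Continuous fun x => fderiv ℝ F x (Pi.single j 1) :=
    (hF.continuous_fderiv one_ne_zero).clm_apply continuous_const
  have h1 : ∀ x, fderiv ℝ (fun x => planeWave (2 * Real.pi) (-k) x * F x) x (Pi.single j 1)
      = planeWave (2 * Real.pi) (-k) x * fderiv ℝ F x (Pi.single j 1)
        - Complex.I * (2 * Real.pi) * k j * (planeWave (2 * Real.pi) (-k) x * F x) := by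
    intro x
    rw [fderiv_fun_mul (hE.differentiable one_ne_zero x) (hF.differentiable one_ne_zero x)]
    simp only [add_apply, smul_apply, smul_eq_mul,
      fderiv_planeWave_single]
    simp
    ring
  simp only [h1] at h0
  have i1 : Integrable (fun x => planeWave (2 * Real.pi) (-k) x * fderiv ℝ F x (Pi.single j 1))
      (volume.restrict (unitCell N)) := integrableOn_unitCell (hE.continuous.mul hcd)
  have i2 : Integrable (fun x => planeWave (2 * Real.pi) (-k) x * F x)
      (volume.restrict (unitCell N)) := integrableOn_unitCell (hE.continuous.mul hF.continuous)
  rw [integral_sub i1 (i2.const_mul _), integral_const_mul, sub_eq_zero] at h0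
  exact h0

lemma exists_norm_fourierCoef_le (F : (Fin N → ℝ) → ℂ) :
    ∃ C, ∀ k, ‖fourierCoef F k‖ ≤ C := by
  refine ⟨∫ x in unitCell N, ‖F x‖, fun k => (norm_integral_le_integral_norm _).trans_eq ?_⟩
  simp [norm_planeWave]

lemma exists_pow_mul_norm_fourierCoef_le (j : Fin N) (n : ℕ) : ∀ {F : (Fin N → ℝ) → ℂ}
    (_hF : ContDiff ℝ (⊤ : ℕ∞) F) (_hp : ∀ z i, F (z + Pi.single i 1) = F z),
    ∃ C, ∀ k : Fin N → ℤ, |(k j : ℝ)| ^ n * ‖fourierCoef F k‖ ≤ C := by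
  induction n with
  | zero => intro F _ _; simpa using exists_norm_fourierCoef_le F
  | succ n ih =>
    intro F hF hp
    have hF' : ContDiff ℝ (⊤ : ℕ∞) fun x => fderiv ℝ F x (Pi.single j 1) :=
      (hF.fderiv_right (m := (⊤ : ℕ∞)) (by norm_num)).clm_apply contDiff_const
    obtain ⟨C, hC⟩ := ih hF' fun z i => by
      have : F = fun x => F (x + Pi.single i 1) := funext fun x => (hp x i).symm
      conv_rhs => rw [this]
      rw [fderiv_comp_add_right]
    refine ⟨C, fun k => le_trans ?_ (hC k)⟩
    rw [fourierCoef_fderiv (hF.of_le (by exact_mod_cast le_top)) hp]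
    simp only [norm_mul, Complex.norm_I, Complex.norm_intCast, Complex.norm_real, one_mul,
      Complex.norm_ofNat, Real.norm_eq_abs, abs_of_pos Real.pi_pos]
    have h1 : (1:ℝ) ≤ 2 * Real.pi := by linarith [Real.pi_gt_three]
    have h2 : 0 ≤ |(k j : ℝ)| ^ n * (|(k j : ℝ)| * ‖fourierCoef F k‖) := by positivity
    rw [pow_succ]
    nlinarith

lemma summable_prod_comp {g : ℤ → ℝ} (hg0 : ∀ n, 0 ≤ g n) (hg : Summable g) :
    Summable fun k : Fin N → ℤ => ∏ i, g (k i) := by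
  classical
  refine summable_of_sum_le (c := (∑' n, g n) ^ N)
    (fun k => Finset.prod_nonneg fun i _ => hg0 _) fun s => ?_
  have hs : s ⊆ Fintype.piFinset fun i => s.image fun k => k i := fun k hk =>
    Fintype.mem_piFinset.2 fun i => Finset.mem_image_of_mem _ hk
  refine (Finset.sum_le_sum_of_subset_of_nonneg hs fun k _ _ =>
    Finset.prod_nonneg fun i _ => hg0 _).trans ?_
  rw [← Finset.prod_univ_sum]
  refine (Finset.prod_le_prod (fun i _ => Finset.sum_nonneg fun n _ => hg0 n)
    fun i _ => hg.sum_le_tsum _ fun n _ => hg0 n).trans_eq ?_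
  simp

lemma summable_inv_one_add_sq_int : Summable fun n : ℤ => (1 + (n : ℝ) ^ 2)⁻¹ := by
  have h1 : Summable fun n : ℤ => 1 / (n : ℝ) ^ 2 := Real.summable_one_div_int_pow.2 one_lt_two
  refine Summable.of_norm_bounded_eventually h1 ?_
  filter_upwards [(Set.finite_singleton (0 : ℤ)).compl_mem_cofinite] with n hn
  have hn' : (n : ℝ) ≠ 0 := by simpa using hn
  rw [Real.norm_of_nonneg (by positivity), one_div]
  exact inv_anti₀ (by positivity) (by linarith)

lemma summable_fourierCoef {F : (Fin N → ℝ) → ℂ} (hF : ContDiff ℝ (⊤ : ℕ∞) F)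
    (hp : ∀ z i, F (z + Pi.single i 1) = F z) : Summable fun k => ‖fourierCoef F k‖ := by
  have h1 := fun j => exists_pow_mul_norm_fourierCoef_le j (2 * N) hF hp
  obtain ⟨C0, hC0⟩ := exists_norm_fourierCoef_le F
  choose C hC using h1
  have hCn : ∀ j, 0 ≤ C j := fun j => le_trans (by positivity) (hC j 0)
  refine Summable.of_nonneg_of_le (fun _ => norm_nonneg _) (fun k => ?_)
    ((summable_prod_comp (N := N) (fun n => by positivity) summable_inv_one_add_sq_int).mul_left
      (2 ^ N * (C0 + (∑ j, C j + C0))))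
  rw [Finset.prod_inv_distrib, ← div_eq_mul_inv, le_div_iff₀ (Finset.prod_pos fun i _ => by positivity)]
  have hk : ∀ i, (k i : ℝ) ^ 2 ≤ ‖k‖ ^ 2 := fun i => by
    have := norm_le_pi_norm k i
    rw [Int.norm_eq_abs] at this
    rw [← sq_abs]
    gcongr
  have hprod : ∏ i, (1 + (k i : ℝ) ^ 2) ≤ (1 + ‖k‖ ^ 2) ^ N := by
    refine (Finset.prod_le_prod (fun i _ => by positivity)
      fun i _ => add_le_add_right (hk i) 1).trans_eq ?_
    simp
  have hsum : (1 + ‖k‖ ^ 2) ^ N ≤ 2 ^ N * (1 + ‖k‖ ^ (2 * N)) := by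
    rcases le_total (‖k‖ ^ 2) 1 with h | h
    · calc (1 + ‖k‖ ^ 2) ^ N ≤ 2 ^ N := by gcongr; linarith
        _ ≤ _ := le_mul_of_one_le_right (by positivity) (by simp)
    · calc (1 + ‖k‖ ^ 2) ^ N ≤ (2 * ‖k‖ ^ 2) ^ N := by gcongr; linarith
        _ = 2 ^ N * ‖k‖ ^ (2 * N) := by rw [mul_pow, pow_mul]
        _ ≤ _ := by gcongr; linarith
  have hmax : ‖k‖ ^ (2 * N) * ‖fourierCoef F k‖ ≤ ∑ j, C j + C0 := by
    rcases N.eq_zero_or_pos with rfl | hN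
    · simpa using hC0 k
    · have : Nonempty (Fin N) := ⟨⟨0, hN⟩⟩
      obtain ⟨j, hj⟩ := Finite.exists_max fun i => ‖k i‖
      have h2 : ‖k‖ = ‖k j‖ := le_antisymm ((pi_norm_le_iff_of_nonneg (norm_nonneg _)).2 hj)
        (norm_le_pi_norm k j)
      have hC0' : 0 ≤ C0 := le_trans (norm_nonneg _) (hC0 k)
      rw [h2, Int.norm_eq_abs]
      refine ((hC j k).trans ?_).trans (le_add_of_nonneg_right hC0')
      exact (Finset.single_le_sum (fun i _ => hCn i) (Finset.mem_univ j))
  calc ‖fourierCoef F k‖ * ∏ i, (1 + (k i : ℝ) ^ 2)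
      ≤ ‖fourierCoef F k‖ * (2 ^ N * (1 + ‖k‖ ^ (2 * N))) := by gcongr; exact hprod.trans hsum
    _ = 2 ^ N * (‖fourierCoef F k‖ + ‖k‖ ^ (2 * N) * ‖fourierCoef F k‖) := by ring
    _ ≤ 2 ^ N * (C0 + (∑ j, C j + C0)) := by gcongr; exact hC0 k

lemma hasSum_fourierCoef {F : (Fin N → ℝ) → ℂ} (hF : ContDiff ℝ (⊤ : ℕ∞) F)
    (hp : ∀ z i, F (z + Pi.single i 1) = F z) (x : Fin N → ℝ) :
    HasSum (fun k => fourierCoef F k * planeWave (2 * Real.pi) k x) (F x) := by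
  obtain ⟨G, hG⟩ := exists_torus_lift hF.continuous hp
  have h1 : UnitAddTorus.mFourierCoeff G = fourierCoef F := by
    ext k
    rw [UnitAddTorus.mFourierCoeff_eq_integral G k 0]
    simp only [mFourier_coe, hG, Pi.zero_apply, zero_add, smul_eq_mul]
    rfl
  have h2 := UnitAddTorus.hasSum_mFourier_series_apply_of_summable (f := G)
    (by rw [h1]; exact (summable_fourierCoef hF hp).of_norm) (fun i => (x i : UnitAddCircle))
  simpa only [h1, mFourier_coe, hG, smul_eq_mul] using h2

lemma fourierCoef_neg_of_real {F : (Fin N → ℝ) → ℝ} (k : Fin N → ℤ) :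
    fourierCoef (fun x => (F x : ℂ)) (-k)
      = (starRingEnd ℂ) (fourierCoef (fun x => (F x : ℂ)) k) := by
  rw [fourierCoef, fourierCoef, ← integral_conj]
  simp [planeWave_neg]

open scoped Pointwise in
/-- Fourier expansion of a smooth periodic divergence-free vector field of mean zero. -/
theorem exists_fourier_expansion {h : ℝ} (hh : 0 < h) {u : (Fin N → ℝ) → Fin N → ℝ}
    (hu : ContDiff ℝ (⊤ : ℕ∞) u) (hdiv : ∀ z, ∑ i, pd i (fun w => u w i) z = 0)
    (hper : ∀ z (i : Fin N), u (z + Pi.single i h) = u z)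
    (hmean : ∀ i, ∫ z in Set.univ.pi fun _ : Fin N => Set.Ico (0:ℝ) h, u z i = 0) :
    ∃ a : Fin N → (Fin N → ℤ) → ℂ, (∀ j, Summable fun k => ‖a j k‖) ∧
      (∀ j z, HasSum (fun k => a j k * planeWave (2 * Real.pi / h) k z) (u z j : ℂ)) ∧
      (∀ j k, a j (-k) = (starRingEnd ℂ) (a j k)) ∧
      (∀ k, ∑ j, (k j : ℂ) * a j k = 0) ∧ ∀ j, a j 0 = 0 := by
  let G : Fin N → (Fin N → ℝ) → ℝ := fun j x => u (h • x) j
  have hGr : ∀ j, ContDiff ℝ (⊤ : ℕ∞) (G j) := fun j => by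
    have h1 : ContDiff ℝ (⊤ : ℕ∞) fun x : Fin N → ℝ => u (h • x) :=
      hu.comp (contDiff_const_smul h)
    exact contDiff_pi.1 h1 j
  let F : Fin N → (Fin N → ℝ) → ℂ := fun j x => (G j x : ℂ)
  have hF : ∀ j, ContDiff ℝ (⊤ : ℕ∞) (F j) := fun j =>
    Complex.ofRealCLM.contDiff.comp (hGr j)
  have hp : ∀ j z i, F j (z + Pi.single i 1) = F j z := fun j z i => by
    have : h • (z + Pi.single i (1:ℝ)) = h • z + Pi.single i h := by
      rw [smul_add, ← Pi.single_smul]; simp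
    simp only [F, G, this, hper]
  refine ⟨fun j => fourierCoef (F j), fun j => summable_fourierCoef (hF j) (hp j),
    fun j z => ?_, fun j k => fourierCoef_neg_of_real k, fun k => ?_, fun j => ?_⟩
  · have h1 := hasSum_fourierCoef (hF j) (hp j) (h⁻¹ • z)
    have h2 : ∀ k : Fin N → ℤ, planeWave (2 * Real.pi) k (h⁻¹ • z)
        = planeWave (2 * Real.pi / h) k z := fun k => by
      have : 2 * Real.pi * ∑ i, (k i : ℝ) * (h⁻¹ • z) i
          = 2 * Real.pi / h * ∑ i, (k i : ℝ) * z i := by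
        rw [Finset.mul_sum, Finset.mul_sum]
        refine Finset.sum_congr rfl fun i _ => ?_
        simp only [Pi.smul_apply, smul_eq_mul]; ring
      rw [planeWave, planeWave, this]
    simpa only [h2, F, G, smul_inv_smul₀ hh.ne'] using h1
  · have hdivF : ∀ x, ∑ j, fderiv ℝ (F j) x (Pi.single j 1) = 0 := fun x => by
      have h1 : ∀ j, fderiv ℝ (F j) x (Pi.single j 1)
          = ((h * pd j (fun w => u w j) (h • x) : ℝ) : ℂ) := fun j => by
        have hd : HasFDerivAt (fun w => u w j) (fderiv ℝ (fun w => u w j) (h • x)) (h • x) :=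
          ((contDiff_pi.1 hu j).differentiable (by simp) _).hasFDerivAt
        have hs : HasFDerivAt (fun x : Fin N → ℝ => h • x)
            (h • ContinuousLinearMap.id ℝ (Fin N → ℝ)) x :=
          (hasFDerivAt_id x).const_smul h
        have := (Complex.ofRealCLM.hasFDerivAt.comp x (hd.comp x hs)).fderiv
        have h3 : fderiv ℝ (F j) x = _ := this
        rw [h3]
        simp [pd]
      simp only [h1]
      rw [← Complex.ofReal_sum, ← Finset.mul_sum, hdiv, mul_zero, Complex.ofReal_zero]
    have h2 : ∑ j, fourierCoef (fun x => fderiv ℝ (F j) x (Pi.single j 1)) k = 0 := by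
      simp only [fourierCoef]
      rw [← integral_finsetSum]
      · simp only [← Finset.mul_sum, hdivF, mul_zero, integral_zero]
      · intro j _
        refine (integrableOn_unitCell ((contDiff_planeWave (n := 0) _ _).continuous.mul ?_)).integrable
        exact ((hF j).continuous_fderiv (by simp)).clm_apply continuous_const
    simp only [fun j => fourierCoef_fderiv ((hF j).of_le (by exact_mod_cast le_top)) (hp j) j k,
      mul_assoc] at h2
    rw [← Finset.mul_sum, ← Finset.mul_sum] at h2
    have h3 : (Complex.I * (2 * Real.pi : ℂ)) ≠ 0 := by simp [Real.pi_ne_zero]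
    refine (mul_eq_zero.1 ?_).resolve_left h3
    rw [mul_assoc, mul_assoc]
    simpa [Finset.mul_sum, mul_assoc] using h2
  · have h1 : fourierCoef (F j) 0 = ((∫ x in unitCell N, G j x : ℝ) : ℂ) := by
      simp only [fourierCoef, neg_zero, planeWave_zero, one_mul, F]
      exact integral_ofReal
    have h2 : ∫ x in unitCell N, G j x = 0 := by
      have h3 := Measure.setIntegral_comp_smul_of_pos volume (fun z => u z j) (unitCell N) hh
      have h4 : h • unitCell N = Set.univ.pi fun _ : Fin N => Set.Ioc (0:ℝ) h := by
        ext x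
        rw [Set.mem_smul_set_iff_inv_smul_mem₀ hh.ne']
        simp only [unitCell, Set.mem_ofPred_eq, Pi.smul_apply, smul_eq_mul, Set.mem_Ioc,
          Set.mem_univ_pi]
        refine forall_congr' fun i => ?_
        rw [inv_mul_le_iff₀ hh, mul_one]
        exact and_congr_left fun _ => by simp [hh]
      have h5 : ∫ z in Set.univ.pi fun _ : Fin N => Set.Ioc (0:ℝ) h, u z j
          = ∫ z in Set.univ.pi fun _ : Fin N => Set.Ico (0:ℝ) h, u z j := by
        refine setIntegral_congr_set ?_
        exact Measure.univ_pi_Ioc_ae_eq_Icc.trans Measure.univ_pi_Ico_ae_eq_Icc.symm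
      rw [h4, h5, hmean] at h3
      simpa using h3
    simp only [h1, h2, Complex.ofReal_zero]

end Fourier

/-- Absolutely summable sequences indexed by the integer lattice. -/
abbrev WienerSeq (N : ℕ) := lp (fun _ : Fin N → ℤ => ℂ) 1

namespace WienerSeq

variable {N : ℕ}

instance : Fact ((1 : ENNReal) ≤ 1) := ⟨le_rfl⟩

lemma summable_norm (b : WienerSeq N) : Summable fun k => ‖b k‖ := by
  simpa using (lp.hasSum_norm (by norm_num) b).summable

lemma norm_eq (b : WienerSeq N) : ‖b‖ = ∑' k, ‖b k‖ := by
  have := (lp.hasSum_norm (by norm_num) b).tsum_eq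
  simpa using this.symm

/-- The element of `WienerSeq` given by an absolutely summable family. -/
def ofSummable (c : (Fin N → ℤ) → ℂ) (hc : Summable fun k => ‖c k‖) : WienerSeq N :=
  ⟨c, memℓp_gen (by simpa using hc)⟩

@[simp] lemma ofSummable_apply (c : (Fin N → ℤ) → ℂ) (hc : Summable fun k => ‖c k‖)
    (k : Fin N → ℤ) : ofSummable c hc k = c k := rfl

/-- Multiplication by a bounded family, extended by zero to unbounded families. -/
def diag (d : (Fin N → ℤ) → ℂ) (C : ℝ) (hd : ∀ k, ‖d k‖ ≤ C) : WienerSeq N →L[ℂ] WienerSeq N :=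
  LinearMap.mkContinuous
    { toFun := fun b => ofSummable (fun k => d k * b k)
        (Summable.of_nonneg_of_le (fun _ => norm_nonneg _)
          (fun k => by rw [norm_mul]; exact mul_le_mul_of_nonneg_right (hd k) (norm_nonneg _))
          ((summable_norm b).mul_left C))
      map_add' := fun b c => by ext k; simp [mul_add]
      map_smul' := fun r b => by ext k; simp [mul_left_comm] }
    C fun b => by
      rw [norm_eq, norm_eq, ← tsum_mul_left]
      refine Summable.tsum_le_tsum (fun k => ?_) (summable_norm _) ((summable_norm b).mul_left C)
      simp only [LinearMap.coe_mk, AddHom.coe_mk, ofSummable_apply, norm_mul]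
      exact mul_le_mul_of_nonneg_right (hd k) (norm_nonneg _)

@[simp] lemma diag_apply (d : (Fin N → ℤ) → ℂ) (C : ℝ) (hd : ∀ k, ‖d k‖ ≤ C) (b : WienerSeq N)
    (k : Fin N → ℤ) : diag d C hd b k = d k * b k := rfl

lemma isCompactOperator_diag (d : (Fin N → ℤ) → ℂ) (C : ℝ) (hd : ∀ k, ‖d k‖ ≤ C)
    (h0 : Filter.Tendsto d Filter.cofinite (nhds 0)) : IsCompactOperator (diag d C hd) := by
  classical
  let F : Finset (Fin N → ℤ) → WienerSeq N →L[ℂ] WienerSeq N := fun s =>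
    ∑ k ∈ s, d k • (lp.singleContinuousLinearMap ℂ (fun _ : Fin N → ℤ => ℂ) 1 k).comp
      (lp.evalCLM ℂ (fun _ : Fin N → ℤ => ℂ) 1 k)
  have hF : ∀ s, IsCompactOperator (F s) := fun s => by
    refine (compactOperator (RingHom.id ℂ) (WienerSeq N) (WienerSeq N)).sum_mem fun k _ => ?_
    refine Submodule.smul_mem _ _ ?_
    have h1 : IsCompactOperator (lp.singleContinuousLinearMap ℂ (fun _ : Fin N → ℤ => ℂ) 1 k) :=
      isCompactOperator_of_locallyCompactSpace_rng (M₂ := ℂ) _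
    exact h1.comp_clm (lp.evalCLM ℂ (fun _ : Fin N → ℤ => ℂ) 1 k)
  refine isCompactOperator_of_tendsto (F := F) (l := Filter.atTop) ?_
    (Filter.Eventually.of_forall hF)
  rw [Metric.tendsto_atTop]
  intro ε hε
  have hfin : {k | ¬ ‖d k‖ < ε / 2}.Finite := by
    have := h0.norm
    rw [norm_zero] at this
    exact this.eventually (gt_mem_nhds (half_pos hε))
  refine ⟨hfin.toFinset, fun s hs => ?_⟩
  rw [dist_comm, dist_eq_norm]
  refine lt_of_le_of_lt (ContinuousLinearMap.opNorm_le_bound _ (half_pos hε).le fun b => ?_)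
    (half_lt_self hε)
  rw [norm_eq, norm_eq, ← tsum_mul_left]
  refine Summable.tsum_le_tsum (fun k => ?_) (summable_norm _) ((summable_norm b).mul_left _)
  have hk : F s b k = if k ∈ s then d k * b k else 0 := by
    have h1 : F s b k = ∑ l ∈ s, (d l • lp.single (E := fun _ : Fin N → ℤ => ℂ) 1 l (b l)) k := by
      have h2 : F s b = ∑ l ∈ s, d l • lp.single (E := fun _ : Fin N → ℤ => ℂ) 1 l (b l) := by
        simp only [F, FunLike.coe_sum, Finset.sum_apply]
        rfl
      rw [h2, lp.coeFn_sum, Finset.sum_apply]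
    rw [h1]
    simp [lp.single_apply, Pi.single_apply, Finset.sum_ite_eq]
  rw [_root_.sub_apply, lp.coeFn_sub, Pi.sub_apply, hk, diag_apply]
  split_ifs with hks
  · simp; positivity
  · have : ‖d k‖ < ε / 2 := by
      by_contra hcon
      exact hks (hs (hfin.mem_toFinset.2 hcon))
    rw [sub_zero, norm_mul]
    gcongr

/-- Translation of sequences. -/
def shift (l : Fin N → ℤ) : WienerSeq N →L[ℂ] WienerSeq N :=
  LinearMap.mkContinuous
    { toFun := fun b => ofSummable (fun k => b (k - l))
        ((Equiv.subRight l).summable_iff (f := fun k => ‖b k‖) |>.2 (summable_norm b))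
      map_add' := fun b c => rfl
      map_smul' := fun r b => rfl }
    1 fun b => by
      rw [norm_eq, norm_eq, one_mul]
      exact ((Equiv.subRight l).tsum_eq fun k => ‖b k‖).le

@[simp] lemma shift_apply (l : Fin N → ℤ) (b : WienerSeq N) (k : Fin N → ℤ) :
    shift l b k = b (k - l) := rfl

lemma norm_shift_le (l : Fin N → ℤ) : ‖(shift l : WienerSeq N →L[ℂ] WienerSeq N)‖ ≤ 1 :=
  LinearMap.mkContinuous_norm_le _ zero_le_one _

/-- Convolution with a fixed sequence. -/
def conv (a : WienerSeq N) : WienerSeq N →L[ℂ] WienerSeq N := ∑' l, a l • shift l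

lemma hasSum_conv (a : WienerSeq N) : HasSum (fun l => a l • shift l) (conv a) := by
  refine (Summable.of_norm_bounded (summable_norm a) fun l => ?_).hasSum
  rw [norm_smul]
  exact mul_le_of_le_one_right (norm_nonneg _) (norm_shift_le l)

lemma hasSum_conv_apply (a b : WienerSeq N) (k : Fin N → ℤ) :
    HasSum (fun l => a l * b (k - l)) (conv a b k) := by
  have h1 := (ContinuousLinearMap.apply ℂ (WienerSeq N) b).hasSum (hasSum_conv a)
  have h2 := (lp.evalCLM ℂ (fun _ : Fin N → ℤ => ℂ) 1 k).hasSum h1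
  exact h2

/-- The sum of the Fourier series with coefficients `b` at the point `z`. -/
def synth (ω : ℝ) (z : Fin N → ℝ) : WienerSeq N →L[ℂ] ℂ :=
  LinearMap.mkContinuous
    { toFun := fun b => ∑' k, b k * planeWave ω k z
      map_add' := fun b c => by
        have h (b : WienerSeq N) : Summable fun k => b k * planeWave ω k z :=
          .of_norm (by simpa [norm_planeWave] using (summable_norm b))
        rw [← (h b).tsum_add (h c)]
        simp [add_mul]
      map_smul' := fun r b => by simp [mul_assoc, tsum_mul_left] }
    1 fun b => by
      have h : Summable fun k => ‖b k * planeWave ω k z‖ := by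
        simpa [norm_planeWave] using (summable_norm b)
      rw [one_mul, norm_eq]
      simpa [norm_planeWave] using norm_tsum_le_tsum_norm h

lemma hasSum_synth (ω : ℝ) (z : Fin N → ℝ) (b : WienerSeq N) :
    HasSum (fun k => b k * planeWave ω k z) (synth ω z b) :=
  (Summable.of_norm (by simpa [norm_planeWave] using (summable_norm b))).hasSum

lemma synth_shift (ω : ℝ) (z : Fin N → ℝ) (l : Fin N → ℤ) (b : WienerSeq N) :
    synth ω z (shift l b) = planeWave ω l z * synth ω z b := by
  refine (hasSum_synth ω z (shift l b)).unique ?_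
  have h1 := (hasSum_synth ω z b).mul_left (planeWave ω l z)
  rw [← (Equiv.subRight l).hasSum_iff] at h1
  refine h1.congr_fun fun k => ?_
  simp only [Function.comp, Equiv.subRight_apply, shift_apply]
  conv_lhs => rw [← sub_add_cancel k l, planeWave_add]
  simp
  ring

lemma synth_conv (ω : ℝ) (z : Fin N → ℝ) (a b : WienerSeq N) :
    synth ω z (conv a b) = synth ω z a * synth ω z b := by
  have h1 := (ContinuousLinearMap.apply ℂ (WienerSeq N) b).hasSum (hasSum_conv a)
  have h2 := (synth ω z).hasSum h1
  refine h2.unique ?_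
  have h3 := (hasSum_synth ω z a).mul_right (synth ω z b)
  refine h3.congr_fun fun k => ?_
  simp [synth_shift, mul_assoc]

/-- The squared Euclidean length of a frequency. -/
def sqLen (k : Fin N → ℤ) : ℝ := ∑ i, (k i : ℝ) ^ 2

/-- The symbol of `∂ⱼ Δ⁻¹`. -/
def rieszSymbol (ω : ℝ) (j : Fin N) (k : Fin N → ℤ) : ℂ := -(Complex.I * k j) / (ω * sqLen k)

lemma sq_le_sqLen (k : Fin N → ℤ) (j : Fin N) : (k j : ℝ) ^ 2 ≤ sqLen k :=
  Finset.single_le_sum (f := fun i => (k i : ℝ) ^ 2) (fun _ _ => sq_nonneg _) (Finset.mem_univ j)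

lemma one_le_sqLen {k : Fin N → ℤ} (hk : k ≠ 0) : 1 ≤ sqLen k := by
  obtain ⟨j, hj⟩ := Function.ne_iff.1 hk
  refine le_trans ?_ (sq_le_sqLen k j)
  have : (1 : ℤ) ≤ (k j) ^ 2 := by
    have := sq_nonneg (k j)
    have h2 : (k j) ^ 2 ≠ 0 := pow_ne_zero 2 hj
    omega
  exact_mod_cast this

lemma sq_norm_le_sqLen (k : Fin N → ℤ) : ‖k‖ ^ 2 ≤ sqLen k := by
  have h0 : 0 ≤ sqLen k := Finset.sum_nonneg fun _ _ => sq_nonneg _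
  have : ‖k‖ ≤ √(sqLen k) := by
    refine (pi_norm_le_iff_of_nonneg (Real.sqrt_nonneg _)).2 fun j => ?_
    refine Real.le_sqrt_of_sq_le ?_
    rw [Int.norm_eq_abs, sq_abs]
    exact sq_le_sqLen k j
  calc ‖k‖ ^ 2 ≤ √(sqLen k) ^ 2 := by gcongr
    _ = sqLen k := Real.sq_sqrt h0

lemma norm_coord_le (k : Fin N → ℤ) (j : Fin N) : ‖(k j : ℂ)‖ ≤ ‖k‖ := by
  have := norm_le_pi_norm k j
  rwa [Int.norm_eq_abs, ← Complex.norm_intCast] at this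

lemma one_le_norm {k : Fin N → ℤ} (hk : k ≠ 0) : 1 ≤ ‖k‖ := by
  obtain ⟨j, hj⟩ := Function.ne_iff.1 hk
  refine le_trans ?_ (norm_le_pi_norm k j)
  rw [Int.norm_eq_abs]
  exact_mod_cast Int.one_le_abs hj

lemma norm_rieszSymbol_le (ω : ℝ) (j : Fin N) (k : Fin N → ℤ) :
    ‖rieszSymbol ω j k‖ ≤ |ω|⁻¹ * ‖k‖⁻¹ := by
  rcases eq_or_ne k 0 with rfl | hk
  · simp [rieszSymbol]
  have h1 := one_le_norm hk
  have h2 := sq_norm_le_sqLen k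
  have h3 := one_le_sqLen hk
  rw [rieszSymbol, norm_div, norm_neg, norm_mul, norm_mul, Complex.norm_I, one_mul,
    Complex.norm_real, Complex.norm_real, Real.norm_eq_abs, Real.norm_eq_abs,
    abs_of_nonneg (zero_le_one.trans h3), div_mul_eq_div_div, div_eq_mul_inv, div_eq_mul_inv,
    mul_right_comm, mul_comm]
  refine mul_le_mul_of_nonneg_left ?_ (by positivity)
  rw [← div_eq_mul_inv, div_le_iff₀ (by linarith), inv_mul_eq_div, le_div_iff₀ (by linarith)]
  nlinarith [norm_coord_le k j]

lemma norm_rieszSymbol_le_inv (ω : ℝ) (j : Fin N) (k : Fin N → ℤ) :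
    ‖rieszSymbol ω j k‖ ≤ |ω|⁻¹ := by
  rcases eq_or_ne k 0 with rfl | hk
  · simp [rieszSymbol]
  exact (norm_rieszSymbol_le ω j k).trans
    (mul_le_of_le_one_right (by positivity) (inv_le_one_of_one_le₀ (one_le_norm hk)))

lemma tendsto_rieszSymbol (ω : ℝ) (j : Fin N) :
    Filter.Tendsto (rieszSymbol ω j) Filter.cofinite (nhds 0) := by
  refine squeeze_zero_norm (norm_rieszSymbol_le ω j) ?_
  rw [← mul_zero |ω|⁻¹, ← Filter.cocompact_eq_cofinite]
  exact (tendsto_inv_atTop_zero.comp (tendsto_norm_cocompact_atTop (E := Fin N → ℤ))).const_mul _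

/-- The operator `∂ⱼ Δ⁻¹`. -/
def riesz (ω : ℝ) (j : Fin N) : WienerSeq N →L[ℂ] WienerSeq N :=
  diag (rieszSymbol ω j) |ω|⁻¹ (norm_rieszSymbol_le_inv ω j)

/-- The operator `u·∇ Δ⁻¹`, for a vector field with coefficients `a`. -/
def drift (ω : ℝ) (a : Fin N → WienerSeq N) : WienerSeq N →L[ℂ] WienerSeq N :=
  ∑ j, (conv (a j)).comp (riesz ω j)

lemma isCompactOperator_drift (ω : ℝ) (a : Fin N → WienerSeq N) :
    IsCompactOperator (drift ω a) := by
  refine (compactOperator (RingHom.id ℂ) (WienerSeq N) (WienerSeq N)).sum_mem fun j _ => ?_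
  exact (isCompactOperator_diag _ _ (norm_rieszSymbol_le_inv ω j)
    (tendsto_rieszSymbol ω j)).clm_comp (conv (a j))

/-- The coefficients of `Δ⁻¹`. -/
def potential (ω : ℝ) (b : WienerSeq N) (k : Fin N → ℤ) : ℂ := -b k / (ω ^ 2 * sqLen k)

lemma riesz_apply (ω : ℝ) (hω : ω ≠ 0) (j : Fin N) (b : WienerSeq N) (k : Fin N → ℤ) :
    riesz ω j b k = Complex.I * ω * k j * potential ω b k := by
  rw [riesz, diag_apply, rieszSymbol, potential]
  have : (ω : ℂ) ≠ 0 := by exact_mod_cast hω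
  rcases eq_or_ne (sqLen k : ℂ) 0 with h | h
  · simp [h]
  · field_simp

lemma drift_apply (ω : ℝ) (a : Fin N → WienerSeq N) (b : WienerSeq N) :
    drift ω a b = ∑ j, conv (a j) (riesz ω j b) := by
  simp [drift]

/-- The Fourier matrix of `u·∇`, up to a constant. -/
def driftMatrix (a : Fin N → WienerSeq N) (k l : Fin N → ℤ) : ℂ := ∑ j, a j (k - l) * l j

lemma hasSum_drift (ω : ℝ) (hω : ω ≠ 0) (a : Fin N → WienerSeq N) (b : WienerSeq N)
    (k : Fin N → ℤ) :
    HasSum (fun l => driftMatrix a k l * (Complex.I * ω * potential ω b l)) (drift ω a b k) := by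
  have h1 : HasSum (fun l => ∑ j, a j l * riesz ω j b (k - l)) (drift ω a b k) := by
    rw [drift_apply, lp.coeFn_sum, Finset.sum_apply]
    exact hasSum_sum fun j _ => hasSum_conv_apply (a j) (riesz ω j b) k
  rw [← (Equiv.subLeft k).hasSum_iff] at h1
  refine h1.congr_fun fun l => ?_
  simp only [Function.comp, Equiv.subLeft_apply, sub_sub_cancel, driftMatrix, Finset.sum_mul,
    riesz_apply ω hω]
  exact Finset.sum_congr rfl fun j _ => by ring

section DivergenceFree

variable {a : Fin N → WienerSeq N}

lemma driftMatrix_zero_left (ha_div : ∀ k : Fin N → ℤ, ∑ j, (k j : ℂ) * a j k = 0)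
    (l : Fin N → ℤ) : driftMatrix a 0 l = 0 := by
  have := ha_div (-l)
  rw [driftMatrix, zero_sub, ← neg_eq_zero, ← this, ← Finset.sum_neg_distrib]
  exact Finset.sum_congr rfl fun j _ => by push_cast [Pi.neg_apply]; ring

lemma conj_driftMatrix (ha_conj : ∀ j k, a j (-k) = starRingEnd ℂ (a j k))
    (ha_div : ∀ k : Fin N → ℤ, ∑ j, (k j : ℂ) * a j k = 0)
    (k l : Fin N → ℤ) :
    starRingEnd ℂ (driftMatrix a l k) = driftMatrix a k l := by
  have h1 := ha_div (k - l)
  rw [← sub_eq_zero, ← h1, driftMatrix, driftMatrix, map_sum, ← Finset.sum_sub_distrib]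
  refine Finset.sum_congr rfl fun j _ => ?_
  rw [map_mul, ← ha_conj, neg_sub, map_intCast]
  push_cast [Pi.sub_apply]
  ring

lemma drift_zero (ha_div : ∀ k : Fin N → ℤ, ∑ j, (k j : ℂ) * a j k = 0)
    (ω : ℝ) (hω : ω ≠ 0) (b : WienerSeq N) : drift ω a b 0 = 0 := by
  refine (hasSum_drift ω hω a b 0).unique ?_
  simp [driftMatrix_zero_left ha_div, hasSum_zero]

lemma eq_zero_of_drift_eq (ha_conj : ∀ j k, a j (-k) = starRingEnd ℂ (a j k))
    (ha_div : ∀ k : Fin N → ℤ, ∑ j, (k j : ℂ) * a j k = 0)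
    (ω : ℝ) (hω : ω ≠ 0) {b : WienerSeq N} (hb : drift ω a b = b) :
    b = 0 := by
  have hb0 : b 0 = 0 := by rw [← hb]; exact drift_zero ha_div ω hω b
  set c := potential ω b with hc
  have hcn : ∀ k, ‖c k‖ ≤ (ω ^ 2)⁻¹ * ‖b‖ := fun k => by
    rcases eq_or_ne k 0 with rfl | hk
    · simp only [hc, potential, hb0]; simp; positivity
    have h3 := one_le_sqLen hk
    have h4 : ‖b k‖ ≤ ‖b‖ := lp.norm_apply_le_norm one_ne_zero b k
    simp only [hc, potential, norm_div, norm_neg, norm_mul, norm_pow, Complex.norm_real,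
      Real.norm_eq_abs, sq_abs, abs_of_nonneg (zero_le_one.trans h3)]
    rw [div_mul_eq_div_div, div_le_iff₀ (by linarith), div_eq_inv_mul, mul_assoc]
    gcongr
    nlinarith [norm_nonneg (b k), norm_nonneg b]
  let P : (Fin N → ℤ) × (Fin N → ℤ) → ℂ := fun x =>
    starRingEnd ℂ (c x.1) * (driftMatrix a x.1 x.2 * (Complex.I * ω * c x.2))
  have hP : Summable P := by
    have h1 : ∀ j, Summable fun x : (Fin N → ℤ) × (Fin N → ℤ) => a j x.1 * riesz ω j b x.2 :=
      fun j => summable_mul_of_summable_norm (summable_norm (a j)) (summable_norm _)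
    have h2 : Summable fun x : (Fin N → ℤ) × (Fin N → ℤ) =>
        ∑ j, ‖a j x.1 * riesz ω j b x.2‖ := summable_sum fun j _ => (h1 j).norm
    let e : (Fin N → ℤ) × (Fin N → ℤ) ≃ (Fin N → ℤ) × (Fin N → ℤ) :=
      { toFun := fun x => (x.1 - x.2, x.2)
        invFun := fun x => (x.1 + x.2, x.2)
        left_inv := fun x => by simp
        right_inv := fun x => by simp }
    have h3 := (e.summable_iff.2 h2).mul_left ((ω ^ 2)⁻¹ * ‖b‖)
    refine Summable.of_norm_bounded h3 fun x => ?_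
    simp only [P, norm_mul (starRingEnd ℂ _), RCLike.norm_conj]
    refine mul_le_mul (hcn _) ?_ (norm_nonneg _) (by positivity)
    simp only [driftMatrix, Finset.sum_mul]
    refine (norm_sum_le _ _).trans_eq (Finset.sum_congr rfl fun j _ => ?_)
    simp only [e, Equiv.coe_fn_mk, riesz_apply ω hω]
    congr 1
    ring
  have hsum : HasSum (fun k => starRingEnd ℂ (c k) * b k) (∑' x, P x) := by
    refine hP.hasSum.prod_fiberwise fun k => ?_
    have := (hasSum_drift ω hω a b k).mul_left (starRingEnd ℂ (c k))
    rwa [hb] at this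
  have hanti : starRingEnd ℂ (∑' x, P x) = -∑' x, P x := by
    rw [Complex.conj_tsum, ← tsum_neg, ← (Equiv.prodComm _ _).tsum_eq]
    refine tsum_congr fun x => ?_
    simp only [P, Equiv.prodComm_apply, Prod.fst_swap, Prod.snd_swap, map_mul, Complex.conj_conj,
      conj_driftMatrix ha_conj ha_div, Complex.conj_I, Complex.conj_ofReal]
    ring
  have hre : (∑' x, P x).re = 0 := by
    have := congrArg Complex.re hanti
    simp at this
    linarith
  have hsum2 : HasSum (fun k => ‖b k‖ ^ 2 / (ω ^ 2 * sqLen k)) 0 := by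
    have := (Complex.hasSum_re hsum).neg
    rw [hre, neg_zero] at this
    refine this.congr_fun fun k => ?_
    have h5 : starRingEnd ℂ (c k) * b k = ((-(‖b k‖ ^ 2 / (ω ^ 2 * sqLen k)) : ℝ) : ℂ) := by
      have h6 := Complex.conj_mul' (b k)
      simp only [hc, potential, map_div₀, map_neg, map_mul, map_pow, Complex.conj_ofReal]
      push_cast
      rw [← h6]
      ring
    rw [h5, Complex.ofReal_re, neg_neg]
  have hnn : ∀ k, 0 ≤ ‖b k‖ ^ 2 / (ω ^ 2 * sqLen k) := fun k => by
    have : 0 ≤ sqLen k := Finset.sum_nonneg fun _ _ => sq_nonneg _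
    positivity
  ext k
  rcases eq_or_ne k 0 with rfl | hk
  · simpa using hb0
  have h7 := congrFun ((hasSum_zero_iff_of_nonneg hnn).1 hsum2) k
  have h8 := one_le_sqLen hk
  have h9 : ω ^ 2 * sqLen k ≠ 0 := by positivity
  simpa [h9, hω, (zero_lt_one.trans_le h8).ne'] using h7

theorem exists_sub_drift_eq (ha_conj : ∀ j k, a j (-k) = starRingEnd ℂ (a j k))
    (ha_div : ∀ k : Fin N → ℤ, ∑ j, (k j : ℂ) * a j k = 0)
    (ω : ℝ) (hω : ω ≠ 0) {g : WienerSeq N} (hg : g 0 = 0) :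
    ∃ b : WienerSeq N, b - drift ω a b = g ∧ b 0 = 0 := by
  obtain h | h := (isCompactOperator_drift ω a).hasEigenvalue_or_mem_resolventSet one_ne_zero
  · obtain ⟨b, hb⟩ := h.exists_hasEigenvector
    have h1 := hb.apply_eq_smul
    rw [one_smul] at h1
    exact absurd (eq_zero_of_drift_eq ha_conj ha_div ω hω h1) hb.2
  · obtain ⟨w, hw⟩ := h
    have h1 : (1 - drift ω a) * (↑w⁻¹ : WienerSeq N →L[ℂ] WienerSeq N) = 1 := by
      have := w.mul_inv
      rw [hw] at this
      simpa using this
    refine ⟨(↑w⁻¹ : WienerSeq N →L[ℂ] WienerSeq N) g, ?_, ?_⟩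
    · simpa using DFunLike.congr_fun h1 g
    · have h2 := DFunLike.congr_fun h1 g
      have h3 := congrArg (fun b : WienerSeq N => b 0) h2
      simpa [drift_zero ha_div ω hω, hg] using h3

end DivergenceFree

/-- The real part of a Fourier series. -/
def reSynth (ω : ℝ) (e : WienerSeq N) (z : Fin N → ℝ) : ℝ := (synth ω z e).re

lemma norm_ofReal_comp_proj_le (i : Fin N) :
    ‖(Complex.ofRealCLM.comp (ContinuousLinearMap.proj (R := ℝ) i) : (Fin N → ℝ) →L[ℝ] ℂ)‖ ≤ 1 :=
  ContinuousLinearMap.opNorm_le_bound _ zero_le_one fun v => by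
    simpa using norm_le_pi_norm v i

lemma hasFDerivAt_reSynth (ω : ℝ) {e : WienerSeq N} {e' : Fin N → WienerSeq N}
    (h : ∀ j k, e' j k = Complex.I * ω * k j * e k) (z : Fin N → ℝ) :
    HasFDerivAt (reSynth ω e)
      (∑ j, reSynth ω (e' j) z • ContinuousLinearMap.proj (R := ℝ) (φ := fun _ : Fin N => ℝ) j) z := by
  let E : Fin N → ((Fin N → ℝ) →L[ℝ] ℂ) := fun i =>
    Complex.ofRealCLM.comp (ContinuousLinearMap.proj (R := ℝ) i)
  let f' : (Fin N → ℤ) → (Fin N → ℝ) → ((Fin N → ℝ) →L[ℝ] ℂ) := fun k z =>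
    ∑ j, (e' j k * planeWave ω k z) • E j
  have h1 : ∀ k z, HasFDerivAt (fun z => e k * planeWave ω k z) (f' k z) z := fun k z => by
    refine ((hasFDerivAt_planeWave ω k z).const_mul (e k)).congr_fderiv ?_
    simp only [f', Finset.smul_sum, smul_smul, h, E]
    exact Finset.sum_congr rfl fun j _ => by congr 1; ring
  have h2 : ∀ k z, ‖f' k z‖ ≤ ∑ j, ‖e' j k‖ := fun k z => by
    refine (norm_sum_le _ _).trans (Finset.sum_le_sum fun j _ => ?_)
    rw [norm_smul, norm_mul, norm_planeWave, mul_one]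
    exact mul_le_of_le_one_right (norm_nonneg _) (norm_ofReal_comp_proj_le j)
  have h3 := hasFDerivAt_tsum (summable_sum fun j _ => summable_norm (e' j)) h1 h2
    (hasSum_synth ω z e).summable z
  have h4 : ∑' k, f' k z = ∑ j, synth ω z (e' j) • E j :=
    (hasSum_sum fun j _ => (hasSum_synth ω z (e' j)).smul_const (E j)).tsum_eq
  rw [h4] at h3
  have h5 := Complex.reCLM.hasFDerivAt.comp z h3
  refine h5.congr_fderiv ?_
  ext v
  simp [E, reSynth]

lemma pd_reSynth (ω : ℝ) {e : WienerSeq N} {e' : Fin N → WienerSeq N}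
    (h : ∀ j k, e' j k = Complex.I * ω * k j * e k) (j : Fin N) :
    pd j (reSynth ω e) = reSynth ω (e' j) := by
  funext z
  rw [pd, (hasFDerivAt_reSynth ω h z).fderiv]
  simp [Pi.single_apply]

lemma continuous_reSynth (ω : ℝ) (e : WienerSeq N) : Continuous (reSynth ω e) := by
  refine Complex.continuous_re.comp ?_
  have : Continuous fun z : Fin N → ℝ => ∑' k, e k * planeWave ω k z :=
    continuous_tsum (fun k => continuous_const.mul (contDiff_planeWave ω k (n := 0)).continuous)
      (summable_norm e) fun k z => by rw [norm_mul, norm_planeWave, mul_one]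
  exact this

lemma contDiff_one_reSynth (ω : ℝ) {e : WienerSeq N} {e' : Fin N → WienerSeq N}
    (h : ∀ j k, e' j k = Complex.I * ω * k j * e k) : ContDiff ℝ 1 (reSynth ω e) := by
  rw [contDiff_one_iff_fderiv]
  refine ⟨fun z => (hasFDerivAt_reSynth ω h z).differentiableAt, ?_⟩
  rw [show fderiv ℝ (reSynth ω e) = fun z => _ from funext fun z => (hasFDerivAt_reSynth ω h z).fderiv]
  exact continuous_finsetSum _ fun j _ => (continuous_reSynth ω _).smul continuous_const

lemma contDiff_two_reSynth (ω : ℝ) {e : WienerSeq N} {e' : Fin N → WienerSeq N}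
    {e'' : Fin N → Fin N → WienerSeq N}
    (h : ∀ j k, e' j k = Complex.I * ω * k j * e k)
    (h' : ∀ i j k, e'' i j k = Complex.I * ω * k j * e' i k) : ContDiff ℝ 2 (reSynth ω e) := by
  rw [show (2 : WithTop ℕ∞) = 1 + 1 by norm_num, contDiff_succ_iff_fderiv]
  refine ⟨fun z => (hasFDerivAt_reSynth ω h z).differentiableAt, by simp, ?_⟩
  rw [show fderiv ℝ (reSynth ω e) = fun z => _ from funext fun z => (hasFDerivAt_reSynth ω h z).fderiv]
  exact ContDiff.sum fun j _ => (contDiff_one_reSynth ω (h' j)).smul contDiff_const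

lemma reSynth_periodic {ω h : ℝ} (hω : ω * h = 2 * Real.pi) (e : WienerSeq N) (z : Fin N → ℝ)
    (i : Fin N) : reSynth ω e (z + Pi.single i h) = reSynth ω e z := by
  have h1 := hasSum_synth ω (z + Pi.single i h) e
  simp only [planeWave_periodic hω] at h1
  rw [reSynth, reSynth, h1.unique (hasSum_synth ω z e)]

/-- The coefficients of the complex conjugate. -/
def conjSeq (e : WienerSeq N) : WienerSeq N :=
  ofSummable (fun k => starRingEnd ℂ (e (-k))) (by
    simpa [Function.comp_def] using (Equiv.neg _).summable_iff.2 (summable_norm e))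

lemma synth_conjSeq (ω : ℝ) (e : WienerSeq N) (z : Fin N → ℝ) :
    synth ω z (conjSeq e) = starRingEnd ℂ (synth ω z e) := by
  refine (hasSum_synth ω z _).unique ?_
  have h1 := Complex.hasSum_conj'.2 (hasSum_synth ω z e)
  rw [← (Equiv.neg _).hasSum_iff] at h1
  refine h1.congr_fun fun k => ?_
  simp [conjSeq, planeWave_neg]

/-- The coefficients of the real part. -/
def rePart (e : WienerSeq N) : WienerSeq N := (1 / 2 : ℂ) • (e + conjSeq e)

lemma synth_rePart (ω : ℝ) (e : WienerSeq N) (z : Fin N → ℝ) :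
    synth ω z (rePart e) = reSynth ω e z := by
  rw [rePart, map_smul, map_add, synth_conjSeq, Complex.add_conj, reSynth]
  simp

lemma rePart_neg (e : WienerSeq N) (k : Fin N → ℤ) :
    rePart e (-k) = starRingEnd ℂ (rePart e k) := by
  have h (k : Fin N → ℤ) : rePart e k = (1 / 2 : ℂ) * (e k + starRingEnd ℂ (e (-k))) := rfl
  simp [h, add_comm, map_ofNat]

/-- The coefficients of the sum of the squares of the real parts. -/
def sqSum (e : Fin N → WienerSeq N) : WienerSeq N := ∑ i, conv (rePart (e i)) (rePart (e i))

lemma reSynth_sqSum (ω : ℝ) (e : Fin N → WienerSeq N) (z : Fin N → ℝ) :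
    reSynth ω (sqSum e) z = ∑ i, reSynth ω (e i) z ^ 2 := by
  simp only [reSynth, sqSum, map_sum, synth_conv, synth_rePart]
  simp [pow_two]

lemma sqSum_zero (e : Fin N → WienerSeq N) (i : Fin N) :
    ∃ r : ℝ, sqSum e 0 = r ∧ ‖rePart (e i) 0‖ ^ 2 ≤ r := by
  have h1 : ∀ i, HasSum (fun l => ((‖rePart (e i) l‖ ^ 2 : ℝ) : ℂ))
      (conv (rePart (e i)) (rePart (e i)) 0) := fun i => by
    refine (hasSum_conv_apply (rePart (e i)) (rePart (e i)) 0).congr_fun fun l => ?_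
    rw [zero_sub, rePart_neg, Complex.mul_conj']
    push_cast; rfl
  have h2 : ∀ i, Summable fun l => ‖rePart (e i) l‖ ^ 2 := fun i =>
    Complex.summable_ofReal.1 (h1 i).summable
  refine ⟨∑ i, ∑' l, ‖rePart (e i) l‖ ^ 2, ?_, ?_⟩
  · rw [sqSum, lp.coeFn_sum, Finset.sum_apply]
    push_cast
    exact Finset.sum_congr rfl fun i _ => by
      rw [← (h1 i).tsum_eq]; push_cast; rfl
  · refine le_trans ?_ (Finset.single_le_sum (fun i _ => tsum_nonneg fun l => sq_nonneg _)
      (Finset.mem_univ i))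
    exact (h2 i).le_tsum 0 fun _ _ => sq_nonneg _

/-- Solvability of the cell problem. -/
theorem exists_cell_solution {h : ℝ} (hh : 0 < h) {a : Fin N → WienerSeq N}
    {u : (Fin N → ℝ) → Fin N → ℝ}
    (hua : ∀ j z, synth (2 * Real.pi / h) z (a j) = (u z j : ℂ))
    (ha_conj : ∀ j k, a j (-k) = starRingEnd ℂ (a j k))
    (ha_div : ∀ k : Fin N → ℤ, ∑ j, (k j : ℂ) * a j k = 0)
    {g : WienerSeq N} (hg : g 0 = 0) :
    ∃ (c : WienerSeq N) (e : Fin N → WienerSeq N), ContDiff ℝ 2 (reSynth (2 * Real.pi / h) c) ∧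
      (∀ i, pd i (reSynth (2 * Real.pi / h) c) = reSynth (2 * Real.pi / h) (e i)) ∧
      (∀ i, e i 0 = 0) ∧
      ∀ z, lap (reSynth (2 * Real.pi / h) c) z - ∑ i, u z i * pd i (reSynth (2 * Real.pi / h) c) z
        = reSynth (2 * Real.pi / h) g z := by
  set ω := 2 * Real.pi / h with hω
  have hω0 : ω ≠ 0 := by have := Real.pi_pos; positivity
  obtain ⟨b, hb, hb0⟩ := exists_sub_drift_eq ha_conj ha_div ω hω0 hg
  have hωC : (ω : ℂ) ≠ 0 := by exact_mod_cast hω0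
  have hSC : ∀ {k : Fin N → ℤ}, k ≠ 0 → (sqLen k : ℂ) ≠ 0 := fun hk => by
    exact_mod_cast (zero_lt_one.trans_le (one_le_sqLen hk)).ne'
  have hc : ∀ k, ‖potential ω b k‖ ≤ (ω ^ 2)⁻¹ * ‖b k‖ := fun k => by
    rcases eq_or_ne k 0 with rfl | hk
    · simp [potential, hb0]
    have h3 := one_le_sqLen hk
    simp only [potential, norm_div, norm_neg, norm_mul, norm_pow, Complex.norm_real,
      Real.norm_eq_abs, sq_abs, abs_of_nonneg (zero_le_one.trans h3)]
    rw [div_mul_eq_div_div, div_le_iff₀ (by linarith), div_eq_inv_mul, mul_assoc]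
    gcongr
    nlinarith [norm_nonneg (b k)]
  let c : WienerSeq N := ofSummable (potential ω b)
    (Summable.of_nonneg_of_le (fun _ => norm_nonneg _) hc ((summable_norm b).mul_left _))
  let e : Fin N → WienerSeq N := fun j => riesz ω j b
  have he : ∀ j k, e j k = Complex.I * ω * k j * c k := fun j k => riesz_apply ω hω0 j b k
  have hd : ∀ i j k, ‖Complex.I * ω * k j * e i k‖ ≤ ‖b k‖ := fun i j k => by
    rcases eq_or_ne k 0 with rfl | hk
    · simp
    have h1 := norm_rieszSymbol_le ω i k
    have h2 := norm_coord_le k j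
    have h3 := one_le_norm hk
    rw [show e i k = rieszSymbol ω i k * b k from rfl, ← mul_assoc, norm_mul]
    refine mul_le_of_le_one_left (norm_nonneg _) ?_
    rw [norm_mul, norm_mul, norm_mul, Complex.norm_I, one_mul, Complex.norm_real,
      Real.norm_eq_abs]
    calc |ω| * ‖(k j : ℂ)‖ * ‖rieszSymbol ω i k‖ ≤ |ω| * ‖k‖ * (|ω|⁻¹ * ‖k‖⁻¹) := by gcongr
      _ = 1 := by
        have : |ω| ≠ 0 := abs_ne_zero.2 hω0
        field_simp
  let e' : Fin N → Fin N → WienerSeq N := fun i j => ofSummable (fun k => Complex.I * ω * k j * e i k)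
    (Summable.of_nonneg_of_le (fun _ => norm_nonneg _) (hd i j) (summable_norm b))
  have he' : ∀ i j k, e' i j k = Complex.I * ω * k j * e i k := fun i j k => rfl
  refine ⟨c, e, contDiff_two_reSynth ω he he', pd_reSynth ω he, ?_, ?_⟩
  · intro i
    rw [he]
    simp
  · intro z
    have h1 : ∑ i, e' i i = b := by
      ext k
      rw [lp.coeFn_sum, Finset.sum_apply]
      rcases eq_or_ne k 0 with rfl | hk
      · simp [he', hb0]
      have h4 : ∀ i, e' i i k = (k i : ℂ) ^ 2 * (b k / sqLen k) := fun i => by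
        have h5 := hSC hk
        rw [he', he]
        simp only [c, ofSummable_apply, potential]
        field_simp
        rw [Complex.I_sq]
        ring
      simp only [h4, ← Finset.sum_mul]
      rw [show ∑ i, (k i : ℂ) ^ 2 = (sqLen k : ℂ) by simp [sqLen]]
      field_simp [hSC hk]
    have h2 : lap (reSynth ω c) z = reSynth ω b z := by
      rw [lap, ← h1]
      simp only [pd_reSynth ω he, pd_reSynth ω (he' _), reSynth, map_sum, Complex.re_sum]
    have h3 : ∑ i, u z i * pd i (reSynth ω c) z = reSynth ω (drift ω a b) z := by
      simp only [pd_reSynth ω he, reSynth, drift_apply, map_sum, synth_conv, hua,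
        Complex.re_sum, Complex.re_ofReal_mul, e]
    rw [h2, h3, ← hb]
    simp [reSynth]

end WienerSeq

/-- A harmonic coordinate `X` and a second corrector `Y` for the operator `Δ - u·∇`. -/
structure Correctors {m : ℕ} (h : ℝ) (u : (Fin (m+1) → ℝ) → Fin (m+1) → ℝ)
    (X Y : (Fin (m+1) → ℝ) → ℝ) (α C : ℝ) : Prop where
  pos : 0 < α
  one_le : 1 ≤ C
  smoothX : ContDiff ℝ 2 X
  smoothY : ContDiff ℝ 2 Y
  periodicX : ∀ z (j : Fin m), X (z + Pi.single j.succ h) = X z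
  periodicY : ∀ z (j : Fin m), Y (z + Pi.single j.succ h) = Y z
  eqX : ∀ z, lap X z - ∑ i, u z i * pd i X z = 0
  eqY : ∀ z, lap Y z - ∑ i, u z i * pd i Y z = α - ∑ i, pd i X z ^ 2
  closeX : ∀ z, |X z - z 0| ≤ C
  boundY : ∀ z, |Y z| ≤ C
  bound_pdX : ∀ z i, |pd i X z| ≤ C
  bound_pdY : ∀ z i, |pd i Y z| ≤ C
  bound_u : ∀ z i, |u z i| ≤ C

open WienerSeq

lemma WienerSeq.abs_reSynth_le {N : ℕ} (ω : ℝ) (e : WienerSeq N) (z : Fin N → ℝ) :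
    |reSynth ω e z| ≤ ‖e‖ := by
  refine (Complex.abs_re_le_norm _).trans ?_
  have h1 := (synth ω z).le_of_opNorm_le (LinearMap.mkContinuous_norm_le _ zero_le_one _) e
  simpa using h1

lemma pd_add {N : ℕ} {f g : (Fin N → ℝ) → ℝ} {z : Fin N → ℝ} (hf : DifferentiableAt ℝ f z)
    (hg : DifferentiableAt ℝ g z) (i : Fin N) :
    pd i (fun z => f z + g z) z = pd i f z + pd i g z := by
  rw [pd, fderiv_fun_add hf hg]
  rfl

lemma pd_coord {N : ℕ} (i j : Fin N) (z : Fin N → ℝ) :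
    pd i (fun z : Fin N → ℝ => z j) z = if i = j then 1 else 0 := by
  rw [pd, show (fun z : Fin N → ℝ => z j) = ContinuousLinearMap.proj (R := ℝ)
    (φ := fun _ : Fin N => ℝ) j from rfl, ContinuousLinearMap.fderiv]
  simp [Pi.single_apply, eq_comm]

theorem exists_correctors {m : ℕ} {h : ℝ} (hh : 0 < h) {u : (Fin (m+1) → ℝ) → Fin (m+1) → ℝ}
    (hu : ContDiff ℝ (⊤ : ℕ∞) u) (hdiv : ∀ z, ∑ i, pd i (fun w => u w i) z = 0)
    (hper : ∀ z (i : Fin (m+1)), u (z + Pi.single i h) = u z)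
    (hmean : ∀ i, ∫ z in Set.univ.pi fun _ : Fin (m+1) => Set.Ico (0:ℝ) h, u z i = 0) :
    ∃ X Y α C, Correctors h u X Y α C := by
  obtain ⟨a', hs, hua', hconj, hdiv', hz⟩ := exists_fourier_expansion hh hu hdiv hper hmean
  set ω := 2 * Real.pi / h with hω
  have hωh : ω * h = 2 * Real.pi := by rw [hω]; field_simp
  let a : Fin (m+1) → WienerSeq (m+1) := fun j => ofSummable (a' j) (hs j)
  have hua : ∀ j z, synth ω z (a j) = (u z j : ℂ) := fun j z =>
    (hasSum_synth ω z (a j)).unique (hua' j z)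
  obtain ⟨c, e, hc2, hce, he0, hceq⟩ := exists_cell_solution hh (a := a) (g := a 0) hua hconj hdiv' (hz 0)
  simp only [← hω] at hc2 hce hceq
  let d : Fin (m+1) → WienerSeq (m+1) := fun i =>
    (if i = 0 then lp.single (E := fun _ : Fin (m+1) → ℤ => ℂ) 1 0 1 else 0) + e i
  let X : (Fin (m+1) → ℝ) → ℝ := fun z => z 0 + reSynth ω c z
  have hs1 : ∀ z, synth ω z (lp.single (E := fun _ : Fin (m+1) → ℤ => ℂ) 1 0 1) = 1 := fun z => by
    refine (hasSum_synth ω z _).unique ?_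
    convert hasSum_single (0 : Fin (m+1) → ℤ) ?_ using 1
    · simp [planeWave_zero]
    · intro k hk
      simp [lp.single_apply, hk]
  have hX2 : ContDiff ℝ 2 X := (contDiff_apply ℝ ℝ 0).add hc2
  have hpdX : ∀ i, pd i X = reSynth ω (d i) := fun i => by
    funext z
    rw [pd_add (differentiableAt_apply _ _) (hc2.differentiable (by norm_num) z), pd_coord, hce]
    simp only [d, reSynth, map_add, Complex.add_re]
    split_ifs <;> simp [hs1]
  obtain ⟨α, hα, hα1⟩ := sqSum_zero d 0
  have hα0 : 1 ≤ α := by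
    refine le_trans ?_ hα1
    have h1 : rePart (d 0) 0 = (1 / 2 : ℂ) * (d 0 0 + starRingEnd ℂ (d 0 (-0))) := rfl
    have h2 : d 0 0 = 1 := by
      have : d 0 0 = lp.single (E := fun _ : Fin (m+1) → ℤ => ℂ) 1 0 1 0 + e 0 0 := rfl
      rw [this, he0, lp.single_apply]; simp
    rw [h1, neg_zero, h2]; norm_num
  let g : WienerSeq (m+1) := (α : ℂ) • lp.single (E := fun _ : Fin (m+1) → ℤ => ℂ) 1 0 1 - sqSum d
  have hg0 : g 0 = 0 := by
    have : g 0 = (α : ℂ) * lp.single (E := fun _ : Fin (m+1) → ℤ => ℂ) 1 0 1 0 - sqSum d 0 := rfl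
    rw [this, lp.single_apply, hα]; simp
  obtain ⟨c₂, e₂, hc22, hce₂, -, hceq₂⟩ := exists_cell_solution hh (a := a) (g := g) hua hconj hdiv' hg0
  simp only [← hω] at hc22 hce₂ hceq₂
  have hper' : ∀ (e : WienerSeq (m+1)) z (i : Fin (m+1)),
      reSynth ω e (z + Pi.single i h) = reSynth ω e z := fun e z i => reSynth_periodic hωh e z i
  let C : ℝ := 1 + ‖c‖ + ‖c₂‖ + ∑ i, ‖d i‖ + ∑ i, ‖e₂ i‖ + ∑ i, ‖a i‖
  have hle : ∀ (v : Fin (m+1) → WienerSeq (m+1)) i, ‖v i‖ ≤ ∑ i, ‖v i‖ := fun v i =>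
    Finset.single_le_sum (f := fun i => ‖v i‖) (fun _ _ => norm_nonneg _) (Finset.mem_univ i)
  have hnn : ∀ (v : Fin (m+1) → WienerSeq (m+1)), 0 ≤ ∑ i, ‖v i‖ := fun v =>
    Finset.sum_nonneg fun _ _ => norm_nonneg _
  have := hnn d; have := hnn e₂; have := hnn a; have := norm_nonneg c; have := norm_nonneg c₂
  refine ⟨X, reSynth ω c₂, α, C, by linarith, by simp only [C]; linarith, hX2, hc22, ?_,
    fun z j => hper' _ _ _, ?_, ?_, ?_, ?_, ?_, ?_, ?_⟩
  · intro z j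
    simp only [X, hper']
    simp
  · intro z
    have h1 := hceq z
    have h2 : lap X z = lap (reSynth ω c) z := by
      simp only [lap]
      refine Finset.sum_congr rfl fun i _ => ?_
      have h3 : pd i X = fun z => (if i = 0 then 1 else 0) + pd i (reSynth ω c) z := by
        funext z
        rw [pd_add (differentiableAt_apply _ _) (hc2.differentiable (by norm_num) z), pd_coord]
      rw [h3, pd, fderiv_const_add]
      rfl
    have h4 : ∑ i, u z i * pd i X z = u z 0 + ∑ i, u z i * pd i (reSynth ω c) z := by
      have : ∀ i, pd i X z = (if i = 0 then 1 else 0) + pd i (reSynth ω c) z := fun i => by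
        rw [pd_add (differentiableAt_apply _ _) (hc2.differentiable (by norm_num) z), pd_coord]
      simp only [this, mul_add, Finset.sum_add_distrib]
      simp
    rw [h2, h4]
    have h5 : reSynth ω (a 0) z = u z 0 := by rw [reSynth, hua, Complex.ofReal_re]
    rw [h5] at h1
    linarith
  · intro z
    rw [hceq₂ z]
    simp only [hpdX]
    rw [← reSynth_sqSum]
    simp [g, reSynth, hs1, -Complex.coe_smul]
  · intro z
    simp only [X, add_sub_cancel_left]
    refine (abs_reSynth_le _ _ _).trans ?_
    simp only [C]; linarith
  · intro z
    refine (abs_reSynth_le _ _ _).trans ?_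
    simp only [C]; linarith
  · intro z i
    rw [hpdX]
    refine (abs_reSynth_le _ _ _).trans ?_
    have := hle d i
    simp only [C]; linarith
  · intro z i
    rw [hce₂]
    refine (abs_reSynth_le _ _ _).trans ?_
    have := hle e₂ i
    simp only [C]; linarith
  · intro z i
    have h1 := abs_reSynth_le ω (a i) z
    rw [reSynth, hua, Complex.ofReal_re] at h1
    have := hle a i
    simp only [C]; linarith

section MaximumPrinciple

variable {N : ℕ}

lemma deriv_deriv_nonneg_of_isLocalMin {φ : ℝ → ℝ} {x : ℝ} (hc : ContinuousAt φ x)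
    (hmin : IsLocalMin φ x) : 0 ≤ deriv (deriv φ) x := by
  by_contra! hneg
  have hmax := isLocalMax_of_deriv_deriv_neg hneg hmin.deriv_eq_zero hc
  have heq : φ =ᶠ[nhds x] fun _ => φ x := by
    filter_upwards [hmin, hmax] with y h1 h2 using le_antisymm h2 h1
  have := heq.deriv.deriv_eq
  simp at this
  linarith

lemma hasDerivAt_line {g : (Fin N → ℝ) → ℝ} (hg : Differentiable ℝ g) (z : Fin N → ℝ) (i : Fin N)
    (s : ℝ) : HasDerivAt (fun s => g (z + s • Pi.single i 1)) (pd i g (z + s • Pi.single i 1)) s := by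
  have h1 : HasDerivAt (fun s : ℝ => z + s • (Pi.single i 1 : Fin N → ℝ)) (Pi.single i 1) s := by
    simpa using ((hasDerivAt_id s).smul_const (Pi.single i 1 : Fin N → ℝ)).const_add z
  exact (hg _).hasFDerivAt.comp_hasDerivAt s h1

lemma contDiff_pd {g : (Fin N → ℝ) → ℝ} (hg : ContDiff ℝ 2 g) (i : Fin N) :
    ContDiff ℝ 1 (pd i g) :=
  (hg.fderiv_right (m := 1) (by norm_num)).clm_apply contDiff_const

lemma lap_nonneg_of_isLocalMin {g : (Fin N → ℝ) → ℝ} (hg : ContDiff ℝ 2 g) {z : Fin N → ℝ}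
    (hmin : IsLocalMin g z) : 0 ≤ lap g z := by
  refine Finset.sum_nonneg fun i _ => ?_
  have h1 := hasDerivAt_line (hg.differentiable (by norm_num)) z i
  have h2 := hasDerivAt_line ((contDiff_pd hg i).differentiable (by norm_num)) z i
  have hd : deriv (fun s : ℝ => g (z + s • Pi.single i 1)) =
      fun s => pd i g (z + s • Pi.single i 1) := funext fun s => (h1 s).deriv
  have hmin' : IsLocalMin (fun s : ℝ => g (z + s • Pi.single i 1)) 0 := by
    have hc : Filter.Tendsto (fun s : ℝ => z + s • (Pi.single i 1 : Fin N → ℝ)) (nhds 0) (nhds z) := by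
      have : Continuous fun s : ℝ => z + s • (Pi.single i 1 : Fin N → ℝ) := by fun_prop
      simpa using this.tendsto 0
    have := hc.eventually hmin
    simpa [IsLocalMin, IsMinFilter] using this
  have h3 := deriv_deriv_nonneg_of_isLocalMin (h1 0).continuousAt hmin'
  rw [hd, (h2 0).deriv] at h3
  simpa using h3

lemma pd_eq_zero_of_isLocalMin {g : (Fin N → ℝ) → ℝ} {z : Fin N → ℝ}
    (hmin : IsLocalMin g z) (i : Fin N) : pd i g z = 0 := by
  rw [pd, hmin.fderiv_eq_zero]; rfl

lemma HasDerivAt.nonpos_of_forall_Icc_le {φ : ℝ → ℝ} {φ' a b : ℝ} (hab : a < b)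
    (h : HasDerivAt φ φ' b) (hle : ∀ s ∈ Set.Icc a b, φ b ≤ φ s) : φ' ≤ 0 := by
  have h1 := (hasDerivWithinAt_iff_tendsto_slope' (by simp : b ∉ Set.Iio b)).1
    (h.hasDerivWithinAt (s := Set.Iio b))
  refine le_of_tendsto h1 ?_
  filter_upwards [Ioo_mem_nhdsLT hab] with s hs
  rw [slope_def_field]
  exact div_nonpos_of_nonneg_of_nonpos (sub_nonneg.2 (hle s ⟨hs.1.le, hs.2.le⟩)) (by linarith [hs.2])

/-- A parabolic maximum principle for functions whose negative values are controlled on a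
compact set. -/
theorem parabolic_nonneg {t₀ t₁ κ : ℝ} {u : (Fin N → ℝ) → Fin N → ℝ}
    {D : ℝ → (Fin N → ℝ) → ℝ} {K : Set (Fin N → ℝ)} (hK : IsCompact K)
    (hcont : ContinuousOn (fun p : ℝ × (Fin N → ℝ) => D p.1 p.2) (Set.Icc t₀ t₁ ×ˢ Set.univ))
    (hinit : ∀ z, 0 ≤ D t₀ z)
    (hred : ∀ t ∈ Set.Icc t₀ t₁, ∀ z, D t z < 0 → ∃ z' ∈ K, D t z' ≤ D t z)
    (htime : ∀ t ∈ Set.Ioc t₀ t₁, ∀ z, DifferentiableAt ℝ (fun s => D s z) t)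
    (hspace : ∀ t ∈ Set.Ioc t₀ t₁, ContDiff ℝ 2 (D t))
    (hineq : ∀ t ∈ Set.Ioc t₀ t₁, ∀ z, D t z < 0 →
      κ * D t z ≤ deriv (fun s => D s z) t + ∑ i, u z i * pd i (D t) z - lap (D t) z) :
    ∀ t ∈ Set.Icc t₀ t₁, ∀ z, 0 ≤ D t z := by
  intro t ht z
  by_contra! hneg
  obtain ⟨z', hz', hle⟩ := hred t ht z hneg
  let G : ℝ × (Fin N → ℝ) → ℝ := fun p => Real.exp (-(κ + 1) * p.1) * D p.1 p.2
  have hG : ContinuousOn G (Set.Icc t₀ t₁ ×ˢ K) :=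
    (by fun_prop : Continuous fun p : ℝ × (Fin N → ℝ) => Real.exp (-(κ + 1) * p.1)).continuousOn.mul
      (hcont.mono (Set.prod_mono subset_rfl (Set.subset_univ _)))
  obtain ⟨⟨s, y⟩, ⟨hs, hy⟩, hmin⟩ := (isCompact_Icc.prod hK).exists_isMinOn ⟨(t, z'), ht, hz'⟩ hG
  have hsy : D s y < 0 := by
    have h1 : G (s, y) ≤ G (t, z') := hmin ⟨ht, hz'⟩
    have h2 : G (t, z') < 0 := mul_neg_of_pos_of_neg (Real.exp_pos _) (hle.trans_lt hneg)
    exact neg_of_mul_neg_right (h1.trans_lt h2) (Real.exp_pos _).le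
  have hst : t₀ < s := by
    refine lt_of_le_of_ne hs.1 fun h => ?_
    have := hinit y
    rw [h] at this
    linarith
  have hs' : s ∈ Set.Ioc t₀ t₁ := ⟨hst, hs.2⟩
  have hglob : IsLocalMin (D s) y := by
    refine Filter.Eventually.of_forall fun x => ?_
    rcases lt_or_ge (D s x) 0 with hx | hx
    · obtain ⟨x', hx', hxx⟩ := hred s hs x hx
      have h1 : G (s, y) ≤ G (s, x') := hmin ⟨hs, hx'⟩
      exact (le_of_mul_le_mul_left h1 (Real.exp_pos _)).trans hxx
    · exact hsy.le.trans hx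
  have hd := (htime s hs' y).hasDerivAt
  have he : HasDerivAt (fun s => Real.exp (-(κ + 1) * s)) (Real.exp (-(κ + 1) * s) * -(κ + 1)) s := by
    simpa using ((hasDerivAt_id s).const_mul (-(κ + 1))).exp
  have hnon := (he.mul hd).nonpos_of_forall_Icc_le hst fun r hr =>
    hmin (show (r, y) ∈ Set.Icc t₀ t₁ ×ˢ K from ⟨⟨hr.1, hr.2.trans hs.2⟩, hy⟩)
  have h3 := hineq s hs' y hsy
  have h4 := lap_nonneg_of_isLocalMin (hspace s hs') hglob
  simp only [pd_eq_zero_of_isLocalMin hglob, mul_zero, Finset.sum_const_zero, add_zero] at h3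
  have h5 : -(κ + 1) * D s y + deriv (fun s => D s y) s ≤ 0 := by
    refine nonpos_of_mul_nonpos_right ?_ (Real.exp_pos (-(κ + 1) * s))
    linarith
  nlinarith

end MaximumPrinciple

section Calculus

variable {N : ℕ}

/-- The operator `Δ - u·∇`. -/
def gen (u : (Fin N → ℝ) → Fin N → ℝ) (g : (Fin N → ℝ) → ℝ) (z : Fin N → ℝ) : ℝ :=
  lap g z - ∑ i, u z i * pd i g z

variable {f g : (Fin N → ℝ) → ℝ} {z : Fin N → ℝ}

lemma pd_sub (hf : DifferentiableAt ℝ f z) (hg : DifferentiableAt ℝ g z) (i : Fin N) :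
    pd i (fun z => f z - g z) z = pd i f z - pd i g z := by
  rw [pd, fderiv_fun_sub hf hg]
  rfl

lemma pd_mul (hf : DifferentiableAt ℝ f z) (hg : DifferentiableAt ℝ g z) (i : Fin N) :
    pd i (fun z => f z * g z) z = f z * pd i g z + g z * pd i f z := by
  rw [pd, fderiv_fun_mul hf hg]
  rfl

lemma pd_comp {φ : ℝ → ℝ} {φ' : ℝ} (hf : DifferentiableAt ℝ f z) (hφ : HasDerivAt φ φ' (f z))
    (i : Fin N) : pd i (fun z => φ (f z)) z = φ' * pd i f z := by
  have h : HasFDerivAt (fun z => φ (f z)) (φ' • fderiv ℝ f z) z :=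
    hφ.comp_hasFDerivAt z hf.hasFDerivAt
  rw [pd, h.fderiv]
  rfl

lemma lap_add (hf : ContDiff ℝ 2 f) (hg : ContDiff ℝ 2 g) :
    lap (fun z => f z + g z) z = lap f z + lap g z := by
  simp only [lap, ← Finset.sum_add_distrib]
  refine Finset.sum_congr rfl fun i _ => ?_
  rw [show pd i (fun z => f z + g z) = fun z => pd i f z + pd i g z from funext fun z =>
    pd_add (hf.differentiable (by norm_num) z) (hg.differentiable (by norm_num) z) i]
  exact pd_add ((contDiff_pd hf i).differentiable (by norm_num) z)
    ((contDiff_pd hg i).differentiable (by norm_num) z) i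

lemma lap_sub (hf : ContDiff ℝ 2 f) (hg : ContDiff ℝ 2 g) :
    lap (fun z => f z - g z) z = lap f z - lap g z := by
  simp only [lap, ← Finset.sum_sub_distrib]
  refine Finset.sum_congr rfl fun i _ => ?_
  rw [show pd i (fun z => f z - g z) = fun z => pd i f z - pd i g z from funext fun z =>
    pd_sub (hf.differentiable (by norm_num) z) (hg.differentiable (by norm_num) z) i]
  exact pd_sub ((contDiff_pd hf i).differentiable (by norm_num) z)
    ((contDiff_pd hg i).differentiable (by norm_num) z) i

lemma lap_mul (hf : ContDiff ℝ 2 f) (hg : ContDiff ℝ 2 g) :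
    lap (fun z => f z * g z) z = f z * lap g z + g z * lap f z + 2 * ∑ i, pd i f z * pd i g z := by
  simp only [lap, Finset.mul_sum, ← Finset.sum_add_distrib]
  refine Finset.sum_congr rfl fun i _ => ?_
  have hf1 := hf.differentiable (by norm_num)
  have hg1 := hg.differentiable (by norm_num)
  have hf2 := (contDiff_pd hf i).differentiable (by norm_num)
  have hg2 := (contDiff_pd hg i).differentiable (by norm_num)
  rw [show pd i (fun z => f z * g z) = fun z => f z * pd i g z + g z * pd i f z from
    funext fun z => pd_mul (hf1 z) (hg1 z) i,
    pd_add ((hf1 z).fun_mul (hg2 z)) ((hg1 z).fun_mul (hf2 z)), pd_mul (hf1 z) (hg2 z),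
    pd_mul (hg1 z) (hf2 z)]
  ring

lemma lap_comp {φ φ₁ φ₂ : ℝ → ℝ} (hf : ContDiff ℝ 2 f) (h₁ : ∀ s, HasDerivAt φ (φ₁ s) s)
    (h₂ : ∀ s, HasDerivAt φ₁ (φ₂ s) s) :
    lap (fun z => φ (f z)) z = φ₂ (f z) * ∑ i, pd i f z ^ 2 + φ₁ (f z) * lap f z := by
  simp only [lap, Finset.mul_sum, ← Finset.sum_add_distrib]
  refine Finset.sum_congr rfl fun i _ => ?_
  have hf1 := hf.differentiable (by norm_num)
  have hf2 := (contDiff_pd hf i).differentiable (by norm_num)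
  have hc : DifferentiableAt ℝ (fun z => φ₁ (f z)) z :=
    (h₂ _).differentiableAt.comp z (hf1 z)
  rw [show pd i (fun z => φ (f z)) = fun z => φ₁ (f z) * pd i f z from
    funext fun z => pd_comp (hf1 z) (h₁ _) i,
    pd_mul hc (hf2 z), pd_comp (hf1 z) (h₂ _)]
  ring

lemma gen_add {u : (Fin N → ℝ) → Fin N → ℝ} (hf : ContDiff ℝ 2 f) (hg : ContDiff ℝ 2 g) :
    gen u (fun z => f z + g z) z = gen u f z + gen u g z := by
  rw [gen, lap_add hf hg]
  simp only [pd_add (hf.differentiable (by norm_num) z) (hg.differentiable (by norm_num) z),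
    mul_add, Finset.sum_add_distrib, gen]
  ring

lemma gen_sub {u : (Fin N → ℝ) → Fin N → ℝ} (hf : ContDiff ℝ 2 f) (hg : ContDiff ℝ 2 g) :
    gen u (fun z => f z - g z) z = gen u f z - gen u g z := by
  rw [gen, lap_sub hf hg]
  simp only [pd_sub (hf.differentiable (by norm_num) z) (hg.differentiable (by norm_num) z),
    mul_sub, Finset.sum_sub_distrib, gen]
  ring

lemma gen_mul {u : (Fin N → ℝ) → Fin N → ℝ} (hf : ContDiff ℝ 2 f) (hg : ContDiff ℝ 2 g) :
    gen u (fun z => f z * g z) z =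
      f z * gen u g z + g z * gen u f z + 2 * ∑ i, pd i f z * pd i g z := by
  rw [gen, lap_mul hf hg]
  simp only [pd_mul (hf.differentiable (by norm_num) z) (hg.differentiable (by norm_num) z),
    mul_add, Finset.sum_add_distrib, gen, mul_sub, Finset.mul_sum, mul_left_comm (u z _)]
  ring

lemma gen_comp {u : (Fin N → ℝ) → Fin N → ℝ} {φ φ₁ φ₂ : ℝ → ℝ} (hf : ContDiff ℝ 2 f)
    (h₁ : ∀ s, HasDerivAt φ (φ₁ s) s) (h₂ : ∀ s, HasDerivAt φ₁ (φ₂ s) s) :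
    gen u (fun z => φ (f z)) z = φ₂ (f z) * ∑ i, pd i f z ^ 2 + φ₁ (f z) * gen u f z := by
  rw [gen, lap_comp hf h₁ h₂]
  simp only [pd_comp (hf.differentiable (by norm_num) z) (h₁ _), gen, mul_sub, Finset.mul_sum,
    mul_left_comm (u z _)]
  ring

end Calculus

lemma exists_box_representative {m : ℕ} {h : ℝ} (hh : 0 < h) (z : Fin (m+1) → ℝ) :
    ∃ z' : Fin (m+1) → ℝ, z' 0 = z 0 ∧ (∀ j : Fin m, z' j.succ ∈ Set.Icc 0 h) ∧
      ∀ G : (Fin (m+1) → ℝ) → ℝ, (∀ z (j : Fin m), G (z + Pi.single j.succ h) = G z) →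
        G z' = G z := by
  let n : Fin m → ℤ := fun j => -⌊z j.succ / h⌋
  refine ⟨z + ∑ j, n j • (Pi.single j.succ h : Fin (m+1) → ℝ), ?_, fun j => ?_, fun G hG => ?_⟩
  · simp [Finset.sum_apply]
  · have h1 : (z + ∑ j, n j • (Pi.single j.succ h : Fin (m+1) → ℝ)) j.succ =
        z j.succ - ⌊z j.succ / h⌋ * h := by
      simp [Finset.sum_apply, Pi.single_apply, n]; ring
    rw [h1]
    have h2 := Int.floor_le (z j.succ / h)
    have h3 := Int.lt_floor_add_one (z j.succ / h)
    rw [le_div_iff₀ hh] at h2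
    rw [div_lt_iff₀ hh] at h3
    constructor <;> linarith
  · have h1 : ∀ s : Finset (Fin m), Function.Periodic G
        (∑ j ∈ s, n j • (Pi.single j.succ h : Fin (m+1) → ℝ)) := fun s => by
      induction s using Finset.cons_induction with
      | empty => intro z; simp
      | cons a s ha ih =>
        rw [Finset.sum_cons]
        have h2 : Function.Periodic G (Pi.single a.succ h) := fun z => hG z a
        exact (h2.zsmul (n a)).add_period ih
    exact h1 _ z

/-- The compact box `[-R,R] × [0,h]^m`. -/
def cylBox (m : ℕ) (h R : ℝ) : Set (Fin (m+1) → ℝ) :=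
  Set.Icc (Fin.cons (-R) fun _ => 0) (Fin.cons R fun _ => h)

lemma isCompact_cylBox (m : ℕ) (h R : ℝ) : IsCompact (cylBox m h R) := isCompact_Icc

lemma mem_cylBox {m : ℕ} {h R : ℝ} {z : Fin (m+1) → ℝ} :
    z ∈ cylBox m h R ↔ |z 0| ≤ R ∧ ∀ j : Fin m, z j.succ ∈ Set.Icc 0 h := by
  simp only [cylBox, Set.mem_Icc, Pi.le_def, Fin.forall_fin_succ, Fin.cons_zero, Fin.cons_succ,
    abs_le, forall_and]
  tauto

section Comparison

variable {m : ℕ} {h M : ℝ} {u : (Fin (m+1) → ℝ) → Fin (m+1) → ℝ} {f : ℝ → ℝ}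
  {T0 : (Fin (m+1) → ℝ) → ℝ} {T : ℝ → (Fin (m+1) → ℝ) → ℝ}

lemma IsCylSol.deriv_eq (sol : IsCylSol m h M u f T0 T) {t : ℝ} (ht : 0 < t)
    (z : Fin (m+1) → ℝ) : deriv (fun s => T s z) t = gen u (T t) z + M * f (T t z) := by
  have := sol.eqn t z ht
  rw [gen]
  linarith

theorem IsCylSol.ge_of_subsolution (sol : IsCylSol m h M u f T0 T) (hM : 0 < M) {K : NNReal}
    (hf : LipschitzOnWith K f (Set.Icc 0 1)) {t₀ t₁ : ℝ} (ht₀ : 0 ≤ t₀)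
    {w w' : ℝ → (Fin (m+1) → ℝ) → ℝ} {S : Set (Fin (m+1) → ℝ)} (hS : IsCompact S)
    (hcont : ContinuousOn (fun p : ℝ × (Fin (m+1) → ℝ) => w p.1 p.2) (Set.Icc t₀ t₁ ×ˢ Set.univ))
    (hinit : ∀ z, w t₀ z ≤ T t₀ z)
    (hred : ∀ t ∈ Set.Icc t₀ t₁, ∀ z, 0 < w t z →
      ∃ z' ∈ S, T t z' - w t z' ≤ T t z - w t z)
    (hle : ∀ t ∈ Set.Icc t₀ t₁, ∀ z, w t z ≤ 1)
    (htime : ∀ t ∈ Set.Ioc t₀ t₁, ∀ z, HasDerivAt (fun s => w s z) (w' t z) t)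
    (hspace : ∀ t ∈ Set.Ioc t₀ t₁, ContDiff ℝ 2 (w t))
    (hineq : ∀ t ∈ Set.Ioc t₀ t₁, ∀ z, 0 < w t z → w' t z ≤ gen u (w t) z + M * f (w t z)) :
    ∀ t ∈ Set.Icc t₀ t₁, ∀ z, w t z ≤ T t z := by
  suffices ∀ t ∈ Set.Icc t₀ t₁, ∀ z, 0 ≤ T t z - w t z from
    fun t ht z => sub_nonneg.1 (this t ht z)
  have hpos : ∀ t ∈ Set.Icc t₀ t₁, ∀ z, T t z - w t z < 0 → 0 < w t z := fun t ht z hz => by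
    linarith [(sol.mem_Icc t z (ht₀.trans ht.1)).1]
  refine parabolic_nonneg (D := fun t z => T t z - w t z) (κ := M * K) (u := u) hS
    ((sol.cont.mono fun p hp => ht₀.trans hp.1.1).sub hcont)
    (fun z => sub_nonneg.2 (hinit z)) (fun t ht z hz => hred t ht z (hpos t ht z hz))
    (fun t ht z => (sol.timeDiff t z (ht₀.trans_lt ht.1)).sub (htime t ht z).differentiableAt)
    (fun t ht => (sol.spaceC2 t (ht₀.trans_lt ht.1)).sub (hspace t ht)) fun t ht z hz => ?_
  have ht' : t ∈ Set.Icc t₀ t₁ := ⟨ht.1.le, ht.2⟩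
  have ht0 : 0 < t := ht₀.trans_lt ht.1
  have hw := hpos t ht' z hz
  rw [deriv_fun_sub (sol.timeDiff t z ht0) (htime t ht z).differentiableAt, (htime t ht z).deriv,
    sol.deriv_eq ht0]
  have h1 := gen_sub (u := u) (z := z) (sol.spaceC2 t ht0) (hspace t ht)
  have h2 := hineq t ht z hw
  have h3 := hf.dist_le_mul _ (sol.mem_Icc t z ht0.le) _ ⟨hw.le, hle t ht' z⟩
  rw [Real.dist_eq, Real.dist_eq, abs_of_neg hz] at h3
  have h4 := neg_abs_le (f (T t z) - f (w t z))
  have h5 := mul_le_mul_of_nonneg_left (h4.trans' (neg_le_neg h3)) hM.le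
  rw [gen] at h1
  simp only [mul_sub, neg_sub] at h5 ⊢
  have h6 : M * (K * (T t z - w t z)) = M * K * (T t z - w t z) := by ring
  rw [mul_sub (M * (K : ℝ))] at h6
  simp only [mul_sub] at h6
  linarith

end Comparison

section Positivity

lemma hasFDerivAt_sub_sum_sq {N : ℕ} (r : ℝ) (ζ z : Fin N → ℝ) :
    HasFDerivAt (fun z : Fin N → ℝ => r - ∑ i, (z i - ζ i) ^ 2)
      (-∑ i, (2 * (z i - ζ i)) • ContinuousLinearMap.proj (R := ℝ) (φ := fun _ : Fin N => ℝ) i) z := by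
  refine HasFDerivAt.const_sub ?_ r
  refine HasFDerivAt.fun_sum fun i _ => ?_
  have h1 : HasFDerivAt (fun z : Fin N → ℝ => z i - ζ i)
      (ContinuousLinearMap.proj (R := ℝ) (φ := fun _ : Fin N => ℝ) i) z :=
    (hasFDerivAt_apply i z).sub_const _
  simpa using h1.pow 2

lemma pd_sub_sum_sq {N : ℕ} (r : ℝ) (ζ : Fin N → ℝ) (i : Fin N) :
    pd i (fun z : Fin N → ℝ => r - ∑ i, (z i - ζ i) ^ 2) = fun z => -2 * (z i - ζ i) := by
  funext z
  rw [pd, (hasFDerivAt_sub_sum_sq r ζ z).fderiv]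
  simp [Pi.single_apply]

lemma lap_sub_sum_sq {N : ℕ} (r : ℝ) (ζ z : Fin N → ℝ) :
    lap (fun z : Fin N → ℝ => r - ∑ i, (z i - ζ i) ^ 2) z = -2 * N := by
  have h : ∀ i, pd i (fun z : Fin N → ℝ => -2 * (z i - ζ i)) z = -2 := fun i => by
    have := (((hasFDerivAt_apply (𝕜 := ℝ) (F' := fun _ : Fin N => ℝ) i z).sub_const
      (ζ i)).const_mul (-2)).fderiv
    rw [pd, this]
    simp
  simp only [lap, pd_sub_sum_sq, h]
  simp [mul_comm]

variable {m : ℕ} {h M : ℝ} {u : (Fin (m+1) → ℝ) → Fin (m+1) → ℝ} {f : ℝ → ℝ}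
  {T0 : (Fin (m+1) → ℝ) → ℝ} {T : ℝ → (Fin (m+1) → ℝ) → ℝ}

theorem IsCylSol.pos (sol : IsCylSol m h M u f T0 T) (hM : 0 < M) {K : NNReal}
    (hf : LipschitzOnWith K f (Set.Icc 0 1)) (hf_nonneg : ∀ s ∈ Set.Icc (0:ℝ) 1, 0 ≤ f s)
    {C : ℝ} (hu : ∀ z i, |u z i| ≤ C) {z₀ : Fin (m+1) → ℝ} (hz₀ : T0 z₀ ≠ 0)
    {τ : ℝ} (hτ : 0 < τ) (z₁ : Fin (m+1) → ℝ) : 0 < T τ z₁ := by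
  have hC : 0 ≤ C := (abs_nonneg _).trans (hu z₀ 0)
  have h00 := sol.mem_Icc 0 z₀ le_rfl
  have hpos0 : 0 < T 0 z₀ := lt_of_le_of_ne h00.1 (by rw [sol.init]; exact hz₀.symm)
  have hcont0 : Continuous (T 0) := by
    have := sol.cont.comp_continuous (f := fun z : Fin (m+1) → ℝ => ((0:ℝ), z)) (by fun_prop)
      fun z => le_refl (0:ℝ)
    exact this
  set ε := T 0 z₀ / 2 with hε
  have hε0 : 0 < ε := half_pos hpos0
  obtain ⟨δ, hδ, hball⟩ := Metric.eventually_nhds_iff.1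
    (hcont0.continuousAt.eventually (lt_mem_nhds (show ε < T 0 z₀ from half_lt_self hpos0)))
  let r := min δ 1
  have hr0 : 0 < r := lt_min hδ one_pos
  have hr1 : r ≤ 1 := min_le_right _ _
  let V : Fin (m+1) → ℝ := fun i => (z₁ i - z₀ i) / τ
  let B : ℝ := 24 + 6 * (m + 1) + ∑ i, 6 * (C + |V i|) * r
  have hB : 0 ≤ B := by
    have : 0 ≤ ∑ i, 6 * (C + |V i|) * r := Finset.sum_nonneg fun i _ => by positivity
    positivity
  let b := B ^ 2 / (96 * r ^ 2)
  have hb : 0 ≤ b := by positivity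
  let ζ : ℝ → Fin (m+1) → ℝ := fun t i => z₀ i + t * V i
  let s : ℝ → (Fin (m+1) → ℝ) → ℝ := fun t z => r ^ 2 - ∑ i, (z i - ζ t i) ^ 2
  let s' : ℝ → (Fin (m+1) → ℝ) → ℝ := fun t z => ∑ i, 2 * V i * (z i - ζ t i)
  let w : ℝ → (Fin (m+1) → ℝ) → ℝ := fun t z => ε * Real.exp (-b * t) * s t z ^ 3
  let w' : ℝ → (Fin (m+1) → ℝ) → ℝ := fun t z =>
    ε * Real.exp (-b * t) * (-b * s t z ^ 3 + 3 * s t z ^ 2 * s' t z)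
  have hscont : Continuous fun p : ℝ × (Fin (m+1) → ℝ) => s p.1 p.2 := by
    simp only [s, ζ]; fun_prop
  have hs_le : ∀ t z, s t z ≤ r ^ 2 := fun t z =>
    sub_le_self _ (Finset.sum_nonneg fun i _ => sq_nonneg _)
  have hs_le1 : ∀ t z, s t z ≤ 1 := fun t z => (hs_le t z).trans (pow_le_one₀ hr0.le hr1)
  have hcube : ∀ t z, s t z ^ 3 ≤ 1 := fun t z => by
    rcases le_total 0 (s t z) with h | h
    · exact pow_le_one₀ h (hs_le1 t z)
    · exact (Odd.pow_nonpos (by decide) h).trans zero_le_one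
  have hs_pos : ∀ t z, 0 < w t z → 0 < s t z := fun t z hw => by
    by_contra! hcon
    have : s t z ^ 3 ≤ 0 := Odd.pow_nonpos (by decide) hcon
    have : w t z ≤ 0 := mul_nonpos_of_nonneg_of_nonpos (by positivity) this
    linarith
  have hy : ∀ t z, 0 < s t z → ∀ i, |z i - ζ t i| ≤ r := fun t z hs i => by
    have h1 : (z i - ζ t i) ^ 2 ≤ ∑ i, (z i - ζ t i) ^ 2 :=
      Finset.single_le_sum (f := fun i => (z i - ζ t i) ^ 2) (fun _ _ => sq_nonneg _)
        (Finset.mem_univ i)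
    refine abs_le_of_sq_le_sq ?_ hr0.le
    simp only [s] at hs
    linarith
  have hexp : ∀ t, 0 ≤ t → Real.exp (-b * t) ≤ 1 := fun t ht => by
    rw [Real.exp_le_one_iff]; nlinarith
  have hw_le : ∀ t, 0 ≤ t → ∀ z, w t z ≤ ε := fun t ht z => by
    have h1 : ε * Real.exp (-b * t) ≤ ε := mul_le_of_le_one_right hε0.le (hexp t ht)
    exact (mul_le_of_le_one_right (by positivity) (hcube t z)).trans h1
  have hkey := sol.ge_of_subsolution hM hf (le_refl 0) (t₁ := τ) (w := w) (w' := w')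
    (S := Set.Icc (fun i => z₀ i - τ * |V i| - 1) (fun i => z₀ i + τ * |V i| + 1)) isCompact_Icc
    ?_ ?_ ?_ ?_ ?_ ?_ ?_ τ ⟨hτ.le, le_rfl⟩ z₁
  · refine lt_of_lt_of_le ?_ hkey
    have : s τ z₁ = r ^ 2 := by
      have : ∀ i, z₁ i - ζ τ i = 0 := fun i => by simp only [ζ, V]; field_simp; ring
      simp [s, this]
    simp only [w, this]
    positivity
  · refine Continuous.continuousOn ?_
    simp only [w]; fun_prop
  · intro z
    rcases le_or_gt (w 0 z) 0 with hw | hw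
    · exact hw.trans (sol.mem_Icc 0 z le_rfl).1
    · have hs := hs_pos 0 z hw
      refine (hw_le 0 le_rfl z).trans (hball ?_).le
      rw [dist_pi_lt_iff hδ]
      intro i
      have hlt : (z i - z₀ i) ^ 2 < r ^ 2 := by
        have h1 : (z i - z₀ i) ^ 2 ≤ ∑ i, (z i - z₀ i) ^ 2 :=
          Finset.single_le_sum (f := fun i => (z i - z₀ i) ^ 2) (fun _ _ => sq_nonneg _)
            (Finset.mem_univ i)
        simp only [s, ζ, zero_mul, add_zero] at hs
        linarith
      exact (abs_lt_of_sq_lt_sq hlt hr0.le).trans_le (min_le_left _ _)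
  · intro t ht z hw
    refine ⟨z, ?_, le_rfl⟩
    have h1 := hy t z (hs_pos t z hw)
    have h2 : ∀ i, |t * V i| ≤ τ * |V i| := fun i => by
      rw [abs_mul, abs_of_nonneg ht.1]
      exact mul_le_mul_of_nonneg_right ht.2 (abs_nonneg _)
    constructor <;> intro i <;>
    · have h3 := abs_le.1 (h1 i)
      have h4 := abs_le.1 (h2 i)
      simp only [ζ] at h3
      linarith
  · intro t ht z
    have := hw_le t ht.1 z
    linarith [h00.2]
  · intro t ht z
    have h1 : HasDerivAt (fun t => Real.exp (-b * t)) (Real.exp (-b * t) * -b) t := by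
      simpa using ((hasDerivAt_id t).const_mul (-b)).exp
    have h2 : HasDerivAt (fun t => s t z) (s' t z) t := by
      have h3 : ∀ i ∈ Finset.univ, HasDerivAt (fun t => (z i - ζ t i) ^ 2)
          (2 * (z i - ζ t i) * -V i) t := fun i _ => by
        have h4 : HasDerivAt (fun t => z i - ζ t i) (-V i) t := by
          simpa using (((hasDerivAt_id t).mul_const (V i)).const_add (z₀ i)).const_sub (z i)
        simpa using h4.fun_pow 2
      refine ((HasDerivAt.fun_sum h3).const_sub (r ^ 2)).congr_deriv ?_
      rw [← Finset.sum_neg_distrib]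
      exact Finset.sum_congr rfl fun i _ => by ring
    refine ((h1.const_mul ε).mul (h2.pow 3)).congr_deriv ?_
    simp only [w', Pi.pow_apply]
    push_cast
    ring
  · intro t ht
    simp only [w, s]
    fun_prop
  · intro t ht z hw
    have hs := hs_pos t z hw
    have hsC : ContDiff ℝ 2 (s t) := by simp only [s]; fun_prop
    have hgen := gen_comp (u := u) (z := z) hsC (φ := fun x => ε * Real.exp (-b * t) * x ^ 3)
      (φ₁ := fun x => ε * Real.exp (-b * t) * (3 * x ^ 2))
      (φ₂ := fun x => ε * Real.exp (-b * t) * (6 * x))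
      (fun x => by simpa using (hasDerivAt_pow 3 x).const_mul (ε * Real.exp (-b * t)))
      (fun x => by
        refine (((hasDerivAt_pow 2 x).const_mul 3).const_mul (ε * Real.exp (-b * t))).congr_deriv ?_
        push_cast; ring)
    have hfw : 0 ≤ M * f (w t z) := mul_nonneg hM.le
      (hf_nonneg _ ⟨hw.le, (hw_le t ht.1.le z).trans (by linarith [h00.2])⟩)
    refine le_trans ?_ (le_add_of_nonneg_right hfw)
    change _ ≤ gen u (fun z => ε * Real.exp (-b * t) * s t z ^ 3) z
    rw [hgen]
    have hgs : gen u (s t) z = -2 * (m + 1) + ∑ i, u z i * (2 * (z i - ζ t i)) := by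
      simp only [gen, s, lap_sub_sum_sq, pd_sub_sum_sq]
      push_cast
      rw [sub_eq_add_neg, ← Finset.sum_neg_distrib]
      congr 1
      exact Finset.sum_congr rfl fun i _ => by ring
    have hgq : ∑ i, pd i (s t) z ^ 2 = 4 * (r ^ 2 - s t z) := by
      simp only [s, pd_sub_sum_sq, sub_sub_cancel, Finset.mul_sum]
      exact Finset.sum_congr rfl fun i _ => by ring
    rw [hgs, hgq]
    have hsum : 6 * (s' t z / 2 - ∑ i, u z i * (z i - ζ t i)) ≤ ∑ i, 6 * (C + |V i|) * r := by
      have : 6 * (s' t z / 2 - ∑ i, u z i * (z i - ζ t i)) =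
          ∑ i, 6 * ((V i - u z i) * (z i - ζ t i)) := by
        simp only [s', Finset.sum_div, ← Finset.sum_sub_distrib, Finset.mul_sum]
        exact Finset.sum_congr rfl fun i _ => by ring
      rw [this]
      refine Finset.sum_le_sum fun i _ => ?_
      rw [mul_assoc]
      refine mul_le_mul_of_nonneg_left ((le_abs_self _).trans ?_) (by norm_num)
      rw [abs_mul]
      refine mul_le_mul ?_ (hy t z hs i) (abs_nonneg _) (by positivity)
      have := abs_sub (V i) (u z i)
      linarith [hu z i]
    have hsq : 0 ≤ b * s t z ^ 2 - B * s t z + 24 * r ^ 2 := by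
      have : b * s t z ^ 2 - B * s t z + 24 * r ^ 2 = 24 / r ^ 2 * (B * s t z / 48 - r ^ 2) ^ 2 := by
        simp only [b]; field_simp; ring
      rw [this]; positivity
    have hA : 0 < ε * Real.exp (-b * t) * s t z := by positivity
    have hfin : -b * s t z ^ 2 + 3 * s t z * s' t z ≤
        24 * (r ^ 2 - s t z) + 3 * s t z * (-2 * (m + 1) + 2 * ∑ i, u z i * (z i - ζ t i)) := by
      have h5 := mul_le_mul_of_nonneg_left hsum hs.le
      have h6 : B * s t z = (24 + 6 * (m + 1)) * s t z + s t z * ∑ i, 6 * (C + |V i|) * r := by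
        simp only [B]; ring
      linarith
    have h7 := mul_le_mul_of_nonneg_left hfin hA.le
    have h8 : ∑ i, u z i * (2 * (z i - ζ t i)) = 2 * ∑ i, u z i * (z i - ζ t i) := by
      rw [Finset.mul_sum]; exact Finset.sum_congr rfl fun i _ => by ring
    rw [h8]
    simp only [w']
    linarith

end Positivity

section Profile

/-- Gaussian profile of height `A`, width `ℓ` and centre `ξ` in the harmonic coordinate `X`,
truncated at the relative level `κ` and corrected to second order by `Y`. -/
def profile {N : ℕ} (κ : ℝ) (X Y : (Fin N → ℝ) → ℝ) (A ξ ℓ : ℝ) (z : Fin N → ℝ) : ℝ :=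
  A * (Real.exp (-((X z - ξ) / ℓ) ^ 2) - κ
    + Y z / ℓ ^ 2 * ((4 * ((X z - ξ) / ℓ) ^ 2 - 2) * Real.exp (-((X z - ξ) / ℓ) ^ 2)))

lemma hasDerivAt_gaussian (ξ ℓ s : ℝ) :
    HasDerivAt (fun s => Real.exp (-((s - ξ) / ℓ) ^ 2))
      (-2 * ((s - ξ) / ℓ) / ℓ * Real.exp (-((s - ξ) / ℓ) ^ 2)) s := by
  have h1 : HasDerivAt (fun s => (s - ξ) / ℓ) (1 / ℓ) s :=
    ((hasDerivAt_id s).sub_const ξ).div_const ℓ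
  refine (h1.fun_pow 2).fun_neg.exp.congr_deriv ?_
  push_cast
  ring

lemma HasDerivAt.polynomial_mul_gaussian {q : ℝ → ℝ} {q' : ℝ} (A ξ ℓ s : ℝ)
    (hq : HasDerivAt q q' ((s - ξ) / ℓ)) :
    HasDerivAt (fun s => A * (q ((s - ξ) / ℓ) * Real.exp (-((s - ξ) / ℓ) ^ 2)))
      (A / ℓ * ((q' - 2 * ((s - ξ) / ℓ) * q ((s - ξ) / ℓ)) * Real.exp (-((s - ξ) / ℓ) ^ 2))) s := by
  have h1 : HasDerivAt (fun s => (s - ξ) / ℓ) (1 / ℓ) s :=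
    ((hasDerivAt_id s).sub_const ξ).div_const ℓ
  refine (((hq.comp s h1).fun_mul (hasDerivAt_gaussian ξ ℓ s)).const_mul A).congr_deriv ?_
  simp only [Function.comp]
  ring

variable {m : ℕ} {h α C : ℝ} {u : (Fin (m+1) → ℝ) → Fin (m+1) → ℝ} {X Y : (Fin (m+1) → ℝ) → ℝ}

lemma Correctors.gen_profile (c : Correctors h u X Y α C) (κ A ξ ℓ : ℝ) (z : Fin (m+1) → ℝ) :
    gen u (profile κ X Y A ξ ℓ) z = A / ℓ ^ 2 * Real.exp (-((X z - ξ) / ℓ) ^ 2) *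
      (α * (4 * ((X z - ξ) / ℓ) ^ 2 - 2)
        + 2 * (∑ i, pd i X z * pd i Y z) * (12 * ((X z - ξ) / ℓ) - 8 * ((X z - ξ) / ℓ) ^ 3) / ℓ
        + Y z * (∑ i, pd i X z ^ 2) *
          (16 * ((X z - ξ) / ℓ) ^ 4 - 48 * ((X z - ξ) / ℓ) ^ 2 + 12) / ℓ ^ 2) := by
  let E : ℝ → ℝ := fun s => Real.exp (-((s - ξ) / ℓ) ^ 2)
  let φ₂ : ℝ → ℝ := fun s => A / ℓ ^ 2 * ((4 * ((s - ξ) / ℓ) ^ 2 - 2) * E s)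
  let φ₃ : ℝ → ℝ := fun s => A / ℓ ^ 3 * ((12 * ((s - ξ) / ℓ) - 8 * ((s - ξ) / ℓ) ^ 3) * E s)
  let φ₄ : ℝ → ℝ := fun s =>
    A / ℓ ^ 4 * ((16 * ((s - ξ) / ℓ) ^ 4 - 48 * ((s - ξ) / ℓ) ^ 2 + 12) * E s)
  have hpow : ∀ (n : ℕ) (a s : ℝ), HasDerivAt (fun s : ℝ => a * s ^ n) (a * (n * s ^ (n - 1))) s :=
    fun n a s => (hasDerivAt_pow n s).const_mul a
  have h0 : ∀ s, HasDerivAt (fun s => A * (E s - κ)) (A / ℓ * (-2 * ((s - ξ) / ℓ) * E s)) s :=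
    fun s => (((hasDerivAt_gaussian ξ ℓ s).sub_const κ).const_mul A).congr_deriv (by ring)
  have h1 : ∀ s, HasDerivAt (fun s => A / ℓ * (-2 * ((s - ξ) / ℓ) * E s)) (φ₂ s) s := fun s =>
    (HasDerivAt.polynomial_mul_gaussian (q := fun x => -2 * x) (A / ℓ) ξ ℓ s
      ((hasDerivAt_id _).const_mul (-2))).congr_deriv (by simp only [φ₂, E]; ring)
  have h2 : ∀ s, HasDerivAt φ₂ (φ₃ s) s := fun s =>
    (HasDerivAt.polynomial_mul_gaussian (q := fun x => 4 * x ^ 2 - 2) (A / ℓ ^ 2) ξ ℓ s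
      ((hpow 2 4 _).sub_const 2)).congr_deriv (by simp only [φ₃, E]; push_cast; ring)
  have h3 : ∀ s, HasDerivAt φ₃ (φ₄ s) s := fun s =>
    (HasDerivAt.polynomial_mul_gaussian (q := fun x => 12 * x - 8 * x ^ 3) (A / ℓ ^ 3) ξ ℓ s
      (((hasDerivAt_id _).const_mul 12).sub (hpow 3 8 _))).congr_deriv
      (by simp only [φ₄, E]; push_cast; ring)
  have hX := c.smoothX
  have hφ₂ : ContDiff ℝ 2 fun z => φ₂ (X z) := by simp only [φ₂, E]; fun_prop
  have hφ₀ : ContDiff ℝ 2 fun z => A * (E (X z) - κ) := by simp only [E]; fun_prop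
  have hfun : profile κ X Y A ξ ℓ = fun z => A * (E (X z) - κ) + Y z * φ₂ (X z) := by
    funext z; simp only [profile, φ₂, E]; ring
  rw [hfun, gen_add hφ₀ (c.smoothY.mul hφ₂), gen_comp hX h0 h1, gen_mul c.smoothY hφ₂,
    gen_comp hX h2 h3]
  have hgX : gen u X z = 0 := c.eqX z
  have hgY : gen u Y z = α - ∑ i, pd i X z ^ 2 := c.eqY z
  have hpd : ∑ i, pd i Y z * pd i (fun z => φ₂ (X z)) z = φ₃ (X z) * ∑ i, pd i X z * pd i Y z := by
    rw [Finset.mul_sum]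
    refine Finset.sum_congr rfl fun i _ => ?_
    rw [pd_comp (hX.differentiable (by norm_num) z) (h2 (X z)) i]
    ring
  rw [hgX, hgY, hpd]
  simp only [φ₂, φ₃, φ₄, E]
  ring

lemma hasDerivAt_profile {N : ℕ} (κ : ℝ) (X Y : (Fin N → ℝ) → ℝ) {A ξ ℓ : ℝ → ℝ} {a σ d t : ℝ}
    (hA : HasDerivAt A (a * A t / ℓ t ^ 2) t) (hξ : HasDerivAt ξ (σ / ℓ t) t)
    (hℓ : HasDerivAt ℓ (d / ℓ t) t) (hℓ0 : ℓ t ≠ 0) (z : Fin N → ℝ) :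
    HasDerivAt (fun t => profile κ X Y (A t) (ξ t) (ℓ t) z)
      (a * profile κ X Y (A t) (ξ t) (ℓ t) z / ℓ t ^ 2
        + A t / ℓ t ^ 2 * Real.exp (-((X z - ξ t) / ℓ t) ^ 2) *
          ((σ + (X z - ξ t) / ℓ t * d) * (2 * ((X z - ξ t) / ℓ t)
            - Y z / ℓ t ^ 2 * (12 * ((X z - ξ t) / ℓ t) - 8 * ((X z - ξ t) / ℓ t) ^ 3))
          - 2 * d * (Y z / ℓ t ^ 2) * (4 * ((X z - ξ t) / ℓ t) ^ 2 - 2))) t := by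
  have hη : HasDerivAt (fun t => (X z - ξ t) / ℓ t)
      (-(σ + (X z - ξ t) / ℓ t * d) / ℓ t ^ 2) t := by
    refine ((hξ.const_sub (X z)).fun_div hℓ hℓ0).congr_deriv ?_
    field_simp
    ring
  have hE := (hη.fun_pow 2).fun_neg.exp
  have hY : HasDerivAt (fun t => Y z / ℓ t ^ 2) (-2 * d * (Y z / ℓ t ^ 2) / ℓ t ^ 2) t := by
    refine ((hasDerivAt_const t (Y z)).fun_div (hℓ.fun_pow 2) (pow_ne_zero 2 hℓ0)).congr_deriv ?_
    field_simp
    push_cast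
    ring
  have hP := (((hη.fun_pow 2).const_mul 4).sub_const 2).fun_mul hE
  refine (hA.fun_mul ((hE.sub_const κ).fun_add (hY.fun_mul hP))).congr_deriv ?_
  simp only [profile]
  push_cast
  ring

lemma abs_hermite_mul_exp_le (η : ℝ) : |(4 * η ^ 2 - 2) * Real.exp (-η ^ 2)| ≤ 4 := by
  have h1 := Real.add_one_le_exp (η ^ 2)
  have h2 : Real.exp (η ^ 2) * Real.exp (-η ^ 2) = 1 := by
    rw [← Real.exp_add]; simp
  have h3 := Real.exp_pos (-η ^ 2)
  have h4 : (η ^ 2 + 1) * Real.exp (-η ^ 2) ≤ 1 :=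
    (mul_le_mul_of_nonneg_right h1 h3.le).trans h2.le
  have h5 : 0 ≤ η ^ 2 * Real.exp (-η ^ 2) := by positivity
  rw [abs_le]
  constructor <;> linarith

lemma Correctors.abs_profile_sub_le (c : Correctors h u X Y α C) (κ : ℝ) {A ℓ : ℝ} (ξ : ℝ)
    (hA : 0 ≤ A) (z : Fin (m+1) → ℝ) :
    |profile κ X Y A ξ ℓ z - A * (Real.exp (-((X z - ξ) / ℓ) ^ 2) - κ)| ≤ A * (4 * C / ℓ ^ 2) := by
  have h1 : profile κ X Y A ξ ℓ z - A * (Real.exp (-((X z - ξ) / ℓ) ^ 2) - κ) =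
      A * (Y z / ℓ ^ 2 * ((4 * ((X z - ξ) / ℓ) ^ 2 - 2) * Real.exp (-((X z - ξ) / ℓ) ^ 2))) := by
    rw [profile]; ring
  have hC : 0 ≤ C := zero_le_one.trans c.one_le
  have h2 : |Y z / ℓ ^ 2| ≤ C / ℓ ^ 2 := by
    rw [abs_div, abs_of_nonneg (sq_nonneg ℓ)]
    exact div_le_div_of_nonneg_right (c.boundY z) (sq_nonneg ℓ)
  rw [h1, abs_mul, abs_of_nonneg hA, abs_mul]
  refine mul_le_mul_of_nonneg_left ?_ hA
  calc _ ≤ C / ℓ ^ 2 * 4 :=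
        mul_le_mul h2 (abs_hermite_mul_exp_le _) (abs_nonneg _) (by positivity)
    _ = 4 * C / ℓ ^ 2 := by ring

set_option maxHeartbeats 1000000 in
lemma Correctors.exists_profile_bound (c : Correctors h u X Y α C) {κ N : ℝ} (hκ : 0 < κ)
    (hκ1 : κ ≤ 1) (hN : 1 ≤ N) :
    ∃ B, 1 ≤ B ∧ 8 * C ≤ κ * B ∧ ∀ (A ξ ℓ a σ d : ℝ) (z : Fin (m+1) → ℝ),
      |a| ≤ N → |σ| ≤ N → |d| ≤ N →
      B ≤ ℓ → 0 < A → 0 < profile κ X Y A ξ ℓ z → ∀ η, (X z - ξ) / ℓ = η →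
      η ^ 2 ≤ 2 / κ ∧ κ / 2 ≤ Real.exp (-η ^ 2) ∧
      a * profile κ X Y A ξ ℓ z / ℓ ^ 2 + A / ℓ ^ 2 * Real.exp (-η ^ 2) *
          ((σ + η * d) * (2 * η - Y z / ℓ ^ 2 * (12 * η - 8 * η ^ 3))
          - 2 * d * (Y z / ℓ ^ 2) * (4 * η ^ 2 - 2)) ≤ gen u (profile κ X Y A ξ ℓ) z +
        A / ℓ ^ 2 * (a * (Real.exp (-η ^ 2) - κ) + Real.exp (-η ^ 2) *
          (2 * σ * η + 2 * d * η ^ 2 - 4 * α * η ^ 2 + 2 * α + B / ℓ)) := by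
  have hC := c.one_le
  set H := 2 / κ with hH
  have hH1 : 1 ≤ H := by rw [hH, le_div_iff₀ hκ]; linarith
  set P : ℝ := (m + 1) * C ^ 2 with hP
  have hP0 : 0 ≤ P := by positivity
  set B₁ := C * (6 * N * H + 40 * N * H ^ 3 + 12 * N * H) + 40 * P * H ^ 2 + 76 * C * P * H ^ 2
  have hB₁ : 0 ≤ B₁ := by positivity
  refine ⟨1 + B₁ + 4 * C * H, ?_, ?_, ?_⟩
  · have : 0 ≤ 4 * C * H := by positivity
    linarith
  · have : κ * (4 * C * H) = 8 * C := by simp only [H]; field_simp; norm_num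
    have h2 : 0 ≤ κ * (1 + B₁) := by positivity
    linarith
  intro A ξ ℓ a σ d z ha hσ hd hBℓ hA hw η hη
  have hℓ1 : 1 ≤ ℓ := by
    have : 0 ≤ 4 * C * H := by positivity
    linarith
  have hℓ0 : 0 < ℓ := one_pos.trans_le hℓ1
  have hsub := c.abs_profile_sub_le κ ξ hA.le (ℓ := ℓ) z
  rw [hη] at hsub
  set E := Real.exp (-η ^ 2) with hE
  have hE0 : 0 < E := Real.exp_pos _
  have hE1 : E ≤ 1 := Real.exp_le_one_iff.2 (by nlinarith [sq_nonneg η])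
  have hEκ : κ / 2 ≤ E := by
    have h1 : 4 * C / ℓ ^ 2 ≤ κ / 2 := by
      rw [div_le_iff₀ (by positivity)]
      have h3 : 4 * C * H ≤ ℓ := by linarith
      have h4 : κ / 2 * (4 * C * H) = 4 * C := by simp only [H]; field_simp
      have h5 : ℓ ≤ ℓ ^ 2 := by nlinarith
      calc 4 * C = κ / 2 * (4 * C * H) := h4.symm
        _ ≤ κ / 2 * ℓ ^ 2 := mul_le_mul_of_nonneg_left (h3.trans h5) (by positivity)
    have h2 : 0 < A * (E - κ + 4 * C / ℓ ^ 2) := by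
      have := (abs_le.1 hsub).2
      linarith
    have := pos_of_mul_pos_right h2 hA.le
    linarith
  have hηH : η ^ 2 ≤ H := by
    have h1 := Real.add_one_le_exp (η ^ 2)
    have h2 : Real.exp (η ^ 2) * E = 1 := by rw [hE, ← Real.exp_add]; simp
    have h3 : Real.exp (η ^ 2) * (κ / 2) ≤ 1 :=
      (mul_le_mul_of_nonneg_left hEκ (Real.exp_pos _).le).trans h2.le
    rw [hH, le_div_iff₀ hκ]
    have h4 := mul_le_mul_of_nonneg_right h1 hκ.le
    linarith
  refine ⟨hηH, hEκ, ?_⟩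
  have hη1 : |η| ≤ H := abs_le_of_sq_le_sq (by nlinarith) (by linarith)
  have hη3 : |η ^ 3| ≤ H ^ 2 := by
    rw [pow_succ, abs_mul, abs_of_nonneg (sq_nonneg η), sq H]
    exact mul_le_mul hηH hη1 (abs_nonneg _) (by linarith)
  have hη4 : η ^ 4 ≤ H ^ 2 := by
    calc η ^ 4 = η ^ 2 * η ^ 2 := by ring
      _ ≤ H * H := mul_le_mul hηH hηH (sq_nonneg η) (by linarith)
      _ = H ^ 2 := by ring
  have hHH : H ≤ H ^ 2 := by nlinarith
  have hq₂ : |4 * η ^ 2 - 2| ≤ 6 * H := abs_le.2 ⟨by nlinarith, by nlinarith⟩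
  have hq₃ : |12 * η - 8 * η ^ 3| ≤ 20 * H ^ 2 := by
    have h1 := abs_le.1 hη1
    have h2 := abs_le.1 hη3
    exact abs_le.2 ⟨by linarith, by linarith⟩
  have hq₄ : |16 * η ^ 4 - 48 * η ^ 2 + 12| ≤ 76 * H ^ 2 :=
    abs_le.2 ⟨by nlinarith [sq_nonneg η, sq_nonneg (η ^ 2)], by nlinarith [sq_nonneg η]⟩
  have hσd : |σ + η * d| ≤ 2 * N * H := by
    have h1 : |η * d| ≤ H * N := by
      rw [abs_mul]; exact mul_le_mul hη1 hd (abs_nonneg _) (by linarith)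
    have h2 : N ≤ H * N := by nlinarith
    linarith [abs_add_le σ (η * d)]
  have hD : |∑ i, pd i X z * pd i Y z| ≤ P := by
    refine (Finset.abs_sum_le_sum_abs _ _).trans ((Finset.sum_le_card_nsmul _ _ (C ^ 2) ?_).trans ?_)
    · intro i _
      rw [abs_mul, sq]
      exact mul_le_mul (c.bound_pdX z i) (c.bound_pdY z i) (abs_nonneg _) (by linarith)
    · simp [hP]
  have hQ : |∑ i, pd i X z ^ 2| ≤ P := by
    refine (Finset.abs_sum_le_sum_abs _ _).trans ((Finset.sum_le_card_nsmul _ _ (C ^ 2) ?_).trans ?_)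
    · intro i _
      rw [abs_pow]
      exact pow_le_pow_left₀ (abs_nonneg _) (c.bound_pdX z i) 2
    · simp [hP]
  have hgen := c.gen_profile κ A ξ ℓ z
  rw [hη] at hgen
  set D := ∑ i, pd i X z * pd i Y z
  set Q := ∑ i, pd i X z ^ 2
  have hY := c.boundY z
  have hmul : ∀ {x y a b : ℝ}, |x| ≤ a → |y| ≤ b → |x * y| ≤ a * b := fun hx hy => by
    rw [abs_mul]; exact mul_le_mul hx hy (abs_nonneg _) ((abs_nonneg _).trans hx)
  have e₁ : |a * (4 * η ^ 2 - 2) - (σ + η * d) * (12 * η - 8 * η ^ 3) - 2 * (d * (4 * η ^ 2 - 2))|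
      ≤ 6 * N * H + 40 * N * H ^ 3 + 12 * N * H := by
    have h1 := abs_le.1 (hmul ha hq₂)
    have h2 := abs_le.1 (hmul hσd hq₃)
    have h3 := abs_le.1 (hmul hd hq₂)
    exact abs_le.2 ⟨by linarith, by linarith⟩
  have e₂ := hmul hY e₁
  have e₃ := hmul hD hq₃
  have e₄ := hmul (hmul hY hQ) hq₄
  have hinv : (1 / ℓ) ^ 2 ≤ 1 / ℓ := by
    have : 1 / ℓ ≤ 1 := by rw [div_le_one hℓ0]; exact hℓ1
    have h0 : 0 ≤ 1 / ℓ := by positivity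
    nlinarith
  have hle_of : ∀ {x b : ℝ}, |x| ≤ b → x * (1 / ℓ) ^ 2 ≤ b * (1 / ℓ) := fun hx =>
    (mul_le_mul_of_nonneg_right ((le_abs_self _).trans hx) (by positivity)).trans
      (mul_le_mul_of_nonneg_left hinv ((abs_nonneg _).trans hx))
  have f₂ := hle_of e₂
  have f₃ : -(D * (12 * η - 8 * η ^ 3)) * (1 / ℓ) ≤ P * (20 * H ^ 2) * (1 / ℓ) :=
    mul_le_mul_of_nonneg_right ((neg_le_abs _).trans e₃) (by positivity)
  have f₄ := hle_of ((abs_neg (Y z * Q * (16 * η ^ 4 - 48 * η ^ 2 + 12))).trans_le e₄)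
  have hBB : B₁ * (1 / ℓ) ≤ (1 + B₁ + 4 * C * H) * (1 / ℓ) := by
    refine mul_le_mul_of_nonneg_right ?_ (by positivity)
    have : 0 ≤ 4 * C * H := by positivity
    linarith
  have hsum : Y z * (a * (4 * η ^ 2 - 2) - (σ + η * d) * (12 * η - 8 * η ^ 3)
        - 2 * (d * (4 * η ^ 2 - 2))) * (1 / ℓ) ^ 2
      + 2 * (-(D * (12 * η - 8 * η ^ 3)) * (1 / ℓ))
      + -(Y z * Q * (16 * η ^ 4 - 48 * η ^ 2 + 12)) * (1 / ℓ) ^ 2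
      ≤ (1 + B₁ + 4 * C * H) * (1 / ℓ) := by
    refine le_trans ?_ hBB
    simp only [B₁]
    linarith
  have hfin := mul_le_mul_of_nonneg_left hsum (show 0 ≤ A / ℓ ^ 2 * E by positivity)
  rw [hgen, profile, hη, ← hE, ← sub_nonneg]
  rw [← sub_nonneg] at hfin
  refine hfin.trans_eq ?_
  ring

end Profile

section ProfileComparison

variable {m : ℕ} {h M α C : ℝ} {u : (Fin (m+1) → ℝ) → Fin (m+1) → ℝ}
  {X Y : (Fin (m+1) → ℝ) → ℝ} {f : ℝ → ℝ}

lemma continuousOn_profile {N : ℕ} (κ : ℝ) {X Y : (Fin N → ℝ) → ℝ} (hX : Continuous X)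
    (hY : Continuous Y) {A ξ ℓ : ℝ → ℝ} {s : Set ℝ} (hA : ContinuousOn A s)
    (hξ : ContinuousOn ξ s) (hℓ : ContinuousOn ℓ s) (hℓ0 : ∀ t ∈ s, ℓ t ≠ 0) :
    ContinuousOn (fun p : ℝ × (Fin N → ℝ) => profile κ X Y (A p.1) (ξ p.1) (ℓ p.1) p.2)
      (s ×ˢ Set.univ) := by
  have hfst : Set.MapsTo (Prod.fst : ℝ × (Fin N → ℝ) → ℝ) (s ×ˢ Set.univ) s := fun p hp => hp.1
  have hA' := hA.comp continuousOn_fst hfst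
  have hξ' := hξ.comp continuousOn_fst hfst
  have hℓ' := hℓ.comp continuousOn_fst hfst
  have h0 : ∀ p ∈ s ×ˢ (Set.univ : Set (Fin N → ℝ)), (ℓ ∘ Prod.fst) p ≠ 0 :=
    fun p hp => hℓ0 _ hp.1
  have hη := ((hX.comp continuous_snd).continuousOn.sub hξ').div hℓ' h0
  have hE := (hη.pow 2).neg.rexp
  have hY' := ((hY.comp continuous_snd).continuousOn).div (hℓ'.pow 2)
    fun p hp => pow_ne_zero 2 (h0 p hp)
  exact hA'.mul ((hE.sub continuousOn_const).add
    (hY'.mul (((continuousOn_const.mul (hη.pow 2)).sub continuousOn_const).mul hE)))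

lemma contDiff_profile {N : ℕ} (κ : ℝ) {X Y : (Fin N → ℝ) → ℝ} (hX : ContDiff ℝ 2 X)
    (hY : ContDiff ℝ 2 Y) (A ξ ℓ : ℝ) : ContDiff ℝ 2 (profile κ X Y A ξ ℓ) := by
  unfold profile
  fun_prop

/-- A Gaussian profile whose parameters evolve on the parabolic scale `ℓ` stays below the solution
as long as the reaction compensates for the explicit defect. -/
theorem Correctors.exists_ge_profile (c : Correctors h u X Y α C) (hh : 0 < h) (hM : 0 < M)
    {K : NNReal} (hf : LipschitzOnWith K f (Set.Icc 0 1)) {κ N : ℝ} (hκ : 0 < κ)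
    (hκ1 : κ ≤ 1) (hN : 1 ≤ N) :
    ∃ B, 1 ≤ B ∧ 8 * C ≤ κ * B ∧ ∀ (T0 : (Fin (m+1) → ℝ) → ℝ) (T : ℝ → (Fin (m+1) → ℝ) → ℝ),
      IsCylSol m h M u f T0 T → ∀ (t₀ t₁ a σ d : ℝ) (A ξ ℓ : ℝ → ℝ), 0 ≤ t₀ → t₀ ≤ t₁ →
      |a| ≤ N → |σ| ≤ N → |d| ≤ N →
      (∀ t ∈ Set.Icc t₀ t₁, 0 < A t ∧ B ≤ ℓ t ∧ HasDerivAt A (a * A t / ℓ t ^ 2) t ∧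
        HasDerivAt ξ (σ / ℓ t) t ∧ HasDerivAt ℓ (d / ℓ t) t) →
      (∀ z η, (X z - ξ t₀) / ℓ t₀ = η → η ^ 2 ≤ 2 / κ →
        profile κ X Y (A t₀) (ξ t₀) (ℓ t₀) z ≤ T t₀ z) →
      (∀ t ∈ Set.Icc t₀ t₁, ∀ z, profile κ X Y (A t) (ξ t) (ℓ t) z ≤ 1) →
      (∀ t ∈ Set.Icc t₀ t₁, ∀ z η, (X z - ξ t) / ℓ t = η →
        0 < profile κ X Y (A t) (ξ t) (ℓ t) z → κ / 2 ≤ Real.exp (-η ^ 2) →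
        A t / ℓ t ^ 2 * (a * (Real.exp (-η ^ 2) - κ) + Real.exp (-η ^ 2) *
          (2 * σ * η + 2 * d * η ^ 2 - 4 * α * η ^ 2 + 2 * α + B / ℓ t)) ≤
          M * f (profile κ X Y (A t) (ξ t) (ℓ t) z)) →
      ∀ t ∈ Set.Icc t₀ t₁, ∀ z, profile κ X Y (A t) (ξ t) (ℓ t) z ≤ T t z := by
  obtain ⟨B, hB1, hBC, hB⟩ := c.exists_profile_bound hκ hκ1 hN
  refine ⟨B, hB1, hBC, fun T0 T sol t₀ t₁ a σ d A ξ ℓ ht₀ ht₀₁ ha hσ hd hpar hinit hle hmain => ?_⟩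
  have hℓ0 : ∀ t ∈ Set.Icc t₀ t₁, 0 < ℓ t := fun t ht =>
    one_pos.trans_le (hB1.trans (hpar t ht).2.1)
  have hAc : ContinuousOn A (Set.Icc t₀ t₁) := fun t ht =>
    (hpar t ht).2.2.1.continuousAt.continuousWithinAt
  have hξc : ContinuousOn ξ (Set.Icc t₀ t₁) := fun t ht =>
    (hpar t ht).2.2.2.1.continuousAt.continuousWithinAt
  have hℓc : ContinuousOn ℓ (Set.Icc t₀ t₁) := fun t ht =>
    (hpar t ht).2.2.2.2.continuousAt.continuousWithinAt
  obtain ⟨R₁, hR₁⟩ := isCompact_Icc.exists_bound_of_continuousOn hξc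
  obtain ⟨R₂, hR₂⟩ := isCompact_Icc.exists_bound_of_continuousOn hℓc
  have hH1 : 1 ≤ 2 / κ := by rw [le_div_iff₀ hκ]; linarith
  refine sol.ge_of_subsolution hM hf ht₀ (isCompact_cylBox m h (R₁ + 2 / κ * R₂ + C))
    (continuousOn_profile κ c.smoothX.continuous c.smoothY.continuous hAc hξc hℓc
      fun t ht => (hℓ0 t ht).ne')
    (fun z => ?_) ?_ hle (fun t ht z => hasDerivAt_profile κ X Y (hpar t ⟨ht.1.le, ht.2⟩).2.2.1
      (hpar t ⟨ht.1.le, ht.2⟩).2.2.2.1 (hpar t ⟨ht.1.le, ht.2⟩).2.2.2.2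
      (hℓ0 t ⟨ht.1.le, ht.2⟩).ne' z)
    (fun t _ => contDiff_profile κ c.smoothX c.smoothY _ _ _) fun t ht z hz => ?_
  · rcases le_or_gt (profile κ X Y (A t₀) (ξ t₀) (ℓ t₀) z) 0 with hz | hz
    · exact hz.trans (sol.mem_Icc t₀ z ht₀).1
    · obtain ⟨hA, hBℓ, -⟩ := hpar t₀ ⟨le_rfl, ht₀₁⟩
      exact hinit z _ rfl (hB (A t₀) (ξ t₀) (ℓ t₀) a σ d z ha hσ hd hBℓ hA hz _ rfl).1
  · intro t ht z hz
    obtain ⟨hA, hBℓ, -⟩ := hpar t ht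
    obtain ⟨hη, -⟩ := hB (A t) (ξ t) (ℓ t) a σ d z ha hσ hd hBℓ hA hz _ rfl
    obtain ⟨z', hz0, hz', hper⟩ := exists_box_representative hh z
    refine ⟨z', mem_cylBox.2 ⟨?_, hz'⟩, ?_⟩
    · have h1 : |(X z - ξ t) / ℓ t| ≤ 2 / κ := abs_le_of_sq_le_sq (by nlinarith) (by linarith)
      rw [abs_div, abs_of_pos (hℓ0 t ht), div_le_iff₀ (hℓ0 t ht)] at h1
      have h2 : 2 / κ * ℓ t ≤ 2 / κ * R₂ :=
        mul_le_mul_of_nonneg_left ((le_abs_self _).trans (hR₂ t ht)) (by linarith)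
      have h3 := hR₁ t ht
      rw [Real.norm_eq_abs] at h3
      have h4 := abs_le.1 (c.closeX z)
      have h5 := abs_le.1 h1
      have h6 := abs_le.1 h3
      rw [hz0]
      exact abs_le.2 ⟨by linarith, by linarith⟩
    · have hX := hper X fun z j => c.periodicX z j
      have hY := hper Y fun z j => c.periodicY z j
      have hT := hper (T t) fun z j => sol.periodic t z (ht₀.trans ht.1) j
      rw [hT, profile, profile, hX, hY]
  · have ht' : t ∈ Set.Icc t₀ t₁ := ⟨ht.1.le, ht.2⟩
    obtain ⟨hA, hBℓ, -⟩ := hpar t ht'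
    refine (hB (A t) (ξ t) (ℓ t) a σ d z ha hσ hd hBℓ hA hz _ rfl).2.2.trans ?_
    have := hmain t ht' z _ rfl hz (hB (A t) (ξ t) (ℓ t) a σ d z ha hσ hd hBℓ hA hz _ rfl).2.1
    linarith

end ProfileComparison

section Spreading

variable {m : ℕ} {h M α C p : ℝ} {u : (Fin (m+1) → ℝ) → Fin (m+1) → ℝ}
  {X Y : (Fin (m+1) → ℝ) → ℝ} {f : ℝ → ℝ}

set_option maxHeartbeats 1000000 in
/-- A plateau of height `A₀` and width `ℓ` in the harmonic coordinate can be grown at rate `ν` and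
moved at speed `v` when it is large enough for the reaction to beat the diffusion. -/
theorem Correctors.exists_spread (c : Correctors h u X Y α C) (hh : 0 < h) (hM : 0 < M)
    {K : NNReal} (hf : LipschitzOnWith K f (Set.Icc 0 1))
    (hf_nonneg : ∀ s ∈ Set.Icc (0:ℝ) 1, 0 ≤ f s) (hp : 1 ≤ p)
    (hfp : ∀ δ > 0, ∃ c' > 0, ∀ s ∈ Set.Icc (0:ℝ) (1 - δ), c' * s ^ p ≤ f s) :
    ∃ μ ρ, 0 < μ ∧ 0 < ρ ∧ ∀ δ > 0, ∃ L C₄, 1 ≤ L ∧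
      ∀ (T0 : (Fin (m+1) → ℝ) → ℝ) (T : ℝ → (Fin (m+1) → ℝ) → ℝ), IsCylSol m h M u f T0 T →
      ∀ t₀ t₁ A₀ ν v ξ₀ ℓ : ℝ, 0 ≤ t₀ → t₀ ≤ t₁ → 0 < A₀ → L ≤ ℓ → 0 ≤ ν → ν * ℓ ^ 2 ≤ μ →
      |v| * ℓ ≤ μ → C₄ ≤ A₀ ^ (p - 1) * ℓ ^ 2 → A₀ * Real.exp (ν * (t₁ - t₀)) ≤ 1 - δ →
      (∀ z, |X z - ξ₀| ≤ ρ * ℓ → A₀ ≤ T t₀ z) →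
      ∀ z, X z = ξ₀ + v * (t₁ - t₀) → A₀ * Real.exp (ν * (t₁ - t₀)) - δ ≤ T t₁ z := by
  set κ := Real.exp (-1) / 2 with hκdef
  have hκ : 0 < κ := by positivity
  have hκ1 : κ ≤ 1 / 2 := by
    have := Real.exp_le_one_iff.2 (show (-1:ℝ) ≤ 0 by norm_num)
    linarith
  have hα := c.pos
  have hC := c.one_le
  obtain ⟨B, hB1, hBC, hB⟩ := c.exists_ge_profile hh hM hf hκ (by linarith) (le_refl (1:ℝ))
  refine ⟨min (α / 3) 1, 2 / κ, by positivity, by positivity, fun δ hδ => ?_⟩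
  obtain ⟨c', hc', hfc⟩ := hfp δ hδ
  refine ⟨max B (max (B / α) (16 * C / δ)), 8 * α / (M * c' * (κ / 2) ^ p),
    hB1.trans (le_max_left _ _), ?_⟩
  intro T0 T sol t₀ t₁ A₀ ν v ξ₀ ℓ ht₀ ht₀₁ hA₀ hLℓ hν hνμ hvμ hC₄ hA₁ hinit z hz
  have hBℓ : B ≤ ℓ := (le_max_left _ _).trans hLℓ
  have hBα : B / ℓ ≤ α := by
    have h1 : B / α ≤ ℓ := (le_max_left _ _).trans ((le_max_right _ _).trans hLℓ)
    rw [div_le_iff₀ hα] at h1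
    rw [div_le_iff₀ (by linarith)]
    linarith
  have hCδ : 16 * C / δ ≤ ℓ := (le_max_right _ _).trans ((le_max_right _ _).trans hLℓ)
  rw [div_le_iff₀ hδ] at hCδ
  have hℓ1 : 1 ≤ ℓ := hB1.trans hBℓ
  have hℓ0 : 0 < ℓ := by linarith
  have hℓsq : ℓ ≤ ℓ ^ 2 := by nlinarith
  set e := 4 * C / ℓ ^ 2 with he
  have he0 : 0 ≤ e := by positivity
  have heκ : e ≤ κ / 2 := by
    rw [he, div_le_iff₀ (by positivity)]
    have h1 : κ * B ≤ κ * ℓ ^ 2 := mul_le_mul_of_nonneg_left (hBℓ.trans hℓsq) hκ.le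
    linarith
  have heδ : 4 * e ≤ δ := by
    have h1 : e ≤ δ / 4 := by
      rw [he, div_le_iff₀ (by positivity)]
      have h1 : ℓ * δ ≤ ℓ ^ 2 * δ := mul_le_mul_of_nonneg_right hℓsq hδ.le
      linarith
    linarith
  set D := 1 - κ + e with hD
  have hD0 : 1 / 2 ≤ D := by linarith
  have hD1 : D ≤ 1 := by linarith
  let H : ℝ → ℝ := fun t => A₀ * Real.exp (ν * (t - t₀))
  have hH0 : ∀ t, 0 < H t := fun t => by positivity
  have hHA : ∀ t ∈ Set.Icc t₀ t₁, A₀ ≤ H t := fun t ht =>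
    le_mul_of_one_le_right hA₀.le (Real.one_le_exp (mul_nonneg hν (sub_nonneg.2 ht.1)))
  have hH1 : ∀ t ∈ Set.Icc t₀ t₁, H t ≤ 1 - δ := fun t ht => by
    refine le_trans ?_ hA₁
    have := ht.2
    simp only [H]
    gcongr
  have hHd : ∀ t, HasDerivAt H (ν * H t) t := fun t => by
    refine (((((hasDerivAt_id t).sub_const t₀).const_mul ν).exp).const_mul A₀).congr_deriv ?_
    simp only [H, id]
    ring
  have hup : ∀ t ξ z, profile κ X Y (H t / D) ξ ℓ z ≤ H t := fun t ξ z => by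
    have h1 := (abs_le.1 (c.abs_profile_sub_le κ ξ (ℓ := ℓ) (A := H t / D)
      (div_nonneg (hH0 t).le (by linarith)) z)).2
    have h2 : Real.exp (-((X z - ξ) / ℓ) ^ 2) ≤ 1 :=
      Real.exp_le_one_iff.2 (neg_nonpos.2 (sq_nonneg _))
    have h3 : H t / D * (Real.exp (-((X z - ξ) / ℓ) ^ 2) - κ + e) ≤ H t / D * D := by
      refine mul_le_mul_of_nonneg_left (by linarith) (div_nonneg (hH0 t).le (by linarith))
    rw [div_mul_cancel₀ _ (by linarith)] at h3
    linarith
  have hlow : ∀ t ξ z, H t / D * (Real.exp (-((X z - ξ) / ℓ) ^ 2) - κ - e) ≤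
      profile κ X Y (H t / D) ξ ℓ z := fun t ξ z => by
    have h1 := (abs_le.1 (c.abs_profile_sub_le κ ξ (ℓ := ℓ) (A := H t / D)
      (div_nonneg (hH0 t).le (by linarith)) z)).1
    linarith
  set μ := min (α / 3) 1
  have hμα : 3 * μ ≤ α := by linarith [min_le_left (α / 3) 1]
  have hμ1 : μ ≤ 1 := min_le_right _ _
  have hvl : |v * ℓ| ≤ μ := by rwa [abs_mul, abs_of_pos hℓ0]
  have ha0 : 0 ≤ ν * ℓ ^ 2 := by positivity
  have hμ0 : 0 ≤ μ := ha0.trans hνμ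
  have hkey := hB T0 T sol t₀ t₁ (ν * ℓ ^ 2) (v * ℓ) 0 (fun t => H t / D)
    (fun t => ξ₀ + v * (t - t₀)) (fun _ => ℓ) ht₀ ht₀₁
    (by rw [abs_of_nonneg ha0]; linarith) (hvl.trans hμ1) (by simp)
    (fun t _ => ⟨div_pos (hH0 t) (by linarith), hBℓ, ?_, ?_, ?_⟩) ?_ ?_ ?_ t₁ ⟨ht₀₁, le_rfl⟩ z
  · have h1 := hlow t₁ (ξ₀ + v * (t₁ - t₀)) z
    rw [hz, sub_self, zero_div, zero_pow two_ne_zero, neg_zero, Real.exp_zero] at h1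
    refine le_trans ?_ (h1.trans hkey)
    have hH := hH1 t₁ ⟨ht₀₁, le_rfl⟩
    have h2 : H t₁ / D ≤ 2 := by
      rw [div_le_iff₀ (by linarith)]; linarith
    have h3 : H t₁ / D * (1 - κ - e) = H t₁ - H t₁ / D * (2 * e) := by
      have : 1 - κ - e = D - 2 * e := by rw [hD]; ring
      rw [this, mul_sub, div_mul_cancel₀ _ (by linarith)]
    have h4 : H t₁ / D * (2 * e) ≤ 2 * (2 * e) := mul_le_mul_of_nonneg_right h2 (by linarith)
    rw [h3]
    simp only [H] at h4 ⊢
    linarith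
  · refine ((hHd t).div_const D).congr_deriv ?_
    field_simp
  · refine ((((hasDerivAt_id t).sub_const t₀).const_mul v).const_add ξ₀).congr_deriv ?_
    field_simp
  · simpa using hasDerivAt_const t ℓ
  · intro z η hη hηκ
    refine (hup t₀ _ z).trans ?_
    have h1 : H t₀ = A₀ := by simp [H]
    rw [h1]
    refine hinit z ?_
    have h2 : 1 ≤ 2 / κ := by rw [le_div_iff₀ hκ]; linarith
    have h3 : |η| ≤ 2 / κ := abs_le_of_sq_le_sq (by nlinarith) (by linarith)
    rw [← hη, abs_div, abs_of_pos hℓ0, div_le_iff₀ hℓ0] at h3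
    simpa using h3
  · intro t ht z
    exact (hup t _ z).trans (by linarith [hH1 t ht])
  · intro t ht z η hη hpos hηκ
    set w := profile κ X Y (H t / D) (ξ₀ + v * (t - t₀)) ℓ z with hw
    have hwH : w ≤ H t := hup t _ z
    have hl := hlow t (ξ₀ + v * (t - t₀)) z
    rw [hη] at hl
    set E := Real.exp (-η ^ 2)
    have hE0 : 0 < E := Real.exp_pos _
    have hE1 : E ≤ 1 := Real.exp_le_one_iff.2 (neg_nonpos.2 (sq_nonneg _))
    have hA : 0 < H t / D := div_pos (hH0 t) (by linarith)
    have ha : ν * ℓ ^ 2 * (E - κ) ≤ μ * E :=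
      (mul_le_mul_of_nonneg_left (by linarith : E - κ ≤ E) ha0).trans
        (mul_le_mul_of_nonneg_right hνμ hE0.le)
    have hση : 2 * (v * ℓ) * η ≤ 2 * (μ * |η|) := by
      have : v * ℓ * η ≤ μ * |η| := by
        refine (le_abs_self _).trans ?_
        rw [abs_mul]
        exact mul_le_mul_of_nonneg_right hvl (abs_nonneg _)
      linarith
    rcases le_total (η ^ 2) 1 with h1 | h1
    · have hE2 : 2 * κ ≤ E := by
        have : Real.exp (-1) ≤ E := Real.exp_le_exp.2 (by linarith)
        linarith
      have hη1 : |η| ≤ 1 := abs_le_of_sq_le_sq (by linarith) (by norm_num)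
      have hbr : ν * ℓ ^ 2 * (E - κ) + E * (2 * (v * ℓ) * η + 2 * 0 * η ^ 2 - 4 * α * η ^ 2
          + 2 * α + B / ℓ) ≤ 4 * α := by
        have h2 : 2 * (v * ℓ) * η + 2 * 0 * η ^ 2 - 4 * α * η ^ 2 + 2 * α + B / ℓ ≤
            2 * μ + 3 * α := by
          have h3 : μ * |η| ≤ μ := mul_le_of_le_one_right hμ0 hη1
          have h4 : 0 ≤ α * η ^ 2 := by positivity
          linarith
        have h5 := mul_le_mul_of_nonneg_left h2 hE0.le
        have h6 : E * (μ + 2 * μ + 3 * α) ≤ 1 * (μ + 2 * μ + 3 * α) :=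
          mul_le_mul_of_nonneg_right hE1 (by linarith)
        linarith
      have hwl : H t * (κ / 2) ≤ w := by
        refine le_trans ?_ hl
        have h2 : H t ≤ H t / D := by
          rw [le_div_iff₀ (by linarith)]
          exact mul_le_of_le_one_right (hH0 t).le hD1
        calc H t * (κ / 2) ≤ H t / D * (κ / 2) := mul_le_mul_of_nonneg_right h2 (by linarith)
          _ ≤ _ := mul_le_mul_of_nonneg_left (by linarith) hA.le
      have hfw : c' * (H t * (κ / 2)) ^ p ≤ f w :=
        (mul_le_mul_of_nonneg_left (Real.rpow_le_rpow (mul_nonneg (hH0 t).le (by linarith)) hwl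
          (by linarith)) hc'.le).trans (hfc w ⟨hpos.le, hwH.trans (hH1 t ht)⟩)
      rw [div_le_iff₀ (by positivity)] at hC₄
      have h2 : A₀ ^ (p - 1) ≤ H t ^ (p - 1) :=
        Real.rpow_le_rpow hA₀.le (hHA t ht) (by linarith)
      have h3 : 8 * α ≤ H t ^ (p - 1) * ℓ ^ 2 * (M * c' * (κ / 2) ^ p) :=
        hC₄.trans (by gcongr)
      have h4 : H t ^ p = H t ^ (p - 1) * H t := by
        rw [← Real.rpow_add_one (hH0 t).ne']; simp
      calc _ ≤ H t / D / ℓ ^ 2 * (4 * α) := mul_le_mul_of_nonneg_left hbr (by positivity)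
        _ ≤ 2 * H t / ℓ ^ 2 * (4 * α) := by
          have : H t / D ≤ 2 * H t := by
            rw [div_le_iff₀ (by linarith)]; linarith [mul_le_mul_of_nonneg_left hD0 (hH0 t).le]
          gcongr
        _ = H t / ℓ ^ 2 * (8 * α) := by ring
        _ ≤ H t / ℓ ^ 2 * (H t ^ (p - 1) * ℓ ^ 2 * (M * c' * (κ / 2) ^ p)) :=
          mul_le_mul_of_nonneg_left h3 (div_nonneg (hH0 t).le (by positivity))
        _ = M * (c' * (H t * (κ / 2)) ^ p) := by
          rw [Real.mul_rpow (hH0 t).le (by linarith), h4]; field_simp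
        _ ≤ M * f w := mul_le_mul_of_nonneg_left hfw hM.le
    · have hη1 : |η| ≤ η ^ 2 := by
        rw [← sq_abs] at h1 ⊢
        have : 1 ≤ |η| := by
          by_contra! hlt
          nlinarith [abs_nonneg η]
        nlinarith
      have hbr : 2 * (v * ℓ) * η + 2 * 0 * η ^ 2 - 4 * α * η ^ 2 + 2 * α + B / ℓ ≤ -μ := by
        have h3 : μ * |η| ≤ μ * η ^ 2 := mul_le_mul_of_nonneg_left hη1 hμ0
        have h4 : μ ≤ μ * η ^ 2 := le_mul_of_one_le_right hμ0 h1
        have h5 : 3 * μ * η ^ 2 ≤ α * η ^ 2 := mul_le_mul_of_nonneg_right hμα (by linarith)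
        have h6 : α ≤ α * η ^ 2 := le_mul_of_one_le_right hα.le h1
        linarith
      have h7 := mul_le_mul_of_nonneg_left hbr hE0.le
      refine (mul_nonpos_of_nonneg_of_nonpos (by positivity) (by linarith)).trans
        (mul_nonneg hM.le (hf_nonneg w ⟨hpos.le, hwH.trans ?_⟩))
      linarith [hH1 t ht]

end Spreading

section GaussianDecay

variable {m : ℕ} {h M α C : ℝ} {u : (Fin (m+1) → ℝ) → Fin (m+1) → ℝ}
  {X Y : (Fin (m+1) → ℝ) → ℝ} {f : ℝ → ℝ}
  {T0 : (Fin (m+1) → ℝ) → ℝ} {T : ℝ → (Fin (m+1) → ℝ) → ℝ}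

theorem IsCylSol.exists_pos_le (sol : IsCylSol m h M u f T0 T) (hh : 0 < h) (hM : 0 < M)
    {K : NNReal} (hf : LipschitzOnWith K f (Set.Icc 0 1))
    (hf_nonneg : ∀ s ∈ Set.Icc (0:ℝ) 1, 0 ≤ f s)
    (hu : ∀ z i, |u z i| ≤ C) {z₀ : Fin (m+1) → ℝ} (hz₀ : T0 z₀ ≠ 0)
    {τ : ℝ} (hτ : 0 < τ) (R : ℝ) : ∃ c₀ > 0, c₀ ≤ 1 ∧ ∀ z, |z 0| ≤ R → c₀ ≤ T τ z := by
  rcases (cylBox m h R).eq_empty_or_nonempty with he | hne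
  · refine ⟨1, one_pos, le_rfl, fun z hz => ?_⟩
    obtain ⟨w, hz0, hw, -⟩ := exists_box_representative hh z
    have : w ∈ cylBox m h R := mem_cylBox.2 ⟨hz0 ▸ hz, hw⟩
    simp [he] at this
  · obtain ⟨y, -, hy⟩ := (isCompact_cylBox m h R).exists_isMinOn hne
      (sol.spaceC2 τ hτ).continuous.continuousOn
    refine ⟨T τ y, sol.pos hM hf hf_nonneg hu hz₀ hτ y, (sol.mem_Icc τ y hτ.le).2,
      fun z hz => ?_⟩
    obtain ⟨w, hz0, hw, hper⟩ := exists_box_representative hh z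
    rw [← hper (T τ) fun z j => sol.periodic τ z hτ.le j]
    exact hy (mem_cylBox.2 ⟨hz0 ▸ hz, hw⟩)

/-- On the diffusive scale a nontrivial solution decays no faster than any power `t ^ (-β)` with
`β > 1 / 2`. -/
theorem Correctors.exists_rpow_le (c : Correctors h u X Y α C) (hh : 0 < h) (hM : 0 < M)
    {K : NNReal} (hf : LipschitzOnWith K f (Set.Icc 0 1))
    (hf_nonneg : ∀ s ∈ Set.Icc (0:ℝ) 1, 0 ≤ f s) {β : ℝ} (hβ : 1 / 2 < β) :
    ∃ r > 0, ∀ (T0 : (Fin (m+1) → ℝ) → ℝ) (T : ℝ → (Fin (m+1) → ℝ) → ℝ),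
      IsCylSol m h M u f T0 T → (∃ z, T0 z ≠ 0) →
      ∃ c₁ > 0, ∃ τ, 0 < τ ∧ ∀ t ≥ τ, ∀ z, X z ^ 2 ≤ r * t → c₁ * t ^ (-β) ≤ T t z := by
  have hα := c.pos
  have hC := c.one_le
  obtain ⟨ε, hε⟩ : ∃ ε, β = 1 / 2 + 2 * ε := ⟨(β - 1 / 2) / 2, by ring⟩
  have hε0 : 0 < ε := by linarith
  have hβ0 : 0 < β := by linarith
  obtain ⟨b, hb⟩ : ∃ b, 2 * α * b = 1 / 2 + ε := ⟨(1 / 2 + ε) / (2 * α), by field_simp⟩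
  have hb0 : 0 < b := by
    have : 0 < 2 * α * b := by linarith
    exact pos_of_mul_pos_right this (by linarith)
  set S := β / ε with hS
  have hS0 : 0 < S := by positivity
  set κ := Real.exp (-S) * (ε / (2 * β)) with hκ
  have hκ0 : 0 < κ := by positivity
  have hεβ : ε / (2 * β) ≤ 1 / 4 := by
    rw [div_le_iff₀ (by positivity)]; linarith
  have hκS : 4 * κ ≤ Real.exp (-S) := by
    have := mul_le_mul_of_nonneg_left hεβ (Real.exp_pos (-S)).le
    linarith
  have hS1 : Real.exp (-S) ≤ 1 := Real.exp_le_one_iff.2 (by linarith)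
  have hκ1 : κ ≤ 1 := by linarith
  obtain ⟨B, hB1, hBC, hB⟩ := c.exists_ge_profile hh hM hf hκ0 hκ1
    (le_max_left 1 (max (β / b) (1 / (2 * b))))
  refine ⟨S / b, by positivity, fun T0 T sol hne => ?_⟩
  obtain ⟨z₀, hz₀⟩ := hne
  set L := max B (2 * b * B / ε) with hL
  have hLB : B ≤ L := le_max_left _ _
  have hL1 : 1 ≤ L := hB1.trans hLB
  let τ := b * L ^ 2
  have hτ : 0 < τ := by positivity
  let ℓ : ℝ → ℝ := fun t => Real.sqrt (t / b)
  have hℓL : ∀ t, τ ≤ t → L ≤ ℓ t := fun t ht => by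
    refine Real.le_sqrt_of_sq_le ?_
    rw [le_div_iff₀ hb0]
    simp only [τ] at ht
    linarith
  have hℓ2 : ∀ t, τ ≤ t → ℓ t ^ 2 = t / b := fun t ht =>
    Real.sq_sqrt (div_nonneg (hτ.le.trans ht) hb0.le)
  have he : ∀ t, τ ≤ t → 4 * C / ℓ t ^ 2 ≤ κ / 2 := fun t ht => by
    have h1 := hℓL t ht
    have h0 : 0 < ℓ t := by linarith
    rw [div_le_iff₀ (pow_pos h0 2)]
    have h2 : B ≤ ℓ t ^ 2 := by nlinarith
    have h3 := mul_le_mul_of_nonneg_left h2 hκ0.le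
    linarith
  obtain ⟨c₀, hc₀, hc₀1, hmin⟩ := sol.exists_pos_le hh hM hf hf_nonneg c.bound_u hz₀ hτ
    (2 / κ * ℓ τ + C)
  set c₁ := c₀ * τ ^ β with hc₁
  have hc₁0 : 0 < c₁ := mul_pos hc₀ (Real.rpow_pos_of_pos hτ _)
  let A : ℝ → ℝ := fun t => c₁ * t ^ (-β)
  have hA0 : ∀ t, τ ≤ t → 0 < A t := fun t ht =>
    mul_pos hc₁0 (Real.rpow_pos_of_pos (hτ.trans_le ht) _)
  have hAτ : A τ = c₀ := by
    simp only [A, hc₁]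
    rw [mul_assoc, ← Real.rpow_add hτ]; simp
  have hA_le : ∀ t, τ ≤ t → A t ≤ c₀ := fun t ht => by
    rw [← hAτ]
    exact mul_le_mul_of_nonneg_left
      (Real.rpow_le_rpow_of_nonpos hτ ht (by linarith)) hc₁0.le
  have hup : ∀ t, τ ≤ t → ∀ z, profile κ X Y (A t) 0 (ℓ t) z ≤ A t := fun t ht z => by
    have h1 := (abs_le.1 (c.abs_profile_sub_le κ 0 (ℓ := ℓ t) (hA0 t ht).le z)).2
    have h2 : Real.exp (-((X z - 0) / ℓ t) ^ 2) ≤ 1 :=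
      Real.exp_le_one_iff.2 (neg_nonpos.2 (sq_nonneg _))
    have h3 : A t * (Real.exp (-((X z - 0) / ℓ t) ^ 2) - κ + 4 * C / ℓ t ^ 2) ≤ A t * 1 :=
      mul_le_mul_of_nonneg_left (by linarith [he t ht]) (hA0 t ht).le
    linarith
  refine ⟨c₁ * (κ / 2), by positivity, τ, hτ, fun t₁ ht₁ z hz => ?_⟩
  have hkey := hB T0 T sol τ t₁ (-β / b) 0 (1 / (2 * b)) A (fun _ => 0) ℓ hτ.le ht₁
    (by
      rw [abs_div, abs_neg, abs_of_pos hβ0, abs_of_pos hb0]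
      exact (le_max_left _ _).trans (le_max_right _ _))
    (by simp)
    (by
      rw [abs_of_pos (by positivity)]
      exact (le_max_right _ _).trans (le_max_right _ _))
    (fun t ht => ⟨hA0 t ht.1, hLB.trans (hℓL t ht.1), ?_, ?_, ?_⟩) ?_ ?_ ?_ t₁ ⟨ht₁, le_rfl⟩ z
  · refine le_trans ?_ hkey
    have h1 := (abs_le.1 (c.abs_profile_sub_le κ 0 (ℓ := ℓ t₁) (hA0 t₁ ht₁).le z)).1
    have h2 : Real.exp (-S) ≤ Real.exp (-((X z - 0) / ℓ t₁) ^ 2) := by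
      refine Real.exp_le_exp.2 (neg_le_neg ?_)
      rw [sub_zero, div_pow, hℓ2 t₁ ht₁, div_le_iff₀ (div_pos (hτ.trans_le ht₁) hb0)]
      calc X z ^ 2 ≤ S / b * t₁ := hz
        _ = S * (t₁ / b) := by ring
    have h3 : A t₁ * (κ / 2) ≤
        A t₁ * (Real.exp (-((X z - 0) / ℓ t₁) ^ 2) - κ - 4 * C / ℓ t₁ ^ 2) :=
      mul_le_mul_of_nonneg_left (by linarith [he t₁ ht₁]) (hA0 t₁ ht₁).le
    have h4 : c₁ * (κ / 2) * t₁ ^ (-β) = A t₁ * (κ / 2) := by simp only [A]; ring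
    linarith
  · have ht0 : 0 < t := hτ.trans_le ht.1
    refine ((Real.hasDerivAt_rpow_const (p := -β) (Or.inl ht0.ne')).const_mul c₁).congr_deriv ?_
    rw [hℓ2 t ht.1, Real.rpow_sub_one ht0.ne']
    simp only [A]
    field_simp
  · simpa using hasDerivAt_const t (0:ℝ)
  · have ht0 : 0 < t := hτ.trans_le ht.1
    refine (((hasDerivAt_id t).div_const b).sqrt (div_pos ht0 hb0).ne').congr_deriv ?_
    simp only [ℓ, id]
    have : Real.sqrt (t / b) ≠ 0 := (Real.sqrt_pos.2 (div_pos ht0 hb0)).ne'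
    field_simp
  · intro z η hη hηκ
    refine (hup τ le_rfl z).trans (hAτ.trans_le (hmin z ?_))
    have hℓ0 : 0 < ℓ τ := by linarith [hℓL τ le_rfl]
    have h2 : 1 ≤ 2 / κ := by rw [le_div_iff₀ hκ0]; linarith
    have h3 : |η| ≤ 2 / κ := abs_le_of_sq_le_sq (by nlinarith) (by linarith)
    rw [← hη, abs_div, abs_of_pos hℓ0, div_le_iff₀ hℓ0, sub_zero] at h3
    have h4 := abs_le.1 h3
    have h5 := abs_le.1 (c.closeX z)
    exact abs_le.2 ⟨by linarith, by linarith⟩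
  · intro t ht z
    linarith [hup t ht.1 z, hA_le t ht.1]
  · intro t ht z η hη hpos hEκ
    have hℓ := hℓL t ht.1
    have hℓ0 : 0 < ℓ t := by linarith
    have hA := hA0 t ht.1
    refine (mul_nonpos_of_nonneg_of_nonpos (by positivity) ?_).trans (mul_nonneg hM.le
      (hf_nonneg _ ⟨hpos.le, ?_⟩))
    · have hBℓ : b * (B / ℓ t) ≤ ε / 2 := by
        have h1 : 2 * b * B / ε ≤ ℓ t := (le_max_right _ _).trans hℓ
        rw [div_le_iff₀ hε0] at h1
        rw [← mul_div_assoc, div_le_iff₀ hℓ0]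
        linarith
      set E := Real.exp (-η ^ 2) with hE
      have hE0 : 0 < E := Real.exp_pos _
      have hmain : β * κ ≤ E * (ε / 2 + 2 * ε * η ^ 2) := by
        rcases le_total (η ^ 2) S with h1 | h1
        · have h2 : Real.exp (-S) ≤ E := Real.exp_le_exp.2 (by linarith)
          have h3 : β * κ = Real.exp (-S) * (ε / 2) := by rw [hκ]; field_simp
          rw [h3]
          exact mul_le_mul h2 (le_add_of_nonneg_right (by positivity)) (by positivity) hE0.le
        · have h2 : β ≤ ε * η ^ 2 := by
            rw [hS, div_le_iff₀ hε0] at h1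
            linarith
          have h3 : κ / 2 * (2 * β) ≤ E * (ε / 2 + 2 * ε * η ^ 2) :=
            mul_le_mul hEκ (by linarith) (by positivity) hE0.le
          linarith
      have hEB := mul_le_mul_of_nonneg_left hBℓ hE0.le
      refine nonpos_of_mul_nonpos_right (a := b) ?_ hb0
      have h5 : b * (-β / b * (E - κ) + E * (2 * 0 * η + 2 * (1 / (2 * b)) * η ^ 2
          - 4 * α * η ^ 2 + 2 * α + B / ℓ t)) = β * κ + E * (b * (B / ℓ t))
          - E * (β - 2 * α * b + (2 * (2 * α * b) - 1) * η ^ 2) := by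
        field_simp
        ring
      rw [hε] at hmain
      rw [h5, hb, hε]
      linarith
    · linarith [hup t ht.1 z, hA_le t ht.1]

end GaussianDecay

section LinearSpreading

lemma exists_mul_rpow_le {f : ℝ → ℝ} (hf : ContinuousOn f (Set.Icc 0 1)) (hf0 : f 0 = 0)
    (hf_pos : ∀ s ∈ Set.Ioo (0:ℝ) 1, 0 < f s) {c θ p : ℝ} (hc : 0 < c) (hθ : 0 < θ)
    (hfp : ∀ s ∈ Set.Icc (0:ℝ) θ, c * s ^ p ≤ f s) {p' : ℝ} (hpp' : p ≤ p') (hp' : 0 < p')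
    {δ : ℝ} (hδ : 0 < δ) : ∃ c' > 0, ∀ s ∈ Set.Icc (0:ℝ) (1 - δ), c' * s ^ p' ≤ f s := by
  obtain ⟨c₀, hc₀, hmin⟩ : ∃ c₀ > 0, ∀ s ∈ Set.Icc θ (1 - δ), c₀ ≤ f s := by
    rcases (Set.Icc θ (1 - δ)).eq_empty_or_nonempty with he | hne
    · exact ⟨1, one_pos, fun s hs => by simp [he] at hs⟩
    · obtain ⟨y, hy, hmin⟩ := isCompact_Icc.exists_isMinOn hne
        (hf.mono (Set.Icc_subset_Icc hθ.le (by linarith)))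
      exact ⟨f y, hf_pos y ⟨hθ.trans_le hy.1, by linarith [hy.2]⟩, fun s hs => hmin hs⟩
  refine ⟨min c c₀, lt_min hc hc₀, fun s hs => ?_⟩
  have hs1 : s ≤ 1 := by linarith [hs.2]
  rcases hs.1.eq_or_lt with rfl | hs0
  · simp [Real.zero_rpow hp'.ne', hf0]
  rcases le_total s θ with h | h
  · refine le_trans ?_ (hfp s ⟨hs0.le, h⟩)
    exact mul_le_mul (min_le_left _ _) (Real.rpow_le_rpow_of_exponent_ge hs0 hs1 hpp')
      (by positivity) hc.le
  · refine le_trans ?_ (hmin s ⟨h, hs.2⟩)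
    calc min c c₀ * s ^ p' ≤ c₀ * 1 :=
          mul_le_mul (min_le_right _ _) (Real.rpow_le_one hs0.le hs1 hp'.le) (by positivity) hc₀.le
      _ = c₀ := mul_one _

lemma exists_le_mul_sq {L : ℝ} (hL : 1 ≤ L) (C : ℝ) {a : ℝ} (ha : 0 < a) :
    ∃ ℓ, L ≤ ℓ ∧ C ≤ a * ℓ ^ 2 := by
  have h1 := le_max_left L (C / a)
  have h2 := le_max_right L (C / a)
  refine ⟨max L (C / a), h1, ?_⟩
  rw [div_le_iff₀' ha] at h2
  exact h2.trans (mul_le_mul_of_nonneg_left (by nlinarith) ha.le)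

variable {m : ℕ} {h M α C p : ℝ} {u : (Fin (m+1) → ℝ) → Fin (m+1) → ℝ}
  {X Y : (Fin (m+1) → ℝ) → ℝ} {f : ℝ → ℝ}

theorem Correctors.exists_linear_spreading (c : Correctors h u X Y α C) (hh : 0 < h) (hM : 0 < M)
    {K : NNReal} (hf : LipschitzOnWith K f (Set.Icc 0 1))
    (hf_nonneg : ∀ s ∈ Set.Icc (0:ℝ) 1, 0 ≤ f s) (hp : 1 < p) (hp3 : p < 3)
    (hfp : ∀ δ > 0, ∃ c' > 0, ∀ s ∈ Set.Icc (0:ℝ) (1 - δ), c' * s ^ p ≤ f s) :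
    ∃ γ > 0, ∀ (T0 : (Fin (m+1) → ℝ) → ℝ) (T : ℝ → (Fin (m+1) → ℝ) → ℝ),
      IsCylSol m h M u f T0 T → (∃ z, T0 z ≠ 0) →
      ∀ ε > 0, ∃ t₀, ∀ t ≥ t₀, ∀ z, |z 0| ≤ γ * t → 1 - ε ≤ T t z := by
  obtain ⟨μ, ρ, hμ, hρ, hspread⟩ := c.exists_spread hh hM hf hf_nonneg hp.le hfp
  have hgrow : ∀ δ > 0, ∃ L C₄, 1 ≤ L ∧
      ∀ (T0 : (Fin (m+1) → ℝ) → ℝ) (T : ℝ → (Fin (m+1) → ℝ) → ℝ), IsCylSol m h M u f T0 T →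
      ∀ t₀ A₀ A₁ ℓ : ℝ, 0 ≤ t₀ → 0 < A₀ → L ≤ ℓ → C₄ ≤ A₀ ^ (p - 1) * ℓ ^ 2 → A₀ ≤ A₁ →
      A₁ ≤ 1 - δ → ∀ z, (∀ z', |X z' - X z| ≤ ρ * ℓ → A₀ ≤ T t₀ z') →
      A₁ - δ ≤ T (t₀ + Real.log (A₁ / A₀) / (μ / ℓ ^ 2)) z := by
    intro δ hδ
    obtain ⟨L, C₄, hL1, hL⟩ := hspread δ hδ
    refine ⟨L, C₄, hL1, fun T0 T sol t₀ A₀ A₁ ℓ ht₀ hA₀ hLℓ hC hA hA₁ z hz => ?_⟩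
    have hℓ0 : 0 < ℓ := by linarith
    have hν : 0 < μ / ℓ ^ 2 := by positivity
    have hlog : 0 ≤ Real.log (A₁ / A₀) := Real.log_nonneg (by rw [le_div_iff₀ hA₀]; linarith)
    have hA₁0 : 0 < A₁ := hA₀.trans_le hA
    have hexp : A₀ * Real.exp (μ / ℓ ^ 2 *
        (t₀ + Real.log (A₁ / A₀) / (μ / ℓ ^ 2) - t₀)) = A₁ := by
      rw [add_sub_cancel_left, mul_div_cancel₀ _ hν.ne', Real.exp_log (by positivity)]
      field_simp
    have := hL T0 T sol t₀ (t₀ + Real.log (A₁ / A₀) / (μ / ℓ ^ 2)) A₀ (μ / ℓ ^ 2) 0 (X z) ℓ ht₀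
      (le_add_of_nonneg_right (by positivity)) hA₀ hLℓ hν.le
      (by rw [div_mul_cancel₀ _ (by positivity)]) (by simpa using hμ.le) hC
      (by rw [hexp]; exact hA₁) hz z (by simp)
    rwa [hexp] at this
  obtain ⟨L₁, C₁, hL₁, hmove⟩ := hspread (1 / 8) (by norm_num)
  obtain ⟨ℓ₁, hℓ₁L, hℓ₁C⟩ : ∃ ℓ₁, L₁ ≤ ℓ₁ ∧ C₁ ≤ (1 / 2 : ℝ) ^ (p - 1) * ℓ₁ ^ 2 :=
    exists_le_mul_sq hL₁ C₁ (by positivity)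
  have hℓ₁ : 0 < ℓ₁ := by linarith
  set σ := μ / ℓ₁ with hσ
  have hσ0 : 0 < σ := by positivity
  refine ⟨σ / 2, by positivity, fun T0 T sol hne => ?_⟩
  obtain ⟨t₁, ht₁, hplateau⟩ : ∃ t₁, 0 ≤ t₁ ∧ ∀ z, |X z| ≤ ρ * ℓ₁ → 1 / 2 ≤ T t₁ z := by
    obtain ⟨β, hβ, hβp⟩ : ∃ β, 1 / 2 < β ∧ β * (p - 1) < 1 := by
      have h1 : 1 / 2 < 1 / (p - 1) := by
        rw [div_lt_div_iff₀ (by norm_num) (by linarith)]; linarith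
      obtain ⟨β, h2, h3⟩ := exists_between h1
      exact ⟨β, h2, by rwa [lt_div_iff₀ (by linarith)] at h3⟩
    obtain ⟨r, hr, hdecay⟩ := c.exists_rpow_le hh hM hf hf_nonneg hβ
    obtain ⟨c₁, hc₁, τ, hτ, hT⟩ := hdecay T0 T sol hne
    obtain ⟨L, C₄, hL, hg⟩ := hgrow (1 / 8) (by norm_num)
    have ev₁ : ∀ᶠ t : ℝ in Filter.atTop, c₁ * t ^ (-β) ≤ 3 / 4 := by
      have h1 := (tendsto_rpow_neg_atTop (y := β) (by linarith)).const_mul c₁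
      rw [mul_zero] at h1
      exact h1.eventually (ge_mem_nhds (by norm_num))
    have ev₂ : ∀ᶠ t : ℝ in Filter.atTop,
        C₄ / (c₁ ^ (p - 1) * (r / (4 * ρ ^ 2))) ≤ t ^ (1 - β * (p - 1)) :=
      (tendsto_rpow_atTop (by linarith)).eventually_ge_atTop _
    have ev₃ : ∀ᶠ t : ℝ in Filter.atTop, L ≤ Real.sqrt (r * t) / (2 * ρ) := by
      refine Filter.Tendsto.eventually_ge_atTop (Filter.Tendsto.atTop_div_const (by positivity) ?_) _
      exact Real.tendsto_sqrt_atTop.comp (Filter.tendsto_id.const_mul_atTop hr)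
    have ev₄ : ∀ᶠ t : ℝ in Filter.atTop, 2 * (ρ * ℓ₁) ≤ Real.sqrt (r * t) :=
      (Real.tendsto_sqrt_atTop.comp (Filter.tendsto_id.const_mul_atTop hr)).eventually_ge_atTop _
    obtain ⟨t, h1, h2, h3, h4, htτ⟩ := (ev₁.and (ev₂.and (ev₃.and (ev₄.and
      (Filter.eventually_ge_atTop τ))))).exists
    have ht0 : 0 < t := hτ.trans_le htτ
    have hsq : Real.sqrt (r * t) ^ 2 = r * t := Real.sq_sqrt (by positivity)
    set q := Real.sqrt (r * t)
    have hA0 : 0 < c₁ * t ^ (-β) := mul_pos hc₁ (Real.rpow_pos_of_pos ht0 _)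
    refine ⟨_, ?_, fun z hz => le_trans (by norm_num) (hg T0 T sol t (c₁ * t ^ (-β)) (3 / 4)
      (q / (2 * ρ)) ht0.le hA0 h3 ?_ h1 (by norm_num) z fun z' hz' => hT t htτ z' ?_)⟩
    · have : 0 ≤ Real.log (3 / 4 / (c₁ * t ^ (-β))) :=
        Real.log_nonneg (by rw [le_div_iff₀ hA0]; linarith)
      positivity
    · rw [div_le_iff₀ (by positivity)] at h2
      refine h2.trans_eq ?_
      rw [Real.mul_rpow hc₁.le (Real.rpow_nonneg ht0.le _), ← Real.rpow_mul ht0.le, div_pow, hsq,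
        show 1 - β * (p - 1) = -β * (p - 1) + 1 by ring, Real.rpow_add_one ht0.ne']
      field_simp
      norm_num
    · have h5 : ρ * (q / (2 * ρ)) = q / 2 := by field_simp
      rw [h5] at hz'
      have h6 : |X z'| ≤ q := by
        have := abs_add_le (X z' - X z) (X z)
        rw [sub_add_cancel] at this
        linarith
      calc X z' ^ 2 = |X z'| ^ 2 := (sq_abs _).symm
        _ ≤ q ^ 2 := pow_le_pow_left₀ (abs_nonneg _) h6 2
        _ = r * t := hsq
  have hcone : ∀ t ≥ t₁, ∀ z, |X z| ≤ σ * (t - t₁) → 3 / 8 ≤ T t z := by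
    intro t ht z hz
    have hv : X z = X z / (t - t₁) * (t - t₁) := by
      rcases ht.eq_or_lt with rfl | hlt
      · rw [sub_self, mul_zero] at hz
        simpa using hz
      · rw [div_mul_cancel₀ _ (by linarith)]
    have := hmove T0 T sol t₁ t (1 / 2) 0 (X z / (t - t₁)) 0 ℓ₁ ht₁ ht (by norm_num) hℓ₁L le_rfl
      (by simpa using hμ.le) ?_ hℓ₁C (by norm_num) (by simpa using hplateau) z (by simpa using hv)
    · refine le_trans ?_ this
      norm_num
    · have h1 : |X z / (t - t₁)| ≤ σ := by
        rw [abs_div, abs_of_nonneg (sub_nonneg.2 ht)]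
        exact div_le_of_le_mul₀ (sub_nonneg.2 ht) hσ0.le hz
      calc |X z / (t - t₁)| * ℓ₁ ≤ σ * ℓ₁ := mul_le_mul_of_nonneg_right h1 hℓ₁.le
        _ = μ := div_mul_cancel₀ _ hℓ₁.ne'
  intro ε hε
  set δ := min ε (1 / 2) / 2 with hδ
  have hδ0 : 0 < δ := by positivity
  have hδε : 2 * δ ≤ ε := by linarith [min_le_left ε (1 / 2)]
  have hδ4 : δ ≤ 1 / 4 := by linarith [min_le_right ε (1 / 2)]
  obtain ⟨L, C₄, hL, hg⟩ := hgrow δ hδ0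
  obtain ⟨ℓ, hℓL, hℓC⟩ : ∃ ℓ, L ≤ ℓ ∧ C₄ ≤ (3 / 8 : ℝ) ^ (p - 1) * ℓ ^ 2 :=
    exists_le_mul_sq hL C₄ (by positivity)
  have hℓ0 : 0 < ℓ := by linarith
  set s := Real.log ((1 - δ) / (3 / 8)) / (μ / ℓ ^ 2) with hs
  have hs0 : 0 ≤ s := by
    have : 0 ≤ Real.log ((1 - δ) / (3 / 8)) :=
      Real.log_nonneg (by rw [le_div_iff₀ (by norm_num)]; linarith)
    positivity
  refine ⟨2 * (C + ρ * ℓ + σ * (s + t₁)) / σ, fun t ht z hz => ?_⟩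
  rw [ge_iff_le, div_le_iff₀ hσ0] at ht
  have hC := c.one_le
  have hρℓ : 0 < ρ * ℓ := by positivity
  have htst : s + t₁ ≤ t := by
    have h1 : 0 ≤ σ * (s + t₁) := by positivity
    have h2 : σ * (s + t₁) ≤ σ * t := by linarith
    exact le_of_mul_le_mul_left h2 hσ0
  have := hg T0 T sol (t - s) (3 / 8) (1 - δ) ℓ (by linarith) (by norm_num) hℓL hℓC (by linarith)
    le_rfl z fun z' hz' => hcone (t - s) (by linarith) z' ?_
  · rw [← hs, sub_add_cancel] at this
    linarith
  · have h1 := abs_le.1 hz'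
    have h2 := abs_le.1 (c.closeX z)
    have h3 := abs_le.1 hz
    exact abs_le.2 ⟨by linarith, by linarith⟩

end LinearSpreading

section UpperBound

lemma gen_exp_coord_le {N : ℕ} {u : (Fin N → ℝ) → Fin N → ℝ} {C a b s : ℝ}
    (hu : ∀ z i, |u z i| ≤ C) (hs : s = 1 ∨ s = -1) (i : Fin N) (z : Fin N → ℝ) :
    gen u (fun z => Real.exp (a + s * z i) + Real.exp (b - s * z i)) z ≤
      (1 + C) * (Real.exp (a + s * z i) + Real.exp (b - s * z i)) := by
  have h₁ : ∀ x, HasDerivAt (fun x => Real.exp (a + s * x) + Real.exp (b - s * x))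
      (s * (Real.exp (a + s * x) - Real.exp (b - s * x))) x := fun x => by
    refine ((((hasDerivAt_id x).const_mul s).const_add a).exp.add
      (((hasDerivAt_id x).const_mul s).const_sub b).exp).congr_deriv ?_
    simp only [id]
    ring
  have h₂ : ∀ x, HasDerivAt (fun x => s * (Real.exp (a + s * x) - Real.exp (b - s * x)))
      (Real.exp (a + s * x) + Real.exp (b - s * x)) x := fun x => by
    refine (((((hasDerivAt_id x).const_mul s).const_add a).exp.sub
      (((hasDerivAt_id x).const_mul s).const_sub b).exp).const_mul s).congr_deriv ?_
    simp only [id]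
    rcases hs with rfl | rfl <;> ring
  have hsq : ∑ j, pd j (fun z : Fin N → ℝ => z i) z ^ 2 = 1 := by
    simp [pd_coord]
  have hgen : gen u (fun z : Fin N → ℝ => z i) z = -u z i := by
    have h0 : ∀ j, pd j (pd j (fun z : Fin N → ℝ => z i)) z = 0 := fun j => by
      rw [show pd j (fun z : Fin N → ℝ => z i) = fun _ => if j = i then 1 else 0 from
        funext (pd_coord j i)]
      simp [pd]
    simp [gen, lap, h0, pd_coord]
  rw [gen_comp (f := fun z : Fin N → ℝ => z i) (by fun_prop) h₁ h₂, hsq, hgen]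
  have hu1 := abs_le.1 (hu z i)
  have e1 := Real.exp_pos (a + s * z i)
  have e2 := Real.exp_pos (b - s * z i)
  set x := Real.exp (a + s * z i)
  set y := Real.exp (b - s * z i)
  rcases hs with rfl | rfl
  · nlinarith
  · nlinarith

variable {m : ℕ} {h M : ℝ} {u : (Fin (m+1) → ℝ) → Fin (m+1) → ℝ} {f : ℝ → ℝ}
  {T0 : (Fin (m+1) → ℝ) → ℝ} {T : ℝ → (Fin (m+1) → ℝ) → ℝ}

theorem IsCylSol.le_exp (sol : IsCylSol m h M u f T0 T) (hh : 0 < h) (hM : 0 < M) {K : NNReal}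
    (hf : LipschitzOnWith K f (Set.Icc 0 1)) (hf0 : f 0 = 0) {C : ℝ} (hC : 0 ≤ C)
    (hu : ∀ z i, |u z i| ≤ C) {L : ℝ} (hL : ∀ z, L ≤ |z 0| → T0 z = 0) {s : ℝ}
    (hs : s = 1 ∨ s = -1) {t : ℝ} (ht : 0 ≤ t) (z : Fin (m+1) → ℝ) :
    T t z ≤ Real.exp (L + s * z 0 + (1 + C + M * K) * t) := by
  set γ := 1 + C + M * K with hγ
  have hγ0 : 0 ≤ γ := by positivity
  let w : ℝ → ℝ → (Fin (m+1) → ℝ) → ℝ := fun a t z =>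
    Real.exp ((L + γ * t) + s * z 0) + Real.exp ((a + γ * t) - s * z 0)
  have hsabs : ∀ x : ℝ, |s * x| = |x| := fun x => by
    rcases hs with rfl | rfl <;> simp
  have hkey : ∀ a, 0 ≤ w a t z - T t z := by
    intro a
    have hwc : Continuous fun p : ℝ × (Fin (m+1) → ℝ) => w a p.1 p.2 := by
      simp only [w]; fun_prop
    have hwz : ∀ t, ContDiff ℝ 2 (w a t) := fun t => by simp only [w]; fun_prop
    have hwt : ∀ t z, HasDerivAt (fun t => w a t z) (γ * w a t z) t := fun t z => by
      refine ((((((hasDerivAt_id t).const_mul γ).const_add L).add_const (s * z 0)).exp).add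
        (((((hasDerivAt_id t).const_mul γ).const_add a).sub_const (s * z 0)).exp)).congr_deriv ?_
      simp only [w, id]
      ring
    refine parabolic_nonneg (D := fun t z => w a t z - T t z) (κ := M * K) (u := u) (t₀ := 0)
      (t₁ := t) (isCompact_cylBox m h (|L| + |a|))
      (hwc.continuousOn.sub (sol.cont.mono fun p hp => hp.1.1)) (fun z => ?_)
      (fun t ht z hz => ?_)
      (fun t ht z => (hwt t z).differentiableAt.sub (sol.timeDiff t z ht.1))
      (fun t ht => (hwz t).sub (sol.spaceC2 t ht.1)) (fun t ht z hz => ?_) t ⟨ht, le_rfl⟩ z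
    · rw [sub_nonneg]
      rcases le_total L (|z 0|) with h1 | h1
      · rw [sol.init, hL z h1]
        positivity
      · refine (sol.mem_Icc 0 z le_rfl).2.trans ?_
        have h2 := abs_le.1 (hsabs (z 0)).le
        have h3 : 1 ≤ Real.exp ((L + γ * 0) + s * z 0) := Real.one_le_exp (by linarith)
        have h4 := Real.exp_pos ((a + γ * 0) - s * z 0)
        linarith
    · have hw1 : w a t z < 1 := by linarith [(sol.mem_Icc t z ht.1).2]
      have h1 : (L + γ * t) + s * z 0 < 0 := by
        rw [← Real.exp_lt_one_iff]
        linarith [Real.exp_pos ((a + γ * t) - s * z 0)]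
      have h2 : (a + γ * t) - s * z 0 < 0 := by
        rw [← Real.exp_lt_one_iff]
        linarith [Real.exp_pos ((L + γ * t) + s * z 0)]
      have hγt : 0 ≤ γ * t := mul_nonneg hγ0 ht.1
      obtain ⟨z', hz0, hz', hper⟩ := exists_box_representative hh z
      refine ⟨z', mem_cylBox.2 ⟨?_, hz'⟩, ?_⟩
      · rw [hz0, ← hsabs]
        exact abs_le.2 ⟨by linarith [neg_abs_le a, abs_nonneg L],
          by linarith [neg_abs_le L, abs_nonneg a]⟩
      · have hT := hper (T t) fun z j => sol.periodic t z ht.1 j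
        simp only [hT, w, hz0, le_refl]
    · have h1 := gen_sub (u := u) (z := z) (hwz t) (sol.spaceC2 t ht.1)
      have h2 : gen u (w a t) z ≤ (1 + C) * w a t z :=
        gen_exp_coord_le (a := L + γ * t) (b := a + γ * t) hu hs 0 z
      have h3 := hf.dist_le_mul _ (sol.mem_Icc t z ht.1.le) 0 ⟨le_rfl, zero_le_one⟩
      rw [hf0, Real.dist_eq, Real.dist_eq, sub_zero, sub_zero,
        abs_of_nonneg (sol.mem_Icc t z ht.1.le).1] at h3
      have h4 := mul_le_mul_of_nonneg_left ((le_abs_self _).trans h3) hM.le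
      rw [deriv_fun_sub (hwt t z).differentiableAt (sol.timeDiff t z ht.1), (hwt t z).deriv,
        sol.deriv_eq ht.1]
      rw [gen] at h1
      have h5 : γ * w a t z = (1 + C) * w a t z + M * K * w a t z := by rw [hγ]; ring
      rw [h5, mul_sub]
      linarith
  have hlim : Filter.Tendsto (fun a => w a t z - T t z) Filter.atBot
      (nhds (Real.exp (L + s * z 0 + γ * t) - T t z)) := by
    have h1 : Filter.Tendsto (fun a => Real.exp ((a + γ * t) - s * z 0)) Filter.atBot (nhds 0) := by
      refine Real.tendsto_exp_atBot.comp ?_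
      simp only [add_sub_assoc]
      exact Filter.tendsto_atBot_add_const_right _ _ Filter.tendsto_id
    have h2 := (h1.const_add (Real.exp ((L + γ * t) + s * z 0))).sub_const (T t z)
    rw [add_zero] at h2
    rwa [add_right_comm L (s * z 0)]
  exact sub_nonneg.1 (ge_of_tendsto' hlim hkey)

end UpperBound

/-- If `f(T) ≥ c T^p` on `[0,θ]` for some `p < 3`, then (a) only the trivial
solution quenches, and (b) there are `0 < γ₁ < γ₂ < ∞` such that every solution with a
compactly supported (in `x`) initial datum `0 ≤ T₀ ≤ 1`, `T₀ ≢ 0`, spreads with speed at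
least `γ₁` and at most `γ₂`. -/
theorem quenching_paper_stmt2
    (m : ℕ) (hm : 1 ≤ m) (h M : ℝ) (hh : 0 < h) (hM : 0 < M)
    (u : (Fin (m+1) → ℝ) → Fin (m+1) → ℝ)
    (hu_smooth : ContDiff ℝ (⊤ : ℕ∞) u)
    (hu_div : ∀ z, ∑ i, pd i (fun w => u w i) z = 0)
    (hu_per : ∀ z (i : Fin (m+1)), u (z + Pi.single i h) = u z)
    (hu_mean : ∀ i, ∫ z in Set.univ.pi fun _ : Fin (m+1) => Set.Ico (0:ℝ) h, u z i = 0)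
    (f : ℝ → ℝ) (hf_lip : ∃ K, LipschitzOnWith K f (Set.Icc 0 1))
    (hf0 : f 0 = 0) (hf1 : f 1 = 0) (hf_pos : ∀ s ∈ Set.Ioo (0:ℝ) 1, 0 < f s)
    (c θ p : ℝ) (hc : 0 < c) (hθ : 0 < θ) (hp : p < 3)
    (hfp : ∀ s ∈ Set.Icc (0:ℝ) θ, c * s ^ p ≤ f s) :
    -- (a) quenching forces a trivial initial datum
    ((∀ (T0 : (Fin (m+1) → ℝ) → ℝ) (T : ℝ → (Fin (m+1) → ℝ) → ℝ),
        IsCylSol m h M u f T0 T → CylQuenches m T → ∀ z, T0 z = 0) ∧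
    -- (b) spreading for nontrivial compactly supported initial data
     (∃ γ₁ γ₂ : ℝ, 0 < γ₁ ∧ γ₁ < γ₂ ∧
        ∀ (T0 : (Fin (m+1) → ℝ) → ℝ) (T : ℝ → (Fin (m+1) → ℝ) → ℝ),
          IsCylSol m h M u f T0 T →
          (∀ z, T0 z ∈ Set.Icc (0:ℝ) 1) →
          (∃ L : ℝ, ∀ z, L ≤ |z 0| → T0 z = 0) →
          (∃ z, T0 z ≠ 0) →
          ((∀ ε > (0:ℝ), ∃ t₀ : ℝ, ∀ t ≥ t₀, ∀ z, |z 0| ≤ γ₁ * t → 1 - ε ≤ T t z) ∧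
           (∀ ε > (0:ℝ), ∃ t₀ : ℝ, ∀ t ≥ t₀, ∀ z, γ₂ * t ≤ |z 0| → T t z ≤ ε)))) := by
  obtain ⟨K, hK⟩ := hf_lip
  obtain ⟨X, Y, α, C, hcor⟩ := exists_correctors hh hu_smooth hu_div hu_per hu_mean
  have hf_nonneg : ∀ s ∈ Set.Icc (0:ℝ) 1, 0 ≤ f s := fun s hs => by
    rcases hs.1.eq_or_lt with rfl | h0
    · exact hf0.ge
    rcases hs.2.eq_or_lt with rfl | h1
    · exact hf1.ge
    · exact (hf_pos s ⟨h0, h1⟩).le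
  obtain ⟨γ, hγ, hspread⟩ := hcor.exists_linear_spreading (p := max p 2) hh hM hK hf_nonneg
    (lt_max_of_lt_right one_lt_two) (max_lt hp (by norm_num)) fun δ hδ =>
      exists_mul_rpow_le hK.continuousOn hf0 hf_pos hc hθ hfp (le_max_left p 2)
        (lt_max_of_lt_right two_pos) hδ
  have hC : 0 ≤ C := zero_le_one.trans hcor.one_le
  refine ⟨fun T0 T sol hq z => ?_, γ, max γ (1 + C + M * K) + 1, hγ,
    (le_max_left _ _).trans_lt (lt_add_one _), fun T0 T sol _ hL hne =>
      ⟨hspread T0 T sol hne, fun ε hε => ?_⟩⟩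
  · by_contra hz
    obtain ⟨t₀, h₀⟩ := hspread T0 T sol ⟨z, hz⟩ (1 / 4) (by norm_num)
    obtain ⟨t₁, h₁⟩ := hq (1 / 2) (by norm_num)
    have h2 := h₀ (max 0 (max t₀ t₁)) (by simp) 0 (by simpa using by positivity)
    have h3 := h₁ (max 0 (max t₀ t₁)) (by simp) 0
    linarith
  · obtain ⟨L, hL⟩ := hL
    refine ⟨max 0 (L - Real.log ε), fun t ht z hz => ?_⟩
    have ht0 : 0 ≤ t := (le_max_left _ _).trans ht
    have htL : L - Real.log ε ≤ t := (le_max_right _ _).trans ht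
    obtain ⟨s, hs, hsz⟩ : ∃ s : ℝ, (s = 1 ∨ s = -1) ∧ s * z 0 = -|z 0| := by
      rcases le_total 0 (z 0) with h0 | h0
      · exact ⟨-1, Or.inr rfl, by rw [abs_of_nonneg h0]; ring⟩
      · exact ⟨1, Or.inl rfl, by rw [abs_of_nonpos h0]; ring⟩
    refine (sol.le_exp hh hM hK hf0 hC hcor.bound_u hL hs ht0 z).trans ?_
    rw [← Real.le_log_iff_exp_le hε, hsz]
    have h1 := mul_le_mul_of_nonneg_right (le_max_right γ (1 + C + M * K)) ht0
    linarith
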